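/- arXiv:1009.4996 — 5 statements merged into one kernel-verified Lean document; each statement's English description precedes it below -/
import Mathlib

section
/- For every s > 0 and every t₀ > 0, the function t ↦ (1/Γ(α)) ∫₀^t (t−τ)^{α−1} φ_{τ,α}(s) dτ is differentiable at t = t₀, and its derivative there equals ψ_{t₀,α}(s) := t₀⁻¹ ∑_{k=1}^∞ (−s t₀^{−α})ᵏ/(k! Γ(−αk)). In other words, the Riemann–Liouville derivative D_{0+,t}^{1−α} of t ↦ φ_{t,α}(s) equals t⁻¹ · ₀Ψ₁[ −; (0,−α) | −s t^{−α} ]. -/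
open Real

/-- The Wright function `Φ_α(ζ) = ∑_{k=0}^∞ (-ζ)^k / (k! Γ(1 - α - α k))`. -/
noncomputable def wrightPhi (α : ℝ) (ζ : ℝ) : ℝ :=
  ∑' k : ℕ, (-ζ) ^ k / (k.factorial * Real.Gamma (1 - α - α * k))

/-- `φ_{t,α}(s) = t^{-α} Φ_α (s t^{-α})`. -/
noncomputable def phiSub (α t s : ℝ) : ℝ := t ^ (-α) * wrightPhi α (s * t ^ (-α))

/-- `ψ_{t,α}(s) = t⁻¹ ∑_{k=1}^∞ (-s t^{-α})^k / (k! Γ(-α k))`,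
the Wright function `t⁻¹ ₀Ψ₁[ -; (0,-α) | -s t^{-α} ]`. -/
noncomputable def psiSub (α t s : ℝ) : ℝ :=
  t⁻¹ * ∑' k : ℕ, (-(s * t ^ (-α))) ^ (k + 1) /
    ((k + 1).factorial * Real.Gamma (-(α * (k + 1))))

theorem summable_pow_div_factorial_mul_Gamma {α b : ℝ} (hα : α ∈ Set.Ioo (0 : ℝ) 1) (hb : 0 < b)
    (x : ℝ) :
    Summable fun k : ℕ => x ^ k / k.factorial * Real.Gamma (α * k + b) := by
  obtain ⟨hα0, hα1⟩ := hα
  have hlim : Filter.Tendsto (fun k : ℕ => |x| * (1 + b) ^ α * ((k : ℝ) + 1) ^ (-(1 - α)))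
      Filter.atTop (nhds (|x| * (1 + b) ^ α * 0)) := by
    refine Filter.Tendsto.const_mul _ ?_
    exact (tendsto_rpow_neg_atTop (by linarith)).comp
      (Filter.tendsto_atTop_add_const_right _ _ tendsto_natCast_atTop_atTop)
  rw [mul_zero] at hlim
  refine summable_of_ratio_norm_eventually_le (r := 1 / 2) (by norm_num) ?_
  filter_upwards [hlim.eventually (ge_mem_nhds (show (0 : ℝ) < 1 / 2 by norm_num))] with k hk
  have hk1 : (0 : ℝ) < (k : ℝ) + 1 := by positivity
  have ha : 0 < α * k + b := by positivity
  have hG : 0 < Real.Gamma (α * k + b) := Real.Gamma_pos_of_pos ha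
  have hG' : 0 < Real.Gamma (α * (k + 1 : ℕ) + b) := Real.Gamma_pos_of_pos (by positivity)
  have hstep : Real.Gamma (α * (k + 1 : ℕ) + b)
      ≤ (α * k + b) ^ α * Real.Gamma (α * k + b) := by
    have h := Real.Gamma_mul_add_mul_le_rpow_Gamma_mul_rpow_Gamma ha
      (show 0 < α * k + b + 1 by positivity) (show 0 < 1 - α by linarith) hα0 (by ring)
    rw [Real.Gamma_add_one ha.ne', Real.mul_rpow ha.le hG.le] at h
    have e1 : (1 - α) * (α * k + b) + α * (α * k + b + 1) = α * (k + 1 : ℕ) + b := by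
      push_cast; ring
    rw [e1] at h
    calc _ ≤ _ := h
      _ = (α * k + b) ^ α *
          (Real.Gamma (α * k + b) ^ (1 - α) * Real.Gamma (α * k + b) ^ α) := by ring
      _ = _ := by rw [← Real.rpow_add hG, sub_add_cancel, Real.rpow_one]
  have hpow : (α * k + b) ^ α ≤ (1 + b) ^ α * ((k : ℝ) + 1) ^ α := by
    rw [← Real.mul_rpow (by positivity) hk1.le]
    refine Real.rpow_le_rpow ha.le ?_ hα0.le
    have hk0 : (0 : ℝ) ≤ k := k.cast_nonneg
    nlinarith [mul_nonneg hb.le hk0]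
  have hsplit : ((k : ℝ) + 1) ^ α = ((k : ℝ) + 1) ^ (-(1 - α)) * ((k : ℝ) + 1) := by
    rw [← Real.rpow_add_one hk1.ne']; ring_nf
  rw [norm_mul, norm_mul, norm_div, norm_div, norm_pow, norm_pow, Real.norm_of_nonneg hG.le,
    Real.norm_of_nonneg hG'.le, Nat.factorial_succ, RCLike.norm_natCast, RCLike.norm_natCast,
    Real.norm_eq_abs]
  have hf : (0 : ℝ) < k.factorial := by positivity
  calc |x| ^ (k + 1) / (((k + 1) * k.factorial : ℕ) : ℝ) * Real.Gamma (α * (k + 1 : ℕ) + b)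
      ≤ |x| ^ (k + 1) / (((k + 1) * k.factorial : ℕ) : ℝ) *
        (((1 + b) ^ α * (((k : ℝ) + 1) ^ (-(1 - α)) * ((k : ℝ) + 1))) *
          Real.Gamma (α * k + b)) := by
        rw [← hsplit]
        gcongr
        exact hstep.trans (by gcongr)
    _ = (|x| * (1 + b) ^ α * ((k : ℝ) + 1) ^ (-(1 - α))) *
        (|x| ^ k / k.factorial * Real.Gamma (α * k + b)) := by
        push_cast; field_simp; ring
    _ ≤ _ := by gcongr

theorem summable_Gamma_mul_rpow {α b : ℝ} (hα : α ∈ Set.Ioo (0 : ℝ) 1) (hb : 0 < b)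
    (x : ℝ) {y : ℝ} (hy : 0 < y) :
    Summable fun k : ℕ => x ^ k / k.factorial * (y ^ (α * k + b) * Real.Gamma (α * k + b)) := by
  refine ((summable_pow_div_factorial_mul_Gamma hα hb (x * y ^ α)).mul_left (y ^ b)).congr ?_
  intro k
  rw [Real.rpow_add hy, Real.rpow_mul hy.le, Real.rpow_natCast, mul_pow]
  ring

theorem norm_rpow_mul_exp (r a : ℝ) (hr : 0 < r) (z : ℂ) :
    ‖((r ^ a : ℝ) : ℂ) * Complex.exp z‖ = r ^ a * Real.exp z.re := by
  rw [norm_mul, Complex.norm_real, Complex.norm_exp, Real.norm_of_nonneg (by positivity)]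

theorem integrableOn_rpow_mul_exp_neg {a : ℝ} (ha : 0 < a) {w : ℂ} (hw : 0 < w.re) :
    MeasureTheory.IntegrableOn
      (fun r : ℝ => ((r ^ (a - 1) : ℝ) : ℂ) * Complex.exp (-(w * r))) (Set.Ioi 0) := by
  have h := integrableOn_rpow_mul_exp_neg_mul_rpow (show -1 < a - 1 by linarith) one_pos hw
  refine MeasureTheory.Integrable.mono' h (by fun_prop) ?_
  filter_upwards [MeasureTheory.ae_restrict_mem measurableSet_Ioi] with r hr
  rw [norm_rpow_mul_exp _ _ hr]
  simp

theorem differentiableAt_integral_rpow_mul_exp_neg {a : ℝ} (ha : 0 < a) {w : ℂ} (hw : 0 < w.re) :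
    DifferentiableAt ℂ (fun w : ℂ => ∫ r in Set.Ioi (0 : ℝ),
      ((r ^ (a - 1) : ℝ) : ℂ) * Complex.exp (-(w * r))) w := by
  have hbound := integrableOn_rpow_mul_exp_neg_mul_rpow (show -1 < a by linarith) one_pos
    (half_pos hw)
  refine (hasDerivAt_integral_of_dominated_loc_of_deriv_le
    (F := fun (w : ℂ) (r : ℝ) => ((r ^ (a - 1) : ℝ) : ℂ) * Complex.exp (-(w * r)))
    (F' := fun w r => ((r ^ (a - 1) : ℝ) : ℂ) * (Complex.exp (-(w * r)) * (-(1 * (r : ℂ)))))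
    (s := {z : ℂ | w.re / 2 < z.re}) (bound := fun r => r ^ a * Real.exp (-(w.re / 2) * r ^ (1 : ℝ)))
    ((isOpen_lt continuous_const Complex.continuous_re).mem_nhds (by simpa using hw))
    (Filter.Eventually.of_forall fun z => by fun_prop)
    (integrableOn_rpow_mul_exp_neg ha hw) (by fun_prop) ?_ hbound ?_).2.differentiableAt
  · filter_upwards [MeasureTheory.ae_restrict_mem measurableSet_Ioi] with r hr z hz
    have hr' : (0 : ℝ) < r := hr
    have hz' : w.re / 2 < z.re := hz
    rw [← mul_assoc, norm_mul, norm_rpow_mul_exp _ _ hr']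
    have : r ^ a = r ^ (a - 1) * r := by rw [← Real.rpow_add_one hr'.ne', sub_add_cancel]
    rw [this, norm_neg, one_mul, Complex.norm_real, Real.norm_of_nonneg hr'.le, mul_right_comm,
      Real.rpow_one]
    gcongr
    simp only [Complex.neg_re, Complex.re_mul_ofReal]
    nlinarith
  · refine Filter.Eventually.of_forall fun r z _ => ?_
    exact ((((hasDerivAt_id z).mul_const (r : ℂ)).neg).cexp).const_mul _

theorem integral_rpow_mul_exp_neg {a : ℝ} (ha : 0 < a) {w : ℂ} (hw : 0 < w.re) :
    ∫ r in Set.Ioi (0 : ℝ), ((r ^ (a - 1) : ℝ) : ℂ) * Complex.exp (-(w * r))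
      = (1 / w) ^ (a : ℂ) * (Real.Gamma a : ℂ) := by
  have hopen : IsOpen {z : ℂ | 0 < z.re} := isOpen_lt continuous_const Complex.continuous_re
  have h1 : AnalyticOnNhd ℂ (fun w : ℂ => ∫ r in Set.Ioi (0 : ℝ),
      ((r ^ (a - 1) : ℝ) : ℂ) * Complex.exp (-(w * r))) {z : ℂ | 0 < z.re} :=
    DifferentiableOn.analyticOnNhd (fun z hz =>
      (differentiableAt_integral_rpow_mul_exp_neg ha hz).differentiableWithinAt) hopen
  have h2 : AnalyticOnNhd ℂ (fun w : ℂ => (1 / w) ^ (a : ℂ) * (Real.Gamma a : ℂ))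
      {z : ℂ | 0 < z.re} := by
    refine DifferentiableOn.analyticOnNhd (fun z hz => ?_) hopen
    have hz' : 0 < z.re := hz
    have hz0 : z ≠ 0 := by rintro rfl; simp at hz'
    refine DifferentiableAt.differentiableWithinAt ?_
    refine DifferentiableAt.mul_const (DifferentiableAt.cpow_const
      (DifferentiableAt.div (by fun_prop) (by fun_prop) hz0) ?_) _
    left
    change 0 < ((1 : ℂ) / z).re
    rw [one_div, Complex.inv_re]
    exact div_pos hz' (Complex.normSq_pos.2 hz0)
  have hconn : IsPreconnected {z : ℂ | 0 < z.re} := (convex_halfSpace_re_gt 0).isPreconnected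
  refine h1.eqOn_of_preconnected_of_frequently_eq h2 hconn (z₀ := 1) (by simp) ?_ hw
  have htend : Filter.Tendsto (fun x : ℝ => (x : ℂ)) (nhdsWithin 1 {1}ᶜ) (nhdsWithin 1 {1}ᶜ) := by
    refine tendsto_nhdsWithin_iff.2 ⟨?_, ?_⟩
    · exact (Complex.continuous_ofReal.tendsto' 1 1 (by simp)).mono_left nhdsWithin_le_nhds
    · filter_upwards [self_mem_nhdsWithin] with x hx
      simpa using hx
  refine htend.frequently (Filter.Eventually.frequently ?_)
  filter_upwards [nhdsWithin_le_nhds (lt_mem_nhds (show (0 : ℝ) < 1 by norm_num))] with x hx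
  rw [← Complex.Gamma_ofReal,
    ← Complex.integral_cpow_mul_exp_neg_mul_Ioi (by simpa using ha) hx]
  refine MeasureTheory.setIntegral_congr_fun measurableSet_Ioi fun r hr => ?_
  have : (0 : ℝ) ≤ r := le_of_lt hr
  simp only [Complex.ofReal_cpow this]
  push_cast
  rfl

theorem integral_rpow_mul_exp_eq_tsum {α b : ℝ} (hα : α ∈ Set.Ioo (0 : ℝ) 1) (hb : 0 < b)
    (c : ℂ) {w : ℂ} (hw : 0 < w.re) :
    ∫ r in Set.Ioi (0 : ℝ), ((r ^ (b - 1) : ℝ) : ℂ) *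
        Complex.exp (-(c * (r ^ α : ℝ)) - w * r)
      = ∑' k : ℕ, (-c) ^ k / k.factorial *
        ((1 / w) ^ ((α * k + b : ℝ) : ℂ) * (Real.Gamma (α * k + b) : ℂ)) := by
  have hpos : ∀ k : ℕ, 0 < α * k + b := fun k => by have := hα.1; positivity
  have key := MeasureTheory.hasSum_integral_of_summable_integral_norm
    (μ := MeasureTheory.volume.restrict (Set.Ioi (0 : ℝ)))
    (F := fun (k : ℕ) (r : ℝ) => (-c) ^ k / k.factorial *
      (((r ^ (α * k + b - 1) : ℝ) : ℂ) * Complex.exp (-(w * r))))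
    (fun k => (integrableOn_rpow_mul_exp_neg (hpos k) hw).const_mul _) ?_
  · simp only [MeasureTheory.integral_const_mul, integral_rpow_mul_exp_neg (hpos _) hw] at key
    rw [key.tsum_eq]
    refine MeasureTheory.setIntegral_congr_fun measurableSet_Ioi fun r hr => ?_
    have hr' : (0 : ℝ) < r := hr
    have h1 := (NormedSpace.expSeries_div_hasSum_exp (-(c * (r ^ α : ℝ)))).mul_right
      (((r ^ (b - 1) : ℝ) : ℂ) * Complex.exp (-(w * r)))
    rw [← Complex.exp_eq_exp_ℂ] at h1
    rw [sub_eq_add_neg (-(c * _)), Complex.exp_add, mul_left_comm, ← h1.tsum_eq]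
    refine tsum_congr fun k => ?_
    have : r ^ (α * k + b - 1) = (r ^ α) ^ k * r ^ (b - 1) := by
      rw [add_sub_assoc, Real.rpow_add hr', Real.rpow_mul hr'.le, Real.rpow_natCast]
    rw [this]
    push_cast
    rw [neg_mul_eq_neg_mul, mul_pow]
    ring
  · refine (summable_Gamma_mul_rpow hα hb ‖c‖ (show 0 < 1 / w.re by positivity)).congr fun k => ?_
    rw [← Real.integral_rpow_mul_exp_neg_mul_Ioi (hpos k) hw, ← MeasureTheory.integral_const_mul]
    refine MeasureTheory.setIntegral_congr_fun measurableSet_Ioi fun r hr => ?_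
    rw [norm_mul, norm_rpow_mul_exp _ _ hr]
    simp

theorem Gamma_mul_sin_pi_mul {a : ℝ} (ha : 0 < a) :
    Real.Gamma a * Real.sin (π * a) = π * (Real.Gamma (1 - a))⁻¹ := by
  have h := Real.Gamma_mul_Gamma_one_sub a
  have hG := (Real.Gamma_pos_of_pos ha).ne'
  rcases eq_or_ne (Real.sin (π * a)) 0 with h0 | h0
  · rw [h0, div_zero] at h
    rcases mul_eq_zero.1 h with h | h
    · exact absurd h hG
    · simp [h, h0]
  · have : Real.Gamma (1 - a) ≠ 0 := by
      intro h1
      rw [h1, mul_zero, eq_comm, div_eq_zero_iff] at h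
      exact h.elim Real.pi_ne_zero h0
    rw [eq_div_iff h0] at h
    rw [← div_eq_mul_inv, eq_div_iff this]
    linarith

theorem I_cpow_mul_one_div_cpow_of_pos {t : ℝ} (ht : 0 < t) (a : ℝ) :
    Complex.I ^ (a : ℂ) * (1 / (-(t * Complex.I))) ^ (a : ℂ)
      = ((t ^ (-a) : ℝ) : ℂ) * Complex.exp (((π * a : ℝ) : ℂ) * Complex.I) := by
  have h : 1 / (-(t * Complex.I)) = ((t⁻¹ : ℝ) : ℂ) * Complex.I := by
    have : (t : ℂ) ≠ 0 := by exact_mod_cast ht.ne'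
    push_cast
    field_simp
    simp
  have h0 : ((t⁻¹ : ℝ) : ℂ) * Complex.I ≠ 0 := by simp [ht.ne']
  rw [h, Complex.cpow_def_of_ne_zero Complex.I_ne_zero, Complex.cpow_def_of_ne_zero h0,
    Complex.log_ofReal_mul (inv_pos.2 ht) Complex.I_ne_zero, Complex.log_I, Real.log_inv,
    Real.rpow_def_of_pos ht, Complex.ofReal_exp, ← Complex.exp_add, ← Complex.exp_add]
  congr 1
  push_cast
  ring

theorem I_cpow_mul_one_div_cpow_of_neg {t : ℝ} (ht : t < 0) (a : ℝ) :
    Complex.I ^ (a : ℂ) * (1 / (-(t * Complex.I))) ^ (a : ℂ) = (((-t) ^ (-a) : ℝ) : ℂ) := by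
  have ht' : 0 < -t := by linarith
  have h : 1 / (-(t * Complex.I)) = (((-t)⁻¹ : ℝ) : ℂ) * (-Complex.I) := by
    have : (t : ℂ) ≠ 0 := by exact_mod_cast ht.ne
    push_cast
    field_simp
    simp
  have hI : -Complex.I ≠ 0 := neg_ne_zero.2 Complex.I_ne_zero
  have h0 : (((-t)⁻¹ : ℝ) : ℂ) * (-Complex.I) ≠ 0 := by simp [ht.ne]
  rw [h, Complex.cpow_def_of_ne_zero Complex.I_ne_zero, Complex.cpow_def_of_ne_zero h0,
    Complex.log_ofReal_mul (inv_pos.2 ht') hI, Complex.log_I, Complex.log_neg_I, Real.log_inv,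
    Real.rpow_def_of_pos ht', Complex.ofReal_exp, ← Complex.exp_add]
  congr 1
  push_cast
  ring

/-- The boundary value `ρ^{b-1} exp(-s (iρ)^α)` of `z^{b-1} exp(-s z^α)` on the imaginary axis, up
to a constant phase. -/
noncomputable def stableKernel (α s b ρ : ℝ) : ℂ :=
  ((ρ ^ (b - 1) : ℝ) : ℂ) * Complex.exp (-(s * Complex.I ^ (α : ℂ) * (ρ ^ α : ℝ)))

/-- The Fourier integral of `stableKernel`. -/
noncomputable def stableFourier (α s b t : ℝ) : ℂ :=
  Complex.I ^ (b : ℂ) *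
    ∫ ρ in Set.Ioi (0 : ℝ), stableKernel α s b ρ * Complex.exp (t * ρ * Complex.I)

theorem norm_exp_mul_I (t ρ : ℝ) : ‖Complex.exp (t * ρ * Complex.I)‖ = 1 := by
  rw [← Complex.ofReal_mul, Complex.norm_exp_ofReal_mul_I]

theorem I_cpow_re (α : ℝ) : (Complex.I ^ (α : ℂ)).re = Real.cos (π / 2 * α) := by
  rw [Complex.cpow_def_of_ne_zero Complex.I_ne_zero, Complex.log_I]
  have : (π / 2 * Complex.I * α : ℂ) = ((π / 2 * α : ℝ) : ℂ) * Complex.I := by push_cast; ring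
  rw [this, Complex.exp_ofReal_mul_I_re]

theorem cos_pi_div_two_mul_pos {α : ℝ} (hα : α ∈ Set.Ioo (0 : ℝ) 1) :
    0 < Real.cos (π / 2 * α) := by
  have := Real.pi_pos
  exact Real.cos_pos_of_mem_Ioo ⟨by nlinarith [hα.1], by nlinarith [hα.2]⟩

theorem norm_stableKernel (α s b : ℝ) {ρ : ℝ} (hρ : 0 < ρ) :
    ‖stableKernel α s b ρ‖ = ρ ^ (b - 1) * Real.exp (-(s * Real.cos (π / 2 * α)) * ρ ^ α) := by
  rw [stableKernel, norm_rpow_mul_exp _ _ hρ, ← I_cpow_re, mul_assoc]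
  congr 2
  simp only [Complex.neg_re, Complex.re_ofReal_mul, Complex.re_mul_ofReal]
  ring

theorem measurable_stableKernel (α s b : ℝ) : Measurable (stableKernel α s b) := by
  unfold stableKernel
  fun_prop

theorem integrableOn_rpow_mul_exp_neg_cos_mul_rpow {α s b : ℝ} (hα : α ∈ Set.Ioo (0 : ℝ) 1)
    (hs : 0 < s) (hb : 0 < b) :
    MeasureTheory.IntegrableOn
      (fun ρ => ρ ^ (b - 1) * Real.exp (-(s * Real.cos (π / 2 * α)) * ρ ^ α)) (Set.Ioi 0) :=
  integrableOn_rpow_mul_exp_neg_mul_rpow (by linarith) hα.1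
    (mul_pos hs (cos_pi_div_two_mul_pos hα))

theorem integrableOn_stableKernel {α s b : ℝ} (hα : α ∈ Set.Ioo (0 : ℝ) 1)
    (hs : 0 < s) (hb : 0 < b) :
    MeasureTheory.IntegrableOn (stableKernel α s b) (Set.Ioi 0) := by
  refine MeasureTheory.Integrable.mono' (integrableOn_rpow_mul_exp_neg_cos_mul_rpow hα hs hb)
    (measurable_stableKernel α s b).aestronglyMeasurable ?_
  filter_upwards [MeasureTheory.ae_restrict_mem measurableSet_Ioi] with ρ hρ
  rw [norm_stableKernel α s b hρ]

theorem stableFourier_eq_tsum {α s b t : ℝ} (hα : α ∈ Set.Ioo (0 : ℝ) 1)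
    (hs : 0 < s) (hb : 0 < b) (ht : t ≠ 0) :
    stableFourier α s b t = ∑' k : ℕ, (-s : ℂ) ^ k / k.factorial *
      ((Complex.I ^ ((α * k + b : ℝ) : ℂ) * (1 / (-(t * Complex.I))) ^ ((α * k + b : ℝ) : ℂ)) *
        (Real.Gamma (α * k + b) : ℂ)) := by
  have hpos : ∀ k : ℕ, 0 < α * k + b := fun k => by have := hα.1; positivity
  have ht' : (t : ℂ) ≠ 0 := by exact_mod_cast ht
  have hlimL : Filter.Tendsto (fun ε : ℝ => ∫ r in Set.Ioi (0 : ℝ), ((r ^ (b - 1) : ℝ) : ℂ) *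
        Complex.exp (-((s * Complex.I ^ (α : ℂ)) * (r ^ α : ℝ)) - (ε - t * Complex.I) * r))
      (nhdsWithin 0 (Set.Ioi 0))
      (nhds (∫ ρ in Set.Ioi (0 : ℝ), stableKernel α s b ρ * Complex.exp (t * ρ * Complex.I))) := by
    refine MeasureTheory.tendsto_integral_filter_of_dominated_convergence
      (fun ρ => ρ ^ (b - 1) * Real.exp (-(s * Real.cos (π / 2 * α)) * ρ ^ α))
      (Filter.Eventually.of_forall fun ε => by fun_prop) ?_
      (integrableOn_rpow_mul_exp_neg_cos_mul_rpow hα hs hb) ?_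
    · filter_upwards [self_mem_nhdsWithin] with ε hε
      filter_upwards [MeasureTheory.ae_restrict_mem measurableSet_Ioi] with ρ hρ
      have hε' : (0 : ℝ) < ε := hε
      have hρ' : (0 : ℝ) < ρ := hρ
      rw [norm_rpow_mul_exp _ _ hρ', ← I_cpow_re, mul_assoc]
      gcongr
      simp only [Complex.sub_re, Complex.neg_re, Complex.re_ofReal_mul, Complex.re_mul_ofReal,
        Complex.ofReal_re, Complex.I_re]
      nlinarith [mul_pos hε' hρ']
    · refine Filter.Eventually.of_forall fun ρ => ?_
      have : stableKernel α s b ρ * Complex.exp (t * ρ * Complex.I) = ((ρ ^ (b - 1) : ℝ) : ℂ) *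
          Complex.exp (-((s * Complex.I ^ (α : ℂ)) * (ρ ^ α : ℝ)) -
            (((0 : ℝ) : ℂ) - t * Complex.I) * ρ) := by
        rw [stableKernel, mul_assoc, ← Complex.exp_add]
        congr 2
        push_cast
        ring
      rw [this]
      refine (Continuous.tendsto ?_ 0).mono_left nhdsWithin_le_nhds
      fun_prop
  have hw : Filter.Tendsto (fun ε : ℝ => 1 / ((ε : ℂ) - t * Complex.I)) (nhdsWithin 0 (Set.Ioi 0))
      (nhds (1 / (-(t * Complex.I)))) := by
    refine Filter.Tendsto.mono_left ?_ nhdsWithin_le_nhds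
    have hne : -(t * Complex.I) ≠ 0 := by simp [ht]
    refine Filter.Tendsto.div tendsto_const_nhds ?_ hne
    exact Continuous.tendsto' (by fun_prop) _ _ (by simp)
  have hslit : 1 / (-(t * Complex.I)) ∈ Complex.slitPlane := by
    right
    have : 1 / (-(t * Complex.I)) = ((t⁻¹ : ℝ) : ℂ) * Complex.I := by
      push_cast
      field_simp
      simp
    rw [this]
    simpa using ht
  have hlimR : Filter.Tendsto (fun ε : ℝ => ∑' k : ℕ, (-(s * Complex.I ^ (α : ℂ))) ^ k /
        k.factorial * ((1 / ((ε : ℂ) - t * Complex.I)) ^ ((α * k + b : ℝ) : ℂ) *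
          (Real.Gamma (α * k + b) : ℂ)))
      (nhdsWithin 0 (Set.Ioi 0))
      (nhds (∑' k : ℕ, (-(s * Complex.I ^ (α : ℂ))) ^ k /
        k.factorial * ((1 / (-(t * Complex.I))) ^ ((α * k + b : ℝ) : ℂ) *
          (Real.Gamma (α * k + b) : ℂ)))) := by
    refine tendsto_tsum_of_dominated_convergence
      (summable_Gamma_mul_rpow hα hb (‖(s * Complex.I ^ (α : ℂ))‖) (y := 1 / |t|)
        (by positivity)) (fun k => ?_) ?_
    · exact (((continuousAt_cpow_const hslit).tendsto.comp hw).mul_const _).const_mul _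
    · refine Filter.Eventually.of_forall fun ε k => ?_
      have hG := Real.Gamma_pos_of_pos (hpos k)
      rw [norm_mul, norm_mul, norm_div, norm_pow, norm_neg, Complex.norm_cpow_real, norm_div,
        norm_one, Complex.norm_real, Real.norm_of_nonneg hG.le, RCLike.norm_natCast]
      have hpk := hpos k
      have : |t| ≤ ‖(ε : ℂ) - t * Complex.I‖ := by
        simpa using Complex.abs_im_le_norm ((ε : ℂ) - t * Complex.I)
      have ht0 : 0 < |t| := abs_pos.2 ht
      gcongr
  have heq := tendsto_nhds_unique_of_eventuallyEq hlimL hlimR (by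
    filter_upwards [self_mem_nhdsWithin] with ε hε
    exact integral_rpow_mul_exp_eq_tsum hα hb _ (by simpa using hε))
  rw [stableFourier, heq, ← tsum_mul_left]
  refine tsum_congr fun k => ?_
  have hI : Complex.I ^ ((α * k + b : ℝ) : ℂ) = (Complex.I ^ (α : ℂ)) ^ k * Complex.I ^ (b : ℂ) := by
    push_cast
    rw [Complex.cpow_add _ _ Complex.I_ne_zero, Complex.cpow_mul_nat]
  rw [hI, neg_mul_eq_neg_mul, mul_pow]
  ring

theorem stableFourier_im_of_neg {α s b t : ℝ} (hα : α ∈ Set.Ioo (0 : ℝ) 1)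
    (hs : 0 < s) (hb : 0 < b) (ht : t < 0) : (stableFourier α s b t).im = 0 := by
  rw [stableFourier_eq_tsum hα hs hb ht.ne]
  simp only [I_cpow_mul_one_div_cpow_of_neg ht]
  have : ∀ k : ℕ, (-s : ℂ) ^ k / k.factorial * ((((-t) ^ (-(α * k + b)) : ℝ) : ℂ) *
      (Real.Gamma (α * k + b) : ℂ)) =
      (((-s) ^ k / k.factorial * ((-t) ^ (-(α * k + b)) * Real.Gamma (α * k + b)) : ℝ) : ℂ) := by
    intro k; push_cast; ring
  simp only [this]
  rw [← Complex.ofReal_tsum, Complex.ofReal_im]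

theorem stableFourier_im_of_pos {α s b t : ℝ} (hα : α ∈ Set.Ioo (0 : ℝ) 1)
    (hs : 0 < s) (hb : 0 < b) (ht : 0 < t) :
    HasSum (fun k : ℕ => π * ((-s) ^ k / k.factorial *
      (t ^ (-(α * k + b)) * (Real.Gamma (1 - (α * k + b)))⁻¹))) (stableFourier α s b t).im := by
  have hpos : ∀ k : ℕ, 0 < α * k + b := fun k => by have := hα.1; positivity
  rw [stableFourier_eq_tsum hα hs hb ht.ne']
  simp only [I_cpow_mul_one_div_cpow_of_pos ht]
  have hsum : Summable fun k : ℕ => (-s : ℂ) ^ k / k.factorial *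
      ((((t ^ (-(α * k + b)) : ℝ) : ℂ) * Complex.exp (((π * (α * k + b) : ℝ) : ℂ) * Complex.I)) *
      (Real.Gamma (α * k + b) : ℂ)) := by
    refine Summable.of_norm ((summable_Gamma_mul_rpow hα hb s (inv_pos.2 ht)).congr fun k => ?_)
    have hG := Real.Gamma_pos_of_pos (hpos k)
    rw [norm_mul, norm_mul, norm_mul, norm_div, norm_pow, norm_neg, Complex.norm_exp_ofReal_mul_I,
      Complex.norm_real, Complex.norm_real, Complex.norm_real, RCLike.norm_natCast,
      Real.norm_of_nonneg hs.le, Real.norm_of_nonneg hG.le,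
      Real.norm_of_nonneg (Real.rpow_nonneg ht.le _), Real.inv_rpow ht.le, Real.rpow_neg ht.le,
      mul_one]
  refine (Complex.hasSum_im hsum.hasSum).congr_fun fun k => ?_
  have e : (-s : ℂ) ^ k / k.factorial *
      ((((t ^ (-(α * k + b)) : ℝ) : ℂ) * Complex.exp (((π * (α * k + b) : ℝ) : ℂ) * Complex.I)) *
      (Real.Gamma (α * k + b) : ℂ)) = (((-s) ^ k / k.factorial * t ^ (-(α * k + b)) *
        Real.Gamma (α * k + b) : ℝ) : ℂ) *
        Complex.exp (((π * (α * k + b) : ℝ) : ℂ) * Complex.I) := by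
    push_cast; ring
  rw [e, Complex.im_ofReal_mul, Complex.exp_ofReal_mul_I_im, mul_assoc _ (Real.Gamma _),
    Gamma_mul_sin_pi_mul (hpos k)]
  ring

theorem phiSub_eq_stableFourier_im {α s τ : ℝ} (hα : α ∈ Set.Ioo (0 : ℝ) 1) (hs : 0 < s)
    (hτ : 0 < τ) : phiSub α τ s = π⁻¹ * (stableFourier α s α τ).im := by
  rw [← (stableFourier_im_of_pos hα hs hα.1 hτ).tsum_eq, phiSub, wrightPhi, ← tsum_mul_left,
    ← tsum_mul_left]
  refine tsum_congr fun k => ?_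
  have h1 : τ ^ (-(α * k + α)) = (τ ^ (-α)) ^ k * τ ^ (-α) := by
    rw [← Real.rpow_natCast, ← Real.rpow_mul hτ.le, ← Real.rpow_add hτ]
    ring_nf
  have h2 : 1 - (α * k + α) = 1 - α - α * k := by ring
  rw [h1, h2, inv_mul_cancel_left₀ Real.pi_ne_zero, neg_mul_eq_neg_mul, mul_pow, div_eq_mul_inv,
    mul_inv]
  ring

theorem psiSub_eq_stableFourier_im {α s t : ℝ} (hα : α ∈ Set.Ioo (0 : ℝ) 1) (hs : 0 < s)
    (ht : 0 < t) : psiSub α t s = π⁻¹ * (stableFourier α s 1 t).im := by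
  have h := stableFourier_im_of_pos hα hs one_pos ht
  rw [← h.tsum_eq, h.summable.tsum_eq_zero_add, psiSub, ← tsum_mul_left]
  simp only [Nat.cast_zero, mul_zero, zero_add, sub_self, Real.Gamma_zero, inv_zero]
  rw [← tsum_mul_left]
  refine tsum_congr fun k => ?_
  have h1 : t ^ (-(α * (k + 1 : ℕ) + 1)) = (t ^ (-α)) ^ (k + 1) * t⁻¹ := by
    rw [← Real.rpow_natCast, ← Real.rpow_mul ht.le, ← Real.rpow_neg_one t, ← Real.rpow_add ht]
    ring_nf
  have h2 : 1 - (α * (k + 1 : ℕ) + 1) = -(α * (k + 1)) := by push_cast; ring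
  rw [h1, h2, inv_mul_cancel_left₀ Real.pi_ne_zero, neg_mul_eq_neg_mul, mul_pow, div_eq_mul_inv,
    mul_inv]
  ring

theorem continuous_stableFourier {α s b : ℝ} (hα : α ∈ Set.Ioo (0 : ℝ) 1) (hs : 0 < s)
    (hb : 0 < b) : Continuous (stableFourier α s b) := by
  refine continuous_const.mul (MeasureTheory.continuous_of_dominated
    (bound := fun ρ => ‖stableKernel α s b ρ‖) (fun t => ?_) (fun t => ?_)
    (integrableOn_stableKernel hα hs hb).norm ?_)
  · exact ((measurable_stableKernel α s b).mul (by fun_prop)).aestronglyMeasurable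
  · refine Filter.Eventually.of_forall fun ρ => ?_
    rw [norm_mul, norm_exp_mul_I, mul_one]
  · exact Filter.Eventually.of_forall fun ρ => by fun_prop

theorem exists_norm_stableFourier_le (α s b : ℝ) : ∃ M, ∀ t, ‖stableFourier α s b t‖ ≤ M := by
  refine ⟨‖Complex.I ^ (b : ℂ)‖ * ∫ ρ in Set.Ioi (0 : ℝ), ‖stableKernel α s b ρ‖, fun t => ?_⟩
  rw [stableFourier, norm_mul]
  gcongr
  refine (MeasureTheory.norm_integral_le_integral_norm _).trans_eq ?_
  simp only [norm_mul, norm_exp_mul_I, mul_one]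

theorem I_cpow_mul_stableKernel (α s : ℝ) {ρ : ℝ} (hρ : 0 < ρ) :
    Complex.I ^ (α : ℂ) * (1 / (ρ * Complex.I)) ^ (α : ℂ) * stableKernel α s α ρ
      = stableKernel α s 0 ρ := by
  have h := I_cpow_mul_one_div_cpow_of_neg (neg_lt_zero.2 hρ) α
  rw [Complex.ofReal_neg, neg_mul, neg_neg, neg_neg] at h
  rw [h, stableKernel, stableKernel, ← mul_assoc, ← Complex.ofReal_mul, ← Real.rpow_add hρ]
  ring_nf

theorem stableKernel_zero_mul (α s : ℝ) {ρ : ℝ} (hρ : 0 < ρ) :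
    stableKernel α s 0 ρ * ρ = stableKernel α s 1 ρ := by
  rw [stableKernel, stableKernel, mul_right_comm, ← Complex.ofReal_mul, ← Real.rpow_add_one hρ.ne']
  ring_nf

theorem integral_rpow_mul_exp_neg_mul_stableFourier {α s ε : ℝ} (hα : α ∈ Set.Ioo (0 : ℝ) 1)
    (hs : 0 < s) (hε : 0 < ε) (t : ℝ) :
    ∫ u in Set.Ioi (0 : ℝ), ((u ^ (α - 1) : ℝ) : ℂ) * Complex.exp (-(ε * u)) *
        stableFourier α s α (t - u)
      = Real.Gamma α * ∫ ρ in Set.Ioi (0 : ℝ), Complex.I ^ (α : ℂ) *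
        (1 / (ε + ρ * Complex.I)) ^ (α : ℂ) * stableKernel α s α ρ *
          Complex.exp (t * ρ * Complex.I) := by
  have hg : MeasureTheory.IntegrableOn
      (fun u : ℝ => ((u ^ (α - 1) : ℝ) : ℂ) * Complex.exp (-(ε * u))) (Set.Ioi 0) :=
    integrableOn_rpow_mul_exp_neg hα.1 (by simpa using hε)
  have hprod := (hg.mul_prod (integrableOn_stableKernel hα hs hα.1)).bdd_mul
    (f := fun z : ℝ × ℝ => Complex.exp (((t - z.1 : ℝ) : ℂ) * z.2 * Complex.I)) (c := 1)
    (by fun_prop) (Filter.Eventually.of_forall fun z => (norm_exp_mul_I _ _).le)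
  have hswap := MeasureTheory.integral_integral_swap
    (f := fun u ρ : ℝ => Complex.exp (((t - u : ℝ) : ℂ) * ρ * Complex.I) *
      ((((u ^ (α - 1) : ℝ) : ℂ) * Complex.exp (-(ε * u))) * stableKernel α s α ρ)) hprod
  calc _ = Complex.I ^ (α : ℂ) * ∫ u in Set.Ioi (0 : ℝ), ∫ ρ in Set.Ioi (0 : ℝ),
        Complex.exp (((t - u : ℝ) : ℂ) * ρ * Complex.I) *
      ((((u ^ (α - 1) : ℝ) : ℂ) * Complex.exp (-(ε * u))) * stableKernel α s α ρ) := by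
        rw [← MeasureTheory.integral_const_mul]
        congr 1 with u
        rw [stableFourier, mul_left_comm, ← MeasureTheory.integral_const_mul]
        congr 2 with ρ
        ring
    _ = _ := by
        rw [hswap, ← MeasureTheory.integral_const_mul, ← MeasureTheory.integral_const_mul]
        congr 1 with ρ
        have h := integral_rpow_mul_exp_neg hα.1 (w := ε + ρ * Complex.I) (by simpa using hε)
        have e : ∀ u : ℝ, Complex.exp (((t - u : ℝ) : ℂ) * ρ * Complex.I) *
            ((((u ^ (α - 1) : ℝ) : ℂ) * Complex.exp (-(ε * u))) * stableKernel α s α ρ) =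
            (Complex.exp (t * ρ * Complex.I) * stableKernel α s α ρ) *
            (((u ^ (α - 1) : ℝ) : ℂ) * Complex.exp (-((ε + ρ * Complex.I) * u))) := by
          intro u
          have : Complex.exp (((t - u : ℝ) : ℂ) * ρ * Complex.I) * Complex.exp (-(ε * u)) =
              Complex.exp (t * ρ * Complex.I) * Complex.exp (-((ε + ρ * Complex.I) * u)) := by
            rw [← Complex.exp_add, ← Complex.exp_add]
            congr 1
            push_cast
            ring
          linear_combination (((u ^ (α - 1) : ℝ) : ℂ) * stableKernel α s α ρ) * this
        simp only [e]
        rw [MeasureTheory.integral_const_mul, h]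
        ring

theorem tendsto_regularized_integral {α s t : ℝ} (hα : α ∈ Set.Ioo (0 : ℝ) 1)
    (hs : 0 < s) (ht : 0 < t) :
    Filter.Tendsto (fun ε : ℝ => (Real.Gamma α * ∫ ρ in Set.Ioi (0 : ℝ), Complex.I ^ (α : ℂ) *
        (1 / (ε + ρ * Complex.I)) ^ (α : ℂ) * stableKernel α s α ρ *
          Complex.exp (t * ρ * Complex.I)).im) (nhdsWithin 0 (Set.Ioi 0))
      (nhds (∫ τ in (0 : ℝ)..t, (t - τ) ^ (α - 1) * (stableFourier α s α τ).im)) := by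
  obtain ⟨M, hM⟩ := exists_norm_stableFourier_le α s α
  have hcont := continuous_stableFourier hα hs hα.1
  have hfirst : ∀ ε : ℝ, 0 < ε → (Real.Gamma α * ∫ ρ in Set.Ioi (0 : ℝ), Complex.I ^ (α : ℂ) *
        (1 / (ε + ρ * Complex.I)) ^ (α : ℂ) * stableKernel α s α ρ *
          Complex.exp (t * ρ * Complex.I)).im = ∫ u in Set.Ioc (0 : ℝ) t,
          u ^ (α - 1) * Real.exp (-(ε * u)) * (stableFourier α s α (t - u)).im := by
    intro ε hε
    rw [← integral_rpow_mul_exp_neg_mul_stableFourier hα hs hε]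
    have hg : MeasureTheory.IntegrableOn
        (fun u : ℝ => ((u ^ (α - 1) : ℝ) : ℂ) * Complex.exp (-(ε * u)) *
          stableFourier α s α (t - u)) (Set.Ioi 0) :=
      (integrableOn_rpow_mul_exp_neg hα.1 (by simpa using hε)).mul_bdd (c := M)
        (hcont.comp (by fun_prop)).aestronglyMeasurable
        (Filter.Eventually.of_forall fun u => hM _)
    have him := Complex.imCLM.integral_comp_comm hg
    simp only [Complex.imCLM_apply] at him
    rw [← him]
    have e : ∀ u : ℝ, (((u ^ (α - 1) : ℝ) : ℂ) * Complex.exp (-(ε * u)) *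
          stableFourier α s α (t - u)).im =
          u ^ (α - 1) * Real.exp (-(ε * u)) * (stableFourier α s α (t - u)).im := by
      intro u
      rw [← Complex.ofReal_mul ε, ← Complex.ofReal_neg, ← Complex.ofReal_exp,
        ← Complex.ofReal_mul, Complex.im_ofReal_mul]
    simp only [e]
    refine (MeasureTheory.setIntegral_eq_of_subset_of_forall_sdiff_eq_zero measurableSet_Ioi
      Set.Ioc_subset_Ioi_self fun u hu => ?_)
    have : t - u < 0 := by
      by_contra h
      exact hu.2 ⟨hu.1, by linarith⟩
    rw [stableFourier_im_of_neg hα hs hα.1 this, mul_zero]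
  have hsub := intervalIntegral.integral_comp_sub_left (a := 0) (b := t)
    (fun τ => (t - τ) ^ (α - 1) * (stableFourier α s α τ).im) t
  simp only [sub_sub_cancel, sub_self, sub_zero] at hsub
  rw [← hsub, intervalIntegral.integral_of_le ht.le]
  have hbd : MeasureTheory.IntegrableOn (fun u : ℝ => u ^ (α - 1) * M) (Set.Ioc 0 t) :=
    (((intervalIntegral.intervalIntegrable_rpow' (by linarith [hα.1])).1).mul_const M)
  have hmeas : Measurable fun u => (stableFourier α s α (t - u)).im :=
    (Complex.continuous_im.comp (hcont.comp (by fun_prop))).measurable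
  refine (MeasureTheory.tendsto_integral_filter_of_dominated_convergence
    (F := fun (ε u : ℝ) => u ^ (α - 1) * Real.exp (-(ε * u)) * (stableFourier α s α (t - u)).im)
    (fun u => u ^ (α - 1) * M) (Filter.Eventually.of_forall fun ε => ?_) ?_ hbd ?_).congr' ?_
  · exact (Measurable.mul (by fun_prop) hmeas).aestronglyMeasurable
  · filter_upwards [self_mem_nhdsWithin] with ε hε
    filter_upwards [MeasureTheory.ae_restrict_mem measurableSet_Ioc] with u hu
    have hε' : (0 : ℝ) < ε := hε
    have hu' : 0 < u := hu.1
    rw [norm_mul, norm_mul, Real.norm_of_nonneg (by positivity : 0 ≤ u ^ (α - 1)),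
      Real.norm_of_nonneg (Real.exp_nonneg _), mul_assoc]
    gcongr
    calc _ ≤ 1 * M := by
          gcongr
          · exact Real.exp_le_one_iff.2 (by nlinarith [mul_pos hε' hu'])
          · exact (Complex.abs_im_le_norm _).trans (hM _)
      _ = M := one_mul M
  · refine Filter.Eventually.of_forall fun u => ?_
    refine Filter.Tendsto.mul_const _ (Filter.Tendsto.mono_left ?_ nhdsWithin_le_nhds)
    exact Continuous.tendsto' (by fun_prop) _ _ (by simp)
  · filter_upwards [self_mem_nhdsWithin] with ε hε
    exact (hfirst ε hε).symm

theorem norm_exp_mul_I_sub_le (t t₀ ρ : ℝ) :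
    ‖Complex.exp (t * ρ * Complex.I) - Complex.exp (t₀ * ρ * Complex.I)‖ ≤ |t - t₀| * |ρ| := by
  have : Complex.exp (t * ρ * Complex.I) - Complex.exp (t₀ * ρ * Complex.I) =
      Complex.exp (t₀ * ρ * Complex.I) *
        (Complex.exp (Complex.I * (((t - t₀) * ρ : ℝ) : ℂ)) - 1) := by
    rw [mul_sub, ← Complex.exp_add, mul_one]
    congr 2
    push_cast
    ring
  rw [this, norm_mul, norm_exp_mul_I, one_mul, ← abs_mul]
  exact Real.norm_exp_I_mul_ofReal_sub_one_le

theorem norm_stableKernel_zero_mul (α s : ℝ) {ρ : ℝ} (hρ : 0 < ρ) :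
    ‖stableKernel α s 0 ρ‖ * ρ = ‖stableKernel α s 1 ρ‖ := by
  rw [← stableKernel_zero_mul α s hρ, norm_mul, Complex.norm_real, Real.norm_of_nonneg hρ.le]

theorem fractionalIntegral_sub_eq {α s t t₀ : ℝ} (hα : α ∈ Set.Ioo (0 : ℝ) 1)
    (hs : 0 < s) (ht : 0 < t) (ht₀ : 0 < t₀) :
    (∫ τ in (0 : ℝ)..t, (t - τ) ^ (α - 1) * (stableFourier α s α τ).im) -
      (∫ τ in (0 : ℝ)..t₀, (t₀ - τ) ^ (α - 1) * (stableFourier α s α τ).im) =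
      Real.Gamma α * (∫ ρ in Set.Ioi (0 : ℝ), stableKernel α s 0 ρ *
        (Complex.exp (t * ρ * Complex.I) - Complex.exp (t₀ * ρ * Complex.I))).im := by
  refine tendsto_nhds_unique ((tendsto_regularized_integral hα hs ht).sub
    (tendsto_regularized_integral hα hs ht₀)) ?_
  have hlim : Filter.Tendsto (fun ε : ℝ => ∫ ρ in Set.Ioi (0 : ℝ), Complex.I ^ (α : ℂ) *
        (1 / (ε + ρ * Complex.I)) ^ (α : ℂ) * stableKernel α s α ρ *
        (Complex.exp (t * ρ * Complex.I) - Complex.exp (t₀ * ρ * Complex.I)))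
      (nhdsWithin 0 (Set.Ioi 0)) (nhds (∫ ρ in Set.Ioi (0 : ℝ), stableKernel α s 0 ρ *
        (Complex.exp (t * ρ * Complex.I) - Complex.exp (t₀ * ρ * Complex.I)))) := by
    refine MeasureTheory.tendsto_integral_filter_of_dominated_convergence
      (fun ρ => ‖stableKernel α s 1 ρ‖ * |t - t₀|)
      (Filter.Eventually.of_forall fun ε => ?_) (Filter.Eventually.of_forall fun ε => ?_)
      ((integrableOn_stableKernel hα hs one_pos).norm.mul_const _) ?_
    · have := measurable_stableKernel α s α
      exact Measurable.aestronglyMeasurable (by fun_prop)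
    · filter_upwards [MeasureTheory.ae_restrict_mem measurableSet_Ioi] with ρ hρ
      have hρ' : (0 : ℝ) < ρ := hρ
      have hle : ‖Complex.I ^ (α : ℂ) * (1 / (ε + ρ * Complex.I)) ^ (α : ℂ) * stableKernel α s α ρ‖
          ≤ ‖stableKernel α s 0 ρ‖ := by
        rw [← I_cpow_mul_stableKernel α s hρ']
        simp only [norm_mul, Complex.norm_cpow_real, norm_div]
        have : ‖(ρ : ℂ)‖ * ‖Complex.I‖ ≤ ‖(ε + ρ * Complex.I : ℂ)‖ := by
          simpa using Complex.abs_im_le_norm ((ε : ℂ) + ρ * Complex.I)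
        have h0 : 0 < ‖(ρ : ℂ)‖ * ‖Complex.I‖ := by simpa using hρ'.ne'
        have hα0 := hα.1.le
        gcongr
      rw [norm_mul, ← norm_stableKernel_zero_mul α s hρ', mul_assoc ‖_‖, mul_comm ρ]
      have := norm_exp_mul_I_sub_le t t₀ ρ
      rw [abs_of_pos hρ'] at this
      gcongr
    · filter_upwards [MeasureTheory.ae_restrict_mem measurableSet_Ioi] with ρ hρ
      have hρ' : (0 : ℝ) < ρ := hρ
      rw [← I_cpow_mul_stableKernel α s hρ']
      have hne : (ρ : ℂ) * Complex.I ≠ 0 := by simp [hρ'.ne']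
      have hslit : 1 / ((ρ : ℂ) * Complex.I) ∈ Complex.slitPlane := by
        right
        simp [hρ'.ne']
      have hw : Filter.Tendsto (fun ε : ℝ => 1 / ((ε : ℂ) + ρ * Complex.I))
          (nhdsWithin 0 (Set.Ioi 0)) (nhds (1 / (ρ * Complex.I))) := by
        refine Filter.Tendsto.mono_left ?_ nhdsWithin_le_nhds
        refine Filter.Tendsto.div tendsto_const_nhds ?_ hne
        exact Continuous.tendsto' (by fun_prop) _ _ (by simp)
      exact ((((continuousAt_cpow_const hslit).tendsto.comp hw).const_mul _).mul_const _).mul_const _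
  have hlim' := ((Complex.continuous_im.tendsto _).comp hlim).const_mul (Real.Gamma α)
  refine hlim'.congr' ?_
  filter_upwards [self_mem_nhdsWithin] with ε hε
  have hε' : (0 : ℝ) < ε := hε
  have hint : ∀ t : ℝ, MeasureTheory.IntegrableOn (fun ρ : ℝ => Complex.I ^ (α : ℂ) *
        (1 / (ε + ρ * Complex.I)) ^ (α : ℂ) * stableKernel α s α ρ *
          Complex.exp (t * ρ * Complex.I)) (Set.Ioi 0) := by
    intro t
    have := measurable_stableKernel α s α
    refine MeasureTheory.Integrable.mono'
      ((integrableOn_stableKernel hα hs hα.1).norm.const_mul ((1 / ε) ^ α))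
      (Measurable.aestronglyMeasurable (by fun_prop)) (Filter.Eventually.of_forall fun ρ => ?_)
    rw [norm_mul, norm_exp_mul_I, mul_one, norm_mul, norm_mul, Complex.norm_cpow_real,
      Complex.norm_cpow_real, Complex.norm_I, Real.one_rpow, one_mul, norm_div, norm_one]
    have : ε ≤ ‖(ε + ρ * Complex.I : ℂ)‖ := by
      simpa using (le_abs_self _).trans (Complex.abs_re_le_norm ((ε : ℂ) + ρ * Complex.I))
    have hα0 := hα.1.le
    gcongr
  simp only [Function.comp_apply, mul_sub]
  rw [MeasureTheory.integral_sub (hint t) (hint t₀), Complex.im_ofReal_mul, Complex.im_ofReal_mul,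
    Complex.sub_im]
  ring

theorem hasDerivAt_integral_stableKernel {α s : ℝ} (hα : α ∈ Set.Ioo (0 : ℝ) 1)
    (hs : 0 < s) (t₀ : ℝ) :
    HasDerivAt (fun t : ℝ => ∫ ρ in Set.Ioi (0 : ℝ), stableKernel α s 0 ρ *
        (Complex.exp (t * ρ * Complex.I) - Complex.exp (t₀ * ρ * Complex.I)))
      (stableFourier α s 1 t₀) t₀ := by
  have hm := measurable_stableKernel α s 0
  have h := (hasDerivAt_integral_of_dominated_loc_of_deriv_le
    (μ := MeasureTheory.volume.restrict (Set.Ioi (0 : ℝ)))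
    (F := fun (t : ℝ) (ρ : ℝ) => stableKernel α s 0 ρ *
        (Complex.exp (t * ρ * Complex.I) - Complex.exp (t₀ * ρ * Complex.I)))
    (F' := fun (t : ℝ) (ρ : ℝ) => stableKernel α s 0 ρ *
        (Complex.exp (t * ρ * Complex.I) * (1 * ρ * Complex.I)))
    (bound := fun ρ => ‖stableKernel α s 1 ρ‖) (x₀ := t₀) (s := Set.univ) Filter.univ_mem
    (Filter.Eventually.of_forall fun t => Measurable.aestronglyMeasurable (by fun_prop))
    (by simp) (Measurable.aestronglyMeasurable (by fun_prop)) ?_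
    (integrableOn_stableKernel hα hs one_pos).norm ?_).2
  · refine h.congr_deriv ?_
    rw [stableFourier, ← MeasureTheory.integral_const_mul]
    refine MeasureTheory.setIntegral_congr_fun measurableSet_Ioi fun ρ (hρ : 0 < ρ) => ?_
    simp only [← stableKernel_zero_mul α s hρ, Complex.ofReal_one, Complex.cpow_one]
    ring
  · filter_upwards [MeasureTheory.ae_restrict_mem measurableSet_Ioi] with ρ hρ t _
    rw [norm_mul, norm_mul, norm_exp_mul_I, ← norm_stableKernel_zero_mul α s hρ]
    simp [abs_of_pos (show (0 : ℝ) < ρ from hρ)]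
  · refine Filter.Eventually.of_forall fun ρ t _ => ?_
    exact (((((Complex.ofRealCLM.hasDerivAt (x := t)).mul_const (ρ : ℂ)).mul_const
      Complex.I).cexp.sub_const _).const_mul _)

/-- For `s > 0`, `t₀ > 0` and `0 < α < 1`, the function
`t ↦ (1/Γ(α)) ∫₀^t (t - τ)^{α-1} φ_{τ,α}(s) dτ` is differentiable at `t₀`
with derivative `ψ_{t₀,α}(s)`; i.e. the Riemann–Liouville derivative
`D_{0+,t}^{1-α} φ_{t,α}(s)` equals `ψ_{t,α}(s)`. -/
theorem riemannLiouville_deriv_phiSub_eq_psiSub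
    (α : ℝ) (hα : α ∈ Set.Ioo (0 : ℝ) 1) (s t₀ : ℝ) (hs : 0 < s) (ht₀ : 0 < t₀) :
    HasDerivAt
      (fun t : ℝ => (Real.Gamma α)⁻¹ * ∫ τ in (0 : ℝ)..t, (t - τ) ^ (α - 1) * phiSub α τ s)
      (psiSub α t₀ s) t₀ := by
  have hG : Real.Gamma α ≠ 0 := (Real.Gamma_pos_of_pos hα.1).ne'
  have hphi : ∀ t : ℝ, 0 < t → ∫ τ in (0 : ℝ)..t, (t - τ) ^ (α - 1) * phiSub α τ s =
      π⁻¹ * ∫ τ in (0 : ℝ)..t, (t - τ) ^ (α - 1) * (stableFourier α s α τ).im := by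
    intro t ht
    rw [← intervalIntegral.integral_const_mul, intervalIntegral.integral_of_le ht.le,
      intervalIntegral.integral_of_le ht.le]
    refine MeasureTheory.setIntegral_congr_fun measurableSet_Ioc fun τ hτ => ?_
    simp only [phiSub_eq_stableFourier_im hα hs hτ.1]
    ring
  rw [psiSub_eq_stableFourier_im hα hs ht₀]
  have hD := Complex.imCLM.hasFDerivAt.comp_hasDerivAt t₀
    (hasDerivAt_integral_stableKernel hα hs t₀)
  refine ((hD.const_mul π⁻¹).const_add ((Real.Gamma α)⁻¹ * (π⁻¹ *
    ∫ τ in (0 : ℝ)..t₀, (t₀ - τ) ^ (α - 1) * (stableFourier α s α τ).im))).congr_of_eventuallyEq ?_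
  filter_upwards [lt_mem_nhds ht₀] with t ht
  rw [hphi t ht, eq_add_of_sub_eq (fractionalIntegral_sub_eq hα hs ht ht₀)]
  rw [mul_add, mul_add, add_comm, mul_left_comm π⁻¹, inv_mul_cancel_left₀ hG]
  rfl
end

section
/- For every s > 0 and every t₀ > 0, the function t ↦ φ_{t,α}(s) is differentiable at t = t₀ and its derivative there equals ν_{t₀,α}(s) := t₀^{−α−1} ∑_{k=0}^∞ (−s t₀^{−α})ᵏ/(k! Γ(−α−αk)). -/
open Real

/-- `ν_{t,α}(s) = t^{-α-1} ∑_{k=0}^∞ (-s t^{-α})^k / (k! Γ(-α - α k))`,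
the Wright function `t^{-α-1} ₀Ψ₁[ -; (-α,-α) | -s t^{-α} ]`. -/
noncomputable def nuSub (α t s : ℝ) : ℝ :=
  t ^ (-α - 1) * ∑' k : ℕ, (-(s * t ^ (-α))) ^ k /
    (k.factorial * Real.Gamma (-α - α * k))

open Filter Topology in
/-- The majorant series for the Wright functions converges. -/
lemma summable_pow_mul_factorial_rpow_div {a : ℝ} (ha : a < 1) {r : ℝ} (hr : 0 < r) :
    Summable fun k : ℕ => r ^ k * ((k + 1).factorial : ℝ) ^ a / k.factorial := by
  have hpos (k : ℕ) : 0 < r ^ k * ((k + 1).factorial : ℝ) ^ a / k.factorial := by positivity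
  refine summable_of_ratio_test_tendsto_lt_one zero_lt_one
    (Eventually.of_forall fun k => (hpos k).ne') ?_
  have hlim : Tendsto (fun k : ℕ => 2 * r * ((k : ℝ) + 2) ^ (-(1 - a))) atTop (𝓝 0) := by
    have h := (tendsto_rpow_neg_atTop (sub_pos.2 ha)).comp
      (tendsto_atTop_add_const_right atTop (2 : ℝ) tendsto_natCast_atTop_atTop)
    simpa using h.const_mul (2 * r)
  refine squeeze_zero (fun k => by positivity) (fun k => ?_) hlim
  rw [norm_of_nonneg (hpos _).le, norm_of_nonneg (hpos _).le, div_le_iff₀ (hpos k)]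
  have h2 : (0 : ℝ) < (k : ℝ) + 2 := by positivity
  have hfac : ((k + 1 + 1).factorial : ℝ) ^ a
      = ((k : ℝ) + 2) ^ a * ((k + 1).factorial : ℝ) ^ a := by
    rw [Nat.factorial_succ, Nat.cast_mul, mul_rpow (by positivity) (by positivity)]
    push_cast
    ring_nf
  have hexp : ((k : ℝ) + 2) ^ (-(1 - a)) = ((k : ℝ) + 2) ^ a / (k + 2) := by
    rw [neg_sub, rpow_sub_one h2.ne']
  rw [hfac, hexp, Nat.factorial_succ k, pow_succ]
  set A : ℝ := ((k : ℝ) + 2) ^ a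
  have hA : 0 < A := by positivity
  set B : ℝ := (((k + 1) * k.factorial : ℕ) : ℝ) ^ a
  have hB : 0 < B := by positivity
  have hk : (0 : ℝ) < k.factorial := by positivity
  push_cast
  have key : 1 / ((k : ℝ) + 1) ≤ 2 / (k + 2) := by
    rw [div_le_div_iff₀ (by positivity) h2]
    linarith [(Nat.cast_nonneg k : (0 : ℝ) ≤ k)]
  calc r ^ k * r * (A * B) / (((k : ℝ) + 1) * k.factorial)
      = (r ^ k * r * (A * B) / k.factorial) * (1 / ((k : ℝ) + 1)) := by field_simp
    _ ≤ (r ^ k * r * (A * B) / k.factorial) * (2 / (k + 2)) := by gcongr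
    _ = 2 * r * (A / (k + 2)) * (r ^ k * B / k.factorial) := by ring

/-- The reflection formula bounds `1 / Γ` on the negative axis. -/
lemma abs_inv_Gamma_le_Gamma_one_sub {z : ℝ} (hz : z < 1) :
    |(Gamma z)⁻¹| ≤ Gamma (1 - z) := by
  have hG : 0 < Gamma (1 - z) := Gamma_pos_of_pos (by linarith)
  rcases eq_or_ne (Gamma z) 0 with h0 | h0
  · simpa [h0] using hG.le
  have hrefl := Gamma_mul_Gamma_one_sub z
  have hsin : sin (π * z) ≠ 0 := by
    intro h
    rw [h, div_zero] at hrefl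
    exact mul_ne_zero h0 hG.ne' hrefl
  have hinv : (Gamma z)⁻¹ = Gamma (1 - z) * (sin (π * z) / π) := by
    rw [eq_div_iff hsin] at hrefl
    refine inv_eq_of_mul_eq_one_right ?_
    rw [← mul_assoc, ← mul_div_assoc, hrefl, div_self pi_ne_zero]
  rw [hinv, abs_mul, abs_of_pos hG, abs_div, abs_of_pos pi_pos]
  refine mul_le_of_le_one_right hG.le ((div_le_one pi_pos).2 ?_)
  linarith [abs_sin_le_one (π * z), pi_gt_three]

/-- Log-convexity of `Γ` compares `Γ(1 + a m)` with a power of `m!`. -/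
lemma Gamma_one_add_mul_natCast_le {a : ℝ} (ha : a ∈ Set.Ioo (0 : ℝ) 1) (m : ℕ) :
    Gamma (1 + a * m) ≤ (m.factorial : ℝ) ^ a := by
  have h := Gamma_mul_add_mul_le_rpow_Gamma_mul_rpow_Gamma (s := 1) (t := (m : ℝ) + 1)
    (a := 1 - a) (b := a) one_pos (by positivity) (sub_pos.2 ha.2) ha.1 (by ring)
  rw [Gamma_one, one_rpow, one_mul, Gamma_nat_eq_factorial] at h
  convert h using 2
  ring

lemma abs_inv_Gamma_neg_sub_mul_le {α : ℝ} (hα : α ∈ Set.Ioo (0 : ℝ) 1) (k : ℕ) :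
    |(Gamma (-α - α * k))⁻¹| ≤ ((k + 1).factorial : ℝ) ^ α := by
  have hk : 0 ≤ α * k := mul_nonneg hα.1.le k.cast_nonneg
  refine (abs_inv_Gamma_le_Gamma_one_sub (by linarith [hα.1])).trans ?_
  have h : 1 - (-α - α * k) = 1 + α * ((k + 1 : ℕ) : ℝ) := by
    push_cast
    ring
  exact h ▸ Gamma_one_add_mul_natCast_le hα (k + 1)

/-- The derivative in time of a single term of the series of `phiSub`. -/
lemma hasDerivAt_phiSub_term {α : ℝ} (hα : 0 < α) (s : ℝ) (k : ℕ) {t : ℝ} (ht : 0 < t) :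
    HasDerivAt
      (fun t : ℝ => t ^ (-α) * ((-(s * t ^ (-α))) ^ k / (k.factorial * Gamma (1 - α - α * k))))
      (t ^ (-α - 1) * ((-(s * t ^ (-α))) ^ k / (k.factorial * Gamma (-α - α * k)))) t := by
  have hz : -α - α * k ≠ 0 := by
    have hk : 0 ≤ α * k := mul_nonneg hα.le k.cast_nonneg
    linarith
  have hGamma : (Gamma (-α - α * k))⁻¹ = (-α - α * k) * (Gamma (1 - α - α * k))⁻¹ := by
    rw [show 1 - α - α * k = -α - α * k + 1 by ring, Gamma_add_one hz, mul_inv,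
      mul_inv_cancel_left₀ hz]
  have h1 : HasDerivAt (fun t : ℝ => t ^ (-α)) (-α * t ^ (-α - 1)) t :=
    hasDerivAt_rpow_const (Or.inl ht.ne')
  have h2 := h1.mul ((((h1.const_mul s).neg).pow k).div_const
    (k.factorial * Gamma (1 - α - α * k)))
  refine h2.congr_deriv ?_
  simp only [div_eq_mul_inv, mul_inv, hGamma, Pi.neg_apply, Pi.pow_apply]
  rcases k with _ | k
  · simp
    ring
  · rw [Nat.add_sub_cancel, pow_succ]
    push_cast
    ring

lemma abs_nuSub_term_le {α : ℝ} (hα : α ∈ Set.Ioo (0 : ℝ) 1) {s : ℝ} (hs : 0 < s) (k : ℕ)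
    {T t : ℝ} (hT : 0 < T) (hTt : T ≤ t) :
    |t ^ (-α - 1) * ((-(s * t ^ (-α))) ^ k / (k.factorial * Gamma (-α - α * k)))| ≤
      T ^ (-α - 1) *
        ((s * T ^ (-α)) ^ k * ((k + 1).factorial : ℝ) ^ α / k.factorial) := by
  have ht : 0 < t := hT.trans_le hTt
  have h1 : t ^ (-α - 1) ≤ T ^ (-α - 1) := rpow_le_rpow_of_nonpos hT hTt (by linarith [hα.1])
  have h2 : t ^ (-α) ≤ T ^ (-α) := rpow_le_rpow_of_nonpos hT hTt (by linarith [hα.1])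
  have h3 := abs_inv_Gamma_neg_sub_mul_le hα k
  have hst : 0 < s * t ^ (-α) := by positivity
  calc |t ^ (-α - 1) * ((-(s * t ^ (-α))) ^ k / (k.factorial * Gamma (-α - α * k)))|
      = t ^ (-α - 1) *
          ((s * t ^ (-α)) ^ k * |(Gamma (-α - α * k))⁻¹| / k.factorial) := by
        rw [abs_mul, abs_div, abs_pow, abs_neg, abs_of_pos hst, abs_mul, Nat.abs_cast,
          abs_of_pos (rpow_pos_of_pos ht _), abs_inv]
        ring
    _ ≤ _ := by gcongr

/-- For `s > 0`, `t₀ > 0` and `0 < α < 1`, the function `t ↦ φ_{t,α}(s)` is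
differentiable at `t₀` with derivative `ν_{t₀,α}(s)`. -/
theorem hasDerivAt_phiSub_eq_nuSub
    (α : ℝ) (hα : α ∈ Set.Ioo (0 : ℝ) 1) (s t₀ : ℝ) (hs : 0 < s) (ht₀ : 0 < t₀) :
    HasDerivAt (fun t : ℝ => phiSub α t s) (nuSub α t₀ s) t₀ := by
  have hT : 0 < t₀ / 2 := half_pos ht₀
  have hmem : t₀ ∈ Set.Ioi (t₀ / 2) := half_lt_self ht₀
  have hsum := (summable_pow_mul_factorial_rpow_div hα.2
    (mul_pos hs (rpow_pos_of_pos hT (-α)))).mul_left ((t₀ / 2) ^ (-α - 1))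
  have hsum₀ : Summable fun k : ℕ => t₀ ^ (-α) *
      ((-(s * t₀ ^ (-α))) ^ k / (k.factorial * Gamma (1 - α - α * k))) := by
    refine Summable.of_norm_bounded (hsum.mul_left (t₀ / α)) fun k => ?_
    have hk : 0 ≤ α * k := mul_nonneg hα.1.le k.cast_nonneg
    have hz : -α - α * k ≠ 0 := by linarith [hα.1]
    have hterm : t₀ ^ (-α) *
          ((-(s * t₀ ^ (-α))) ^ k / (k.factorial * Gamma (1 - α - α * k)))
        = t₀ / (-α - α * k) * (t₀ ^ (-α - 1) *
          ((-(s * t₀ ^ (-α))) ^ k / (k.factorial * Gamma (-α - α * k)))) := by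
      rw [show 1 - α - α * k = -α - α * k + 1 by ring, Gamma_add_one hz, rpow_sub_one ht₀.ne']
      simp only [div_eq_mul_inv, mul_inv]
      field_simp
    rw [hterm, norm_mul, norm_eq_abs, norm_eq_abs, abs_div, abs_of_pos ht₀]
    have hα₀ := hα.1
    have hle : α ≤ |-α - α * k| := by
      rw [abs_of_neg (by linarith)]
      linarith
    gcongr
    exact abs_nuSub_term_le hα hs k hT hmem.le
  have h := hasDerivAt_tsum_of_isPreconnected hsum isOpen_Ioi isPreconnected_Ioi
    (fun k t ht => hasDerivAt_phiSub_term hα.1 s k (hT.trans ht))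
    (fun k t ht => abs_nuSub_term_le hα hs k hT (le_of_lt ht)) hmem hsum₀ hmem
  simp only [tsum_mul_left] at h
  exact h
end

section
/- For every ζ > 0 and every t > 0, E_{α,α}(−ζ t^α) = t^{−α} ∫₀^∞ ( ∑_{k=1}^∞ (−s t^{−α})ᵏ/(k! Γ(−αk)) ) e^{−ζ s} ds, the integral being absolutely convergent. -/
open MeasureTheory Real

/-- The Mittag-Leffler type function `E_{α,α}(z) = ∑_{k=0}^∞ z^k / Γ(α + α k)`. -/
noncomputable def mlAA (α : ℝ) (z : ℝ) : ℝ :=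
  ∑' k : ℕ, z ^ k / Real.Gamma (α + α * k)

/-- The Wright function `₀Ψ₁[ -; (0,-α) | -x ] = ∑_{k=1}^∞ (-x)^k / (k! Γ(-α k))`. -/
noncomputable def wright0 (α : ℝ) (x : ℝ) : ℝ :=
  ∑' k : ℕ, (-x) ^ (k + 1) / ((k + 1).factorial * Real.Gamma (-(α * (k + 1))))

open Set Filter Topology

lemma integrableOn_rpow_mul_exp_neg_mul {a b : ℝ} (ha : 0 < a) (hb : 0 < b) :
    IntegrableOn (fun t : ℝ => t ^ (a - 1) * Real.exp (-(b * t))) (Ioi 0) := by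
  have h := integrableOn_rpow_mul_exp_neg_mul_rpow (p := 1) (s := a - 1) (b := b)
    (by linarith) one_pos hb
  simpa using h

lemma norm_cexp_neg_mul_ofReal (z : ℂ) (t : ℝ) :
    ‖Complex.exp (-(z * t))‖ = Real.exp (-(z.re * t)) := by
  simp [Complex.norm_exp]

lemma integrableOn_rpow_mul_cexp_neg_mul {a : ℝ} {z : ℂ} (ha : 0 < a) (hz : 0 < z.re) :
    IntegrableOn (fun t : ℝ => ((t ^ (a - 1) : ℝ) : ℂ) * Complex.exp (-(z * t))) (Ioi 0) := by
  refine (integrableOn_rpow_mul_exp_neg_mul ha hz).mono' (by fun_prop) ?_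
  refine (ae_restrict_iff' measurableSet_Ioi).2 (ae_of_all _ fun t ht => ?_)
  rw [norm_mul, norm_cexp_neg_mul_ofReal, Complex.norm_real,
    Real.norm_of_nonneg (Real.rpow_nonneg (le_of_lt ht) _)]

lemma differentiableOn_integral_rpow_mul_cexp_neg_mul {a : ℝ} (ha : 0 < a) :
    DifferentiableOn ℂ (fun z : ℂ => ∫ t : ℝ in Ioi 0,
      ((t ^ (a - 1) : ℝ) : ℂ) * Complex.exp (-(z * t))) {z | 0 < z.re} := by
  intro z₀ hz₀
  have hz₀' : 0 < z₀.re := hz₀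
  refine DifferentiableAt.differentiableWithinAt ?_
  have hs : {z : ℂ | z₀.re / 2 < z.re} ∈ 𝓝 z₀ :=
    (isOpen_lt continuous_const Complex.continuous_re).mem_nhds (by simp; linarith)
  refine (hasDerivAt_integral_of_dominated_loc_of_deriv_le
    (μ := volume.restrict (Ioi 0))
    (F := fun (z : ℂ) (t : ℝ) => ((t ^ (a - 1) : ℝ) : ℂ) * Complex.exp (-(z * t)))
    (F' := fun (z : ℂ) (t : ℝ) => ((t ^ (a - 1) : ℝ) : ℂ) * (Complex.exp (-(z * t)) * -t))
    (bound := fun t : ℝ => t ^ (a + 1 - 1) * Real.exp (-(z₀.re / 2 * t)))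
    hs (Eventually.of_forall fun z => by fun_prop) (integrableOn_rpow_mul_cexp_neg_mul ha hz₀)
    (by fun_prop) ?_ (integrableOn_rpow_mul_exp_neg_mul (by linarith) (by linarith))
    (ae_of_all _ fun t z _ => ?_)).2.differentiableAt
  · refine (ae_restrict_iff' measurableSet_Ioi).2 (ae_of_all _ fun t ht z hz => ?_)
    have ht' : 0 < t := ht
    have hz' : z₀.re / 2 < z.re := hz
    rw [norm_mul, norm_mul, norm_cexp_neg_mul_ofReal, Complex.norm_real, norm_neg,
      Complex.norm_real, Real.norm_of_nonneg (Real.rpow_nonneg ht'.le _),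
      Real.norm_of_nonneg ht'.le, add_sub_right_comm, Real.rpow_add_one ht'.ne']
    rw [mul_comm (Real.exp _) t, ← mul_assoc]
    gcongr
  · have h : HasDerivAt (fun z : ℂ => -(z * t)) (-t) z := by
      simpa using ((hasDerivAt_id' z).mul_const (t : ℂ)).fun_neg
    exact h.cexp.const_mul _

lemma integral_rpow_mul_cexp_neg_mul {a : ℝ} {z : ℂ} (ha : 0 < a) (hz : 0 < z.re) :
    ∫ t : ℝ in Ioi 0, ((t ^ (a - 1) : ℝ) : ℂ) * Complex.exp (-(z * t)) =
      z ^ (-a : ℂ) * Real.Gamma a := by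
  have hU : IsOpen {z : ℂ | 0 < z.re} := isOpen_lt continuous_const Complex.continuous_re
  have hd : DifferentiableOn ℂ (fun z : ℂ => z ^ (-a : ℂ) * (Real.Gamma a : ℂ))
      {z | 0 < z.re} := fun w hw =>
    ((differentiableAt_id.cpow_const (Or.inl hw)).mul_const _).differentiableWithinAt
  refine AnalyticOnNhd.eqOn_of_preconnected_of_frequently_eq (z₀ := 1)
    ((differentiableOn_integral_rpow_mul_cexp_neg_mul ha).analyticOnNhd hU)
    (hd.analyticOnNhd hU) (convex_halfSpace_re_gt 0).isPreconnected (by simp) ?_ hz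
  have hr : ∃ᶠ x : ℝ in 𝓝[≠] (1 : ℝ), 0 < x :=
    ((eventually_gt_nhds one_pos).filter_mono nhdsWithin_le_nhds).frequently
  have hmap : Tendsto (fun x : ℝ => (x : ℂ)) (𝓝[≠] (1 : ℝ)) (𝓝[≠] (1 : ℂ)) := by
    refine tendsto_nhdsWithin_of_tendsto_nhds_of_eventually_within _ ?_ ?_
    · exact (Complex.continuous_ofReal.tendsto' 1 1 (by simp)).mono_left nhdsWithin_le_nhds
    · filter_upwards [self_mem_nhdsWithin] with x hx
      simpa using hx
  refine hmap.frequently (hr.mono fun x hx => ?_)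
  have h := Complex.integral_cpow_mul_exp_neg_mul_Ioi (a := a) (by simpa using ha) hx
  rw [Complex.cpow_neg, ← Complex.Gamma_ofReal, ← Complex.inv_cpow, ← one_div, ← h]
  · refine setIntegral_congr_fun measurableSet_Ioi fun t ht => ?_
    simp [Complex.ofReal_cpow (le_of_lt ht)]
  · rw [Complex.arg_ofReal_of_nonneg hx.le]; exact Real.pi_pos.ne

lemma ofReal_mul_cexp_cpow_neg {ρ ψ : ℝ} (a : ℝ) (hρ : 0 < ρ) (hψ : ψ ∈ Ioc (-π) π) :
    ((ρ : ℂ) * Complex.exp (ψ * Complex.I)) ^ (-a : ℂ) =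
      ((ρ ^ (-a) : ℝ) : ℂ) * Complex.exp (-(a * ψ) * Complex.I) := by
  have hlog : Complex.log (Complex.exp (ψ * Complex.I)) = ψ * Complex.I :=
    Complex.log_exp (by simpa using hψ.1) (by simpa using hψ.2)
  rw [Complex.cpow_def_of_ne_zero (by simp [hρ.ne', Complex.exp_ne_zero]),
    Complex.log_ofReal_mul hρ (Complex.exp_ne_zero _), hlog, Real.rpow_def_of_pos hρ,
    Complex.ofReal_exp, ← Complex.exp_add]
  congr 1
  push_cast
  ring

lemma re_ofReal_mul_cexp (ρ ψ : ℝ) :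
    ((ρ : ℂ) * Complex.exp (ψ * Complex.I)).re = ρ * Real.cos ψ := by
  rw [Complex.re_ofReal_mul, Complex.exp_ofReal_mul_I_re]

/-- The Gamma integral along the ray of argument `ψ`. -/
lemma integral_rpow_mul_cexp_ray {a ρ ψ : ℝ} (ha : 0 < a) (hρ : 0 < ρ)
    (hψ : ψ ∈ Ioo (-(π / 2)) (π / 2)) :
    ∫ t : ℝ in Ioi 0, ((t ^ (a - 1) : ℝ) : ℂ) *
        Complex.exp (-((ρ : ℂ) * Complex.exp (ψ * Complex.I) * t)) =
      ((ρ ^ (-a) : ℝ) : ℂ) * Complex.exp (-(a * ψ) * Complex.I) * Real.Gamma a := by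
  rw [integral_rpow_mul_cexp_neg_mul ha, ofReal_mul_cexp_cpow_neg a hρ]
  · constructor <;> linarith [hψ.1, hψ.2, Real.pi_pos]
  · rw [re_ofReal_mul_cexp]
    exact mul_pos hρ (Real.cos_pos_of_mem_Ioo hψ)

/-- The integrand of the representation of the Wright function by an integral along the ray
of argument `π - θ`. -/
noncomputable def wrightKernel (α θ x r : ℝ) : ℂ :=
  Complex.exp (-(Complex.exp ((-θ : ℝ) * Complex.I) * r)) *
    Complex.exp (-(x * Complex.exp ((α * (π - θ) : ℝ) * Complex.I) * (r ^ α : ℝ)))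

lemma integrableOn_exp_mul_rpow_mul_exp_neg_mul {α b : ℝ} (hα : α ∈ Ioo (0 : ℝ) 1) (hb : 0 < b)
    (x : ℝ) : IntegrableOn (fun r : ℝ => Real.exp (-(b * r)) * Real.exp (x * r ^ α)) (Ioi 0) := by
  refine integrable_of_isBigO_exp_neg (half_pos hb) ?_ ?_
  · exact (Continuous.mul (by fun_prop) (Real.continuous_exp.comp
      (continuous_const.mul (Real.continuous_rpow_const hα.1.le)))).continuousOn
  · have ht : Tendsto (fun r : ℝ => x * r ^ (-(1 - α))) atTop (𝓝 (x * 0)) :=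
      (tendsto_rpow_neg_atTop (by linarith [hα.2])).const_mul x
    rw [mul_zero] at ht
    refine Asymptotics.IsBigO.of_bound' ?_
    filter_upwards [ht.eventually_lt_const (half_pos hb), eventually_gt_atTop 0] with r hr hr0
    rw [← Real.exp_add, Real.norm_eq_abs, Real.norm_eq_abs, Real.abs_exp, Real.abs_exp,
      Real.exp_le_exp]
    have h : x * r ^ α = x * r ^ (-(1 - α)) * r := by
      rw [mul_assoc, ← Real.rpow_add_one hr0.ne']
      ring_nf
    rw [h]
    nlinarith

lemma norm_cexp_ofReal_mul_I (ψ : ℝ) : ‖Complex.exp (ψ * Complex.I)‖ = 1 :=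
  Complex.norm_exp_ofReal_mul_I ψ

lemma norm_cexp_neg_ray_mul (ψ r : ℝ) :
    ‖Complex.exp (-(Complex.exp (ψ * Complex.I) * r))‖ = Real.exp (-(Real.cos ψ * r)) := by
  rw [norm_cexp_neg_mul_ofReal, Complex.exp_ofReal_mul_I_re]

lemma norm_cexp_neg_mul_ray_mul (x ψ r : ℝ) :
    ‖Complex.exp (-(x * Complex.exp (ψ * Complex.I) * r))‖ =
      Real.exp (-(x * Real.cos ψ * r)) := by
  rw [norm_cexp_neg_mul_ofReal, re_ofReal_mul_cexp]

lemma norm_wrightKernel (α θ x r : ℝ) :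
    ‖wrightKernel α θ x r‖ = Real.exp (-(Real.cos θ * r)) *
      Real.exp (-(x * Real.cos (α * (π - θ)) * r ^ α)) := by
  rw [wrightKernel, norm_mul, norm_cexp_neg_ray_mul, norm_cexp_neg_mul_ray_mul, Real.cos_neg]

lemma hasSum_integral_wrightKernel {α θ : ℝ} (hα : α ∈ Ioo (0 : ℝ) 1) (hθ : θ ∈ Ioo 0 (π / 2))
    (x : ℝ) :
    HasSum (fun k : ℕ => ∫ r : ℝ in Ioi 0,
        Complex.exp (-(Complex.exp ((-θ : ℝ) * Complex.I) * r)) *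
        ((-(x * Complex.exp ((α * (π - θ) : ℝ) * Complex.I) * (r ^ α : ℝ))) ^ k / k.factorial))
      (∫ r : ℝ in Ioi 0, wrightKernel α θ x r) := by
  have hc : 0 < Real.cos θ := Real.cos_pos_of_mem_Ioo ⟨by linarith [hθ.1, hθ.2], hθ.2⟩
  have hs : ∀ r : ℝ, HasSum (fun k : ℕ => Real.exp (-(Real.cos θ * r)) *
      ((|x| * r ^ α) ^ k / k.factorial))
      (Real.exp (-(Real.cos θ * r)) * Real.exp (|x| * r ^ α)) := fun r =>
    (Real.exp_eq_exp_ℝ ▸ NormedSpace.expSeries_div_hasSum_exp (|x| * r ^ α)).mul_left _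
  refine hasSum_integral_of_dominated_convergence
    (fun (k : ℕ) (r : ℝ) => Real.exp (-(Real.cos θ * r)) * ((|x| * r ^ α) ^ k / k.factorial))
    (fun k => by fun_prop) (fun k => ?_) (ae_of_all _ fun r => (hs r).summable) ?_
    (ae_of_all _ fun r => ?_)
  · refine (ae_restrict_iff' measurableSet_Ioi).2 (ae_of_all _ fun r hr => le_of_eq ?_)
    rw [norm_mul, norm_cexp_neg_ray_mul, Real.cos_neg, norm_div, norm_pow, norm_neg, norm_mul,
      norm_mul, norm_cexp_ofReal_mul_I, Complex.norm_real, Complex.norm_real, Real.norm_eq_abs,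
      Real.norm_of_nonneg (Real.rpow_nonneg (le_of_lt hr) _), mul_one, Complex.norm_natCast]
  · simp_rw [fun r => (hs r).tsum_eq]
    exact integrableOn_exp_mul_rpow_mul_exp_neg_mul hα hc |x|
  · have h := NormedSpace.expSeries_div_hasSum_exp
      (-(x * Complex.exp ((α * (π - θ) : ℝ) * Complex.I) * (r ^ α : ℝ)))
    rw [← Complex.exp_eq_exp_ℂ] at h
    exact h.mul_left _

lemma integral_cexp_ray_mul_pow {α θ : ℝ} (hα : 0 < α) (hθ : θ ∈ Ioo 0 (π / 2)) (x : ℝ)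
    (k : ℕ) :
    Complex.exp ((-θ : ℝ) * Complex.I) * ∫ r : ℝ in Ioi 0,
        Complex.exp (-(Complex.exp ((-θ : ℝ) * Complex.I) * r)) *
        ((-(x * Complex.exp ((α * (π - θ) : ℝ) * Complex.I) * (r ^ α : ℝ))) ^ k / k.factorial) =
      (((-x) ^ k / k.factorial * Real.Gamma (α * k + 1) : ℝ) : ℂ) *
        Complex.exp ((π * (α * k) : ℝ) * Complex.I) := by
  have h := integral_rpow_mul_cexp_ray (a := α * k + 1) (ρ := 1) (ψ := -θ) (by positivity)
    one_pos ⟨by linarith [hθ.2], by linarith [hθ.1, hθ.2]⟩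
  simp only [Complex.ofReal_one, one_mul, Real.one_rpow, add_sub_cancel_right] at h
  calc
    _ = Complex.exp ((-θ : ℝ) * Complex.I) * ∫ r : ℝ in Ioi 0,
          ((-(x * Complex.exp ((α * (π - θ) : ℝ) * Complex.I))) ^ k / k.factorial) *
          (((r ^ (α * k) : ℝ) : ℂ) *
            Complex.exp (-(Complex.exp ((-θ : ℝ) * Complex.I) * r))) := by
      congr 1
      refine setIntegral_congr_fun measurableSet_Ioi fun r hr => ?_
      simp only [Real.rpow_mul (le_of_lt hr), Real.rpow_natCast, Complex.ofReal_pow]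
      rw [← neg_mul ((x : ℂ) * _), mul_pow (-((x : ℂ) * _))]
      ring
    _ = _ := by
      rw [integral_const_mul, h, ← neg_mul, mul_pow, ← Complex.exp_nat_mul]
      have e : Complex.exp ((π * (α * k) : ℝ) * Complex.I) =
          Complex.exp ((-θ : ℝ) * Complex.I) *
            (Complex.exp (k * ((α * (π - θ) : ℝ) * Complex.I)) *
            Complex.exp (-((α * k + 1 : ℝ) * (-θ : ℝ)) * Complex.I)) := by
        rw [← Complex.exp_add, ← Complex.exp_add]
        congr 1
        push_cast
        ring
      rw [e]
      push_cast
      ring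

lemma inv_Gamma_neg (s : ℝ) (hs : 0 ≤ s) :
    (Real.Gamma (-s))⁻¹ = -(1 / π) * (Real.Gamma (s + 1) * Real.sin (π * s)) := by
  have h := Real.Gamma_mul_Gamma_one_sub (-s)
  have hG : Real.Gamma (s + 1) ≠ 0 := (Real.Gamma_pos_of_pos (by linarith)).ne'
  rw [sub_neg_eq_add, add_comm, mul_neg, Real.sin_neg] at h
  rw [eq_div_of_mul_eq hG h, inv_div, div_neg, div_neg, div_div_eq_mul_div]
  ring

/-- The Wright function as an integral along a ray. -/
lemma wright0_eq_integral {α θ : ℝ} (hα : α ∈ Ioo (0 : ℝ) 1) (hθ : θ ∈ Ioo 0 (π / 2)) (x : ℝ) :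
    wright0 α x = -(1 / π) * (Complex.exp ((-θ : ℝ) * Complex.I) *
      ∫ r : ℝ in Ioi 0, wrightKernel α θ x r).im := by
  have h := ((hasSum_integral_wrightKernel hα hθ x).mul_left
    (Complex.exp ((-θ : ℝ) * Complex.I))).mapL Complex.imCLM
  simp only [integral_cexp_ray_mul_pow hα.1 hθ, Complex.imCLM_apply, Complex.im_ofReal_mul,
    Complex.exp_ofReal_mul_I_im] at h
  rw [← h.tsum_eq, h.summable.tsum_eq_zero_add]
  simp only [CharP.cast_eq_zero, mul_zero, Real.sin_zero, zero_add, ← tsum_mul_left, wright0]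
  refine tsum_congr fun k => ?_
  rw [div_mul_eq_div_div, div_eq_mul_inv _ (Real.Gamma _),
    inv_Gamma_neg _ (mul_nonneg hα.1.le (by positivity))]
  push_cast
  ring

lemma integrableOn_pow_mul_exp_neg_mul_rpow {α b : ℝ} (hα : 0 < α) (hb : 0 < b) (n : ℕ) :
    IntegrableOn (fun r : ℝ => r ^ n * Real.exp (-(b * r ^ α))) (Ioi 0) := by
  have h := integrableOn_rpow_mul_exp_neg_mul_rpow (p := α) (s := n) (b := b)
    (by linarith [(Nat.cast_nonneg n : (0 : ℝ) ≤ n)]) hα hb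
  simpa using h

lemma integrableOn_pow_mul_cexp_ray {α s ψ : ℝ} (hα : 0 < α) (hs : 0 < s)
    (hψ : ψ ∈ Ioo (-(π / 2)) (π / 2)) (n : ℕ) :
    IntegrableOn (fun r : ℝ => (r : ℂ) ^ n *
      Complex.exp (-(s * Complex.exp (ψ * Complex.I) * (r ^ α : ℝ)))) (Ioi 0) := by
  refine (integrableOn_pow_mul_exp_neg_mul_rpow hα
    (mul_pos hs (Real.cos_pos_of_mem_Ioo hψ)) n).mono' (by fun_prop) ?_
  refine (ae_restrict_iff' measurableSet_Ioi).2 (ae_of_all _ fun r hr => ?_)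
  rw [norm_mul, norm_cexp_neg_mul_ray_mul, norm_pow, Complex.norm_real,
    Real.norm_of_nonneg (le_of_lt hr)]

lemma integral_pow_mul_cexp_ray {α s ψ : ℝ} (hα : 0 < α) (hs : 0 < s)
    (hψ : ψ ∈ Ioo (-(π / 2)) (π / 2)) (n : ℕ) :
    ∫ r : ℝ in Ioi 0, (r : ℂ) ^ n *
        Complex.exp (-(s * Complex.exp (ψ * Complex.I) * (r ^ α : ℝ))) =
      ((α⁻¹ * s ^ (-((n + 1) / α)) * Real.Gamma ((n + 1) / α) : ℝ) : ℂ) *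
        Complex.exp ((-((n + 1) / α * ψ) : ℝ) * Complex.I) := by
  have h := integral_rpow_mul_cexp_ray (a := (n + 1) / α) (by positivity) hs hψ
  rw [← integral_comp_rpow_Ioi_of_pos hα] at h
  calc
    _ = ∫ r : ℝ in Ioi 0, (α : ℂ)⁻¹ * ((α * r ^ (α - 1)) •
          ((((r ^ α) ^ ((n + 1) / α - 1) : ℝ) : ℂ) *
          Complex.exp (-(s * Complex.exp (ψ * Complex.I) * (r ^ α : ℝ))))) := by
      refine setIntegral_congr_fun measurableSet_Ioi fun r hr => ?_
      have e : r ^ n = r ^ (α - 1) * (r ^ α) ^ ((n + 1) / α - 1) := by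
        rw [← Real.rpow_mul (le_of_lt hr), ← Real.rpow_add hr, ← Real.rpow_natCast]
        congr 1
        field_simp
        ring
      have e' : (r : ℂ) ^ n = ((r ^ (α - 1) : ℝ) : ℂ) * (((r ^ α) ^ ((n + 1) / α - 1) : ℝ) : ℂ) := by
        exact_mod_cast e
      have hα' : (α : ℂ) ≠ 0 := by exact_mod_cast hα.ne'
      simp only [e', Complex.real_smul, Complex.ofReal_mul]
      field_simp
    _ = _ := by
      rw [integral_const_mul, h]
      push_cast
      ring

/-- The integer powers contribute only real terms, hence drop out of the imaginary part. -/
lemma im_mul_integral_pow_mul_cexp_ray {α θ s : ℝ} (hα : 0 < α) (hs : 0 < s)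
    (hψ : α * (π - θ) ∈ Ioo (-(π / 2)) (π / 2)) (n : ℕ) :
    (Complex.exp ((-θ : ℝ) * Complex.I) * ∫ r : ℝ in Ioi 0,
      ((-(Complex.exp ((-θ : ℝ) * Complex.I) * r)) ^ n / n.factorial) *
        Complex.exp (-(s * Complex.exp ((α * (π - θ) : ℝ) * Complex.I) * (r ^ α : ℝ)))).im = 0 := by
  have h : Complex.exp ((-θ : ℝ) * Complex.I) * ∫ r : ℝ in Ioi 0,
      ((-(Complex.exp ((-θ : ℝ) * Complex.I) * r)) ^ n / n.factorial) *
        Complex.exp (-(s * Complex.exp ((α * (π - θ) : ℝ) * Complex.I) * (r ^ α : ℝ))) =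
      (((-1) ^ n / n.factorial *
        (α⁻¹ * s ^ (-((n + 1) / α)) * Real.Gamma ((n + 1) / α)) : ℝ) : ℂ) *
        Complex.exp ((-((n + 1 : ℕ) * π) : ℝ) * Complex.I) := by
    calc
      _ = Complex.exp ((-θ : ℝ) * Complex.I) * ∫ r : ℝ in Ioi 0,
          ((-1) ^ n / n.factorial * Complex.exp ((-θ : ℝ) * Complex.I) ^ n) * ((r : ℂ) ^ n *
            Complex.exp (-(s * Complex.exp ((α * (π - θ) : ℝ) * Complex.I) * (r ^ α : ℝ)))) := by
        congr 2
        ext r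
        rw [neg_pow, mul_pow]
        ring
      _ = _ := by
        have e : Complex.exp ((-((n + 1 : ℕ) * π) : ℝ) * Complex.I) =
            Complex.exp ((-θ : ℝ) * Complex.I) * (Complex.exp (n * ((-θ : ℝ) * Complex.I)) *
              Complex.exp ((-((n + 1) / α * (α * (π - θ))) : ℝ) * Complex.I)) := by
          rw [← Complex.exp_add, ← Complex.exp_add]
          congr 1
          have e₁ : (n + 1) / α * (α * (π - θ)) = (n + 1) * (π - θ) := by field_simp
          rw [e₁]
          push_cast
          ring
        rw [integral_const_mul, integral_pow_mul_cexp_ray hα hs hψ, e, ← Complex.exp_nat_mul]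
        push_cast
        ring
  rw [h, Complex.im_ofReal_mul, Complex.exp_ofReal_mul_I_im, Real.sin_neg,
    Real.sin_nat_mul_pi, neg_zero, mul_zero]

lemma norm_cexp_neg_sub_sum_le {w : ℂ} (hw : ‖w‖ ≤ 1) (hre : 0 ≤ w.re) (N : ℕ) :
    ∀ r : ℝ, 0 ≤ r → ‖Complex.exp (-(w * r)) -
      ∑ k ∈ Finset.range N, (-(w * r)) ^ k / k.factorial‖ ≤ r ^ N / N.factorial := by
  have hl : ∀ r : ℝ, HasDerivAt (fun r : ℝ => -(w * r)) (-w) r := fun r => by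
    simpa using (((hasDerivAt_id' r).ofReal_comp).const_mul w).fun_neg
  induction N with
  | zero =>
    intro r hr
    simpa [norm_cexp_neg_mul_ofReal] using mul_nonneg hre hr
  | succ N ih =>
    intro r hr
    have hd : ∀ x : ℝ, HasDerivAt (fun r : ℝ => Complex.exp (-(w * r)) -
        ∑ k ∈ Finset.range (N + 1), (-(w * r)) ^ k / k.factorial)
        (-w * (Complex.exp (-(w * x)) -
          ∑ k ∈ Finset.range N, (-(w * x)) ^ k / k.factorial)) x := by
      intro x
      have h₁ : ∀ k ∈ Finset.range N, HasDerivAt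
          (fun r : ℝ => (-(w * r)) ^ (k + 1) / ((k + 1).factorial : ℂ))
          (-w * ((-(w * x)) ^ k / k.factorial)) x := by
        intro k _
        convert! ((hl x).pow (k + 1)).div_const ((k + 1).factorial : ℂ) using 1
        have : (k.factorial : ℂ) ≠ 0 := by exact_mod_cast k.factorial_ne_zero
        have : (k : ℂ) + 1 ≠ 0 := by exact_mod_cast k.succ_ne_zero
        rw [Nat.factorial_succ, Nat.add_sub_cancel]
        push_cast
        field_simp
      convert! (hl x).cexp.sub ((HasDerivAt.fun_sum h₁).add_const 1) using 1
      · ext y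
        simp [Finset.sum_range_succ']
      · rw [← Finset.mul_sum]
        ring
    have hB : ∀ x : ℝ, HasDerivAt (fun x : ℝ => x ^ (N + 1) / ((N + 1).factorial : ℝ))
        (x ^ N / N.factorial) x := by
      intro x
      convert! (hasDerivAt_pow (N + 1) x).div_const ((N + 1).factorial : ℝ) using 1
      rw [Nat.factorial_succ, Nat.add_sub_cancel]
      push_cast
      field_simp
    refine image_norm_le_of_norm_deriv_right_le_deriv_boundary (a := 0) (b := r)
      (fun x _ => (hd x).continuousAt.continuousWithinAt) (fun x _ => (hd x).hasDerivWithinAt)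
      ?_ hB (fun x hx => ?_) ⟨hr, le_rfl⟩
    · simp [Finset.sum_range_succ']
    · rw [norm_mul, norm_neg]
      exact (mul_le_of_le_one_left (norm_nonneg _) hw).trans (ih x hx.1)

lemma abs_wright0_le {α θ : ℝ} (hα : α ∈ Ioo (0 : ℝ) 1) (hθ : θ ∈ Ioo 0 (π / 2)) (x : ℝ) :
    |wright0 α x| ≤ 1 / π * ‖∫ r : ℝ in Ioi 0, wrightKernel α θ x r‖ := by
  rw [wright0_eq_integral hα hθ, abs_mul, abs_neg, abs_of_pos (by positivity : 0 < 1 / π)]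
  gcongr
  refine (Complex.abs_im_le_norm _).trans_eq ?_
  rw [norm_mul, norm_cexp_ofReal_mul_I, one_mul]

lemma abs_wright0_le_of_pos {α θ : ℝ} (hα : α ∈ Ioo (0 : ℝ) 1) (hθ : θ ∈ Ioo 0 (π / 2))
    (hψ : α * (π - θ) ∈ Ioo (-(π / 2)) (π / 2)) {s : ℝ} (hs : 0 < s) :
    |wright0 α s| ≤ 1 / π * ∫ r in Ioi 0, Real.exp (-(Real.cos θ * r)) := by
  have hc : 0 < Real.cos θ := Real.cos_pos_of_mem_Ioo ⟨by linarith [hθ.1, hθ.2], hθ.2⟩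
  refine (abs_wright0_le hα hθ s).trans ?_
  gcongr
  refine norm_integral_le_of_norm_le ?_
    ((ae_restrict_iff' measurableSet_Ioi).2 (ae_of_all _ fun r hr => ?_))
  · simpa [IntegrableOn] using integrableOn_rpow_mul_exp_neg_mul one_pos hc
  · rw [norm_wrightKernel]
    refine mul_le_of_le_one_right (Real.exp_nonneg _) (Real.exp_le_one_iff.2 ?_)
    have := Real.rpow_nonneg (le_of_lt hr) α
    have := Real.cos_pos_of_mem_Ioo hψ
    rw [neg_nonpos]
    positivity

lemma abs_wright0_le_integral_pow {α θ : ℝ} (hα : α ∈ Ioo (0 : ℝ) 1) (hθ : θ ∈ Ioo 0 (π / 2))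
    (hψ : α * (π - θ) ∈ Ioo (-(π / 2)) (π / 2)) {s : ℝ} (hs : 0 < s) (N : ℕ) :
    |wright0 α s| ≤ 1 / π * ∫ r in Ioi 0, r ^ N / N.factorial *
      Real.exp (-(s * Real.cos (α * (π - θ)) * r ^ α)) := by
  have hκ := Real.cos_pos_of_mem_Ioo hψ
  have hc : 0 < Real.cos θ := Real.cos_pos_of_mem_Ioo ⟨by linarith [hθ.1, hθ.2], hθ.2⟩
  set w := Complex.exp ((-θ : ℝ) * Complex.I) with hw
  have hw1 : ‖w‖ = 1 := norm_cexp_ofReal_mul_I _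
  have hwre : 0 ≤ w.re := by rw [hw, Complex.exp_ofReal_mul_I_re, Real.cos_neg]; exact hc.le
  set E : ℝ → ℂ := fun r =>
    Complex.exp (-(s * Complex.exp ((α * (π - θ) : ℝ) * Complex.I) * (r ^ α : ℝ))) with hE
  have hEn : ∀ r, ‖E r‖ = Real.exp (-(s * Real.cos (α * (π - θ)) * r ^ α)) := fun r =>
    norm_cexp_neg_mul_ray_mul _ _ _
  have hterm : ∀ k : ℕ, IntegrableOn
      (fun r : ℝ => ((-(w * r)) ^ k / k.factorial) * E r) (Ioi 0) := fun k => by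
    refine ((integrableOn_pow_mul_cexp_ray hα.1 hs hψ k).const_mul
      ((-w) ^ k / k.factorial)).congr (ae_of_all _ fun r => ?_)
    simp only [hE]
    rw [← neg_mul w, mul_pow (-w)]
    ring
  have hbound : IntegrableOn (fun r : ℝ => r ^ N / N.factorial *
      Real.exp (-(s * Real.cos (α * (π - θ)) * r ^ α))) (Ioi 0) := by
    refine ((integrableOn_pow_mul_exp_neg_mul_rpow hα.1 (mul_pos hs hκ) N).const_mul
      (1 / N.factorial : ℝ)).congr (ae_of_all _ fun r => ?_)
    ring
  set g : ℝ → ℂ := fun r => (Complex.exp (-(w * r)) -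
    ∑ k ∈ Finset.range N, (-(w * r)) ^ k / k.factorial) * E r with hg
  have hgn : ∀ᵐ r ∂(volume.restrict (Ioi (0 : ℝ))), ‖g r‖ ≤ r ^ N / N.factorial *
      Real.exp (-(s * Real.cos (α * (π - θ)) * r ^ α)) := by
    refine (ae_restrict_iff' measurableSet_Ioi).2 (ae_of_all _ fun r hr => ?_)
    rw [norm_mul, hEn]
    gcongr
    exact norm_cexp_neg_sub_sum_le hw1.le hwre N r (le_of_lt hr)
  have hgi : IntegrableOn g (Ioi 0) := hbound.mono' (by fun_prop) hgn
  have hsum : ∫ r in Ioi 0, wrightKernel α θ s r = (∫ r in Ioi 0, g r) +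
      ∑ k ∈ Finset.range N, ∫ r : ℝ in Ioi 0, ((-(w * r)) ^ k / k.factorial) * E r := by
    rw [← integral_finsetSum _ fun k _ => hterm k,
      ← integral_add hgi (integrable_finsetSum _ fun k _ => hterm k)]
    congr 1
    ext r
    rw [hg, ← Finset.sum_mul, ← add_mul, sub_add_cancel]
    rfl
  have him : (w * ∫ r in Ioi 0, wrightKernel α θ s r).im = (w * ∫ r in Ioi 0, g r).im := by
    rw [hsum, mul_add, Complex.add_im, Finset.mul_sum, Complex.im_sum,
      Finset.sum_eq_zero fun k _ => im_mul_integral_pow_mul_cexp_ray hα.1 hs hψ k, add_zero]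
  rw [wright0_eq_integral hα hθ, ← hw, him, abs_mul, abs_neg,
    abs_of_pos (by positivity : 0 < 1 / π)]
  gcongr
  refine (Complex.abs_im_le_norm _).trans ?_
  rw [norm_mul, hw1, one_mul]
  exact norm_integral_le_of_norm_le hbound hgn

lemma exists_le_mul_exp_mul_rpow {α b : ℝ} (hα : 0 < α) (hb : 0 < b) :
    ∃ D, 0 < D ∧ ∀ r : ℝ, 0 ≤ r → r ≤ D * Real.exp (b * r ^ α) := by
  obtain ⟨m, hm⟩ := exists_nat_ge (1 / α)
  refine ⟨1 + m.factorial / b ^ m, by positivity, fun r hr => ?_⟩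
  have hu := Real.rpow_nonneg hr α
  have h1 : 1 ≤ Real.exp (b * r ^ α) := Real.one_le_exp (by positivity)
  have h0 : 0 ≤ m.factorial / b ^ m * Real.exp (b * r ^ α) := by positivity
  rw [one_add_mul]
  rcases le_total r 1 with h | h
  · linarith
  · have h2 := Real.pow_div_factorial_le_exp (b * r ^ α) (by positivity) m
    have h3 : r ≤ (r ^ α) ^ m := by
      rw [← Real.rpow_natCast, ← Real.rpow_mul hr]
      refine (Real.rpow_one r).symm.le.trans (Real.rpow_le_rpow_of_exponent_le h ?_)
      rwa [div_le_iff₀' hα] at hm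
    have h4 : (r ^ α) ^ m ≤ m.factorial / b ^ m * Real.exp (b * r ^ α) := by
      rw [div_mul_eq_mul_div, le_div_iff₀ (by positivity), ← mul_pow, mul_comm _ b,
        mul_comm _ (Real.exp _)]
      rwa [div_le_iff₀ (by positivity)] at h2
    linarith

/-- On the positive axis the Wright function decays faster than every exponential. -/
lemma exists_abs_wright0_le_exp {α θ : ℝ} (hα : α ∈ Ioo (0 : ℝ) 1) (hθ : θ ∈ Ioo 0 (π / 2))
    (hψ : α * (π - θ) ∈ Ioo (-(π / 2)) (π / 2)) {M : ℝ} (hM : 0 ≤ M) :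
    ∃ C, ∀ s, 0 < s → |wright0 α s| ≤ C * Real.exp (-(M * s)) := by
  have hκ := Real.cos_pos_of_mem_Ioo hψ
  obtain ⟨D, hD, hr⟩ := exists_le_mul_exp_mul_rpow hα.1 (half_pos hκ)
  set κ := Real.cos (α * (π - θ))
  set B := 1 / π * ∫ r in Ioi 0, Real.exp (-(Real.cos θ * r)) with hB
  set A := 1 / π * ∫ r in Ioi 0, Real.exp (-(κ / 2 * r ^ α)) with hA
  have hB0 : 0 ≤ B := mul_nonneg (by positivity) (integral_nonneg fun _ => Real.exp_nonneg _)
  have hA0 : 0 ≤ A := mul_nonneg (by positivity) (integral_nonneg fun _ => Real.exp_nonneg _)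
  have hlarge : ∀ n : ℕ, 1 ≤ n → ∀ s : ℝ, n ≤ s →
      |wright0 α s| ≤ A * (D ^ n / n.factorial) := by
    intro n hn s hs
    have hn' : (1 : ℝ) ≤ n := by exact_mod_cast hn
    refine (abs_wright0_le_integral_pow hα hθ hψ (by linarith) n).trans ?_
    rw [hA, mul_assoc, ← integral_mul_const]
    gcongr 1 / π * ?_
    refine setIntegral_mono_on ?_ ?_ measurableSet_Ioi fun r hr0 => ?_
    · refine ((integrableOn_pow_mul_exp_neg_mul_rpow hα.1
        (mul_pos (by linarith : 0 < s) hκ) n).const_mul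
        (1 / n.factorial : ℝ)).congr (ae_of_all _ fun r => ?_)
      ring
    · simpa [IntegrableOn] using (integrableOn_pow_mul_exp_neg_mul_rpow hα.1 (half_pos hκ) 0).mul_const
        (D ^ n / n.factorial)
    · have hr0' : (0 : ℝ) ≤ r := le_of_lt hr0
      have hu := Real.rpow_nonneg hr0' α
      have h1 : r ^ n ≤ D ^ n * Real.exp (n * (κ / 2 * r ^ α)) := by
        rw [Real.exp_nat_mul, ← mul_pow]
        exact pow_le_pow_left₀ hr0' (hr r hr0') n
      have h2 : Real.exp (n * (κ / 2 * r ^ α)) * Real.exp (-(s * κ * r ^ α)) ≤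
          Real.exp (-(κ / 2 * r ^ α)) := by
        rw [← Real.exp_add, Real.exp_le_exp]
        have h3 : 0 ≤ κ * r ^ α := by positivity
        nlinarith
      calc r ^ n / n.factorial * Real.exp (-(s * κ * r ^ α))
          ≤ (D ^ n * Real.exp (n * (κ / 2 * r ^ α))) / n.factorial *
            Real.exp (-(s * κ * r ^ α)) := by gcongr
        _ = (Real.exp (n * (κ / 2 * r ^ α)) * Real.exp (-(s * κ * r ^ α))) *
            (D ^ n / n.factorial) := by ring
        _ ≤ _ := by gcongr
  refine ⟨Real.exp M * (B + A * Real.exp (Real.exp M * D)), fun s hs => ?_⟩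
  have hfl : s < ⌊s⌋₊ + 1 := Nat.lt_floor_add_one s
  have hfl' : (⌊s⌋₊ : ℝ) ≤ s := Nat.floor_le hs.le
  generalize ⌊s⌋₊ = n at hfl hfl'
  have hexp : Real.exp (M * s) ≤ Real.exp M * Real.exp M ^ n := by
    rw [← Real.exp_nat_mul, ← Real.exp_add, Real.exp_le_exp]
    nlinarith
  rw [Real.exp_neg, ← div_eq_mul_inv, le_div_iff₀ (Real.exp_pos _), mul_add]
  rcases Nat.eq_zero_or_pos n with rfl | hn
  · have h := abs_wright0_le_of_pos hα hθ hψ hs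
    rw [pow_zero, mul_one] at hexp
    have h' : |wright0 α s| * Real.exp (M * s) ≤ B * Real.exp M := by gcongr
    have : 0 ≤ Real.exp M * (A * Real.exp (Real.exp M * D)) := by positivity
    linarith
  · have h := hlarge n hn s hfl'
    have hf := Real.pow_div_factorial_le_exp (Real.exp M * D) (by positivity) n
    have : 0 ≤ Real.exp M * B := by positivity
    calc |wright0 α s| * Real.exp (M * s)
        ≤ (A * (D ^ n / n.factorial)) * (Real.exp M * Real.exp M ^ n) := by gcongr
      _ = Real.exp M * (A * ((Real.exp M * D) ^ n / n.factorial)) := by rw [mul_pow]; ring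
      _ ≤ Real.exp M * (A * Real.exp (Real.exp M * D)) := by gcongr
      _ ≤ _ := by linarith

lemma exists_ray_angle {α : ℝ} (hα : α ∈ Ioo (0 : ℝ) 1) :
    ∃ θ ∈ Ioo 0 (π / 2), α * (π - θ) ∈ Ioo (-(π / 2)) (π / 2) := by
  have hπ := Real.pi_pos
  obtain ⟨h0, h1⟩ := hα
  refine ⟨π / 4 * (1 + α), ⟨by positivity, by nlinarith⟩, ?_, ?_⟩
  · have : 0 < α * (π - π / 4 * (1 + α)) := mul_pos h0 (by nlinarith)
    linarith
  · nlinarith [mul_pos hπ (mul_pos (sub_pos.2 h1) (by linarith : 0 < 2 - α))]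

lemma stronglyMeasurable_wright0 {α θ : ℝ} (hα : α ∈ Ioo (0 : ℝ) 1) (hθ : θ ∈ Ioo 0 (π / 2)) :
    StronglyMeasurable (wright0 α) := by
  have hK : StronglyMeasurable (Function.uncurry (wrightKernel α θ)) := by
    unfold Function.uncurry wrightKernel
    exact Measurable.stronglyMeasurable (by fun_prop)
  have hm : Measurable fun x => ∫ r in Ioi 0, wrightKernel α θ x r :=
    (hK.integral_prod_right (ν := volume.restrict (Ioi 0))).measurable
  rw [show wright0 α = _ from funext (wright0_eq_integral hα hθ)]
  exact Measurable.stronglyMeasurable (by fun_prop)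

lemma integrable_rpow_mul_wrightKernel {α θ a : ℝ} (hα : α ∈ Ioo (0 : ℝ) 1)
    (hθ : θ ∈ Ioo 0 (π / 2)) (hψ : α * (π - θ) ∈ Ioo (-(π / 2)) (π / 2))
    (ha : a ∈ Ioo (0 : ℝ) 1) :
    Integrable (Function.uncurry fun s r : ℝ => ((s ^ (a - 1) : ℝ) : ℂ) * wrightKernel α θ s r)
      ((volume.restrict (Ioi 0)).prod (volume.restrict (Ioi 0))) := by
  have hκ := Real.cos_pos_of_mem_Ioo hψ
  have hc : 0 < Real.cos θ := Real.cos_pos_of_mem_Ioo ⟨by linarith [hθ.1, hθ.2], hθ.2⟩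
  have hαa : 0 < 1 - α * a := by nlinarith [hα.1, hα.2, ha.1, ha.2]
  have hmeas : Measurable
      (Function.uncurry fun s r : ℝ => ((s ^ (a - 1) : ℝ) : ℂ) * wrightKernel α θ s r) := by
    unfold Function.uncurry wrightKernel
    fun_prop
  have hnorm : ∀ s r : ℝ, 0 < s → ‖((s ^ (a - 1) : ℝ) : ℂ) * wrightKernel α θ s r‖ =
      Real.exp (-(Real.cos θ * r)) *
        (s ^ (a - 1) * Real.exp (-(Real.cos (α * (π - θ)) * r ^ α * s))) := fun s r hs => by
    rw [norm_mul, norm_wrightKernel, Complex.norm_real,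
      Real.norm_of_nonneg (Real.rpow_nonneg hs.le _)]
    ring_nf
  rw [integrable_prod_iff' hmeas.aestronglyMeasurable]
  constructor
  · refine (ae_restrict_iff' measurableSet_Ioi).2 (ae_of_all _ fun r hr => ?_)
    have hr' := Real.rpow_pos_of_pos hr α
    refine ((integrableOn_rpow_mul_exp_neg_mul ha.1 (mul_pos hκ hr')).const_mul
      (Real.exp (-(Real.cos θ * r)))).mono'
      (hmeas.comp measurable_prodMk_right).aestronglyMeasurable ?_
    exact (ae_restrict_iff' measurableSet_Ioi).2 (ae_of_all _ fun s hs => (hnorm s r hs).le)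
  · refine IntegrableOn.congr_fun ((integrableOn_rpow_mul_exp_neg_mul hαa hc).const_mul
      (Real.cos (α * (π - θ)) ^ (-a) * Real.Gamma a)) (fun r hr => ?_) measurableSet_Ioi
    have hr' := Real.rpow_pos_of_pos hr α
    have h : ∫ s in Ioi 0, ‖((s ^ (a - 1) : ℝ) : ℂ) * wrightKernel α θ s r‖ =
        ∫ s in Ioi 0, Real.exp (-(Real.cos θ * r)) *
          (s ^ (a - 1) * Real.exp (-(Real.cos (α * (π - θ)) * r ^ α * s))) :=
      setIntegral_congr_fun measurableSet_Ioi fun s hs => hnorm s r hs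
    simp only [Function.uncurry_apply_pair]
    rw [h, integral_const_mul, Real.integral_rpow_mul_exp_neg_mul_Ioi ha.1 (mul_pos hκ hr'),
      one_div, ← Real.rpow_neg_eq_inv_rpow, Real.mul_rpow hκ.le hr'.le,
      ← Real.rpow_mul (le_of_lt hr)]
    ring_nf

/-- The Mellin transform of the Wright function in the strip where Fubini applies. -/
lemma integral_rpow_mul_wright0 {α θ a : ℝ} (hα : α ∈ Ioo (0 : ℝ) 1)
    (hθ : θ ∈ Ioo 0 (π / 2)) (hψ : α * (π - θ) ∈ Ioo (-(π / 2)) (π / 2))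
    (ha : a ∈ Ioo (0 : ℝ) 1) :
    ∫ s in Ioi 0, s ^ (a - 1) * wright0 α s = Real.Gamma a * (Real.Gamma (α * a))⁻¹ := by
  have hαa : 0 < 1 - α * a := by nlinarith [hα.1, hα.2, ha.1, ha.2]
  have hαa' : 0 < α * a := mul_pos hα.1 ha.1
  have hint := integrable_rpow_mul_wrightKernel hα hθ hψ ha
  have hinner : ∀ r ∈ Ioi (0 : ℝ), ∫ s in Ioi 0, ((s ^ (a - 1) : ℝ) : ℂ) * wrightKernel α θ s r =
      (Complex.exp (-(a * (α * (π - θ) : ℝ)) * Complex.I) * Real.Gamma a) *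
        (((r ^ (1 - α * a - 1) : ℝ) : ℂ) *
          Complex.exp (-((1 : ℝ) * Complex.exp ((-θ : ℝ) * Complex.I) * r))) := by
    intro r hr
    have h := integral_rpow_mul_cexp_ray ha.1 (Real.rpow_pos_of_pos hr α) hψ
    have e : (r ^ α) ^ (-a) = r ^ (1 - α * a - 1) := by
      rw [← Real.rpow_mul (le_of_lt hr)]
      ring_nf
    rw [e] at h
    calc _ = ∫ s : ℝ in Ioi 0, Complex.exp (-(Complex.exp ((-θ : ℝ) * Complex.I) * r)) *
          (((s ^ (a - 1) : ℝ) : ℂ) * Complex.exp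
            (-((r ^ α : ℝ) * Complex.exp ((α * (π - θ) : ℝ) * Complex.I) * s))) := by
          congr 1
          ext s
          have e' : (s : ℂ) * Complex.exp ((α * (π - θ) : ℝ) * Complex.I) * (r ^ α : ℝ) =
              (r ^ α : ℝ) * Complex.exp ((α * (π - θ) : ℝ) * Complex.I) * s := by ring
          rw [wrightKernel, e', mul_left_comm]
      _ = _ := by
          rw [integral_const_mul, h, Complex.ofReal_one, one_mul]
          ring
  have hswap : ∫ s in Ioi 0, ((s ^ (a - 1) : ℝ) : ℂ) * ∫ r in Ioi 0, wrightKernel α θ s r =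
      (Complex.exp (-(a * (α * (π - θ) : ℝ)) * Complex.I) * Real.Gamma a) *
        (Complex.exp (-((1 - α * a : ℝ) * (-θ : ℝ)) * Complex.I) *
          Real.Gamma (1 - α * a)) := by
    simp_rw [← integral_const_mul]
    rw [integral_integral_swap hint, setIntegral_congr_fun measurableSet_Ioi hinner,
      integral_const_mul, integral_rpow_mul_cexp_ray hαa one_pos
        ⟨by linarith [hθ.2], by linarith [hθ.1, hθ.2]⟩, Real.one_rpow, Complex.ofReal_one, one_mul]
  have hi : IntegrableOn (fun s => Complex.exp ((-θ : ℝ) * Complex.I) *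
      (((s ^ (a - 1) : ℝ) : ℂ) * ∫ r in Ioi 0, wrightKernel α θ s r)) (Ioi 0) := by
    refine Integrable.const_mul ?_ _
    simp_rw [← integral_const_mul]
    exact hint.integral_prod_left
  have hval : Complex.exp ((-θ : ℝ) * Complex.I) *
      ((Complex.exp (-(a * (α * (π - θ) : ℝ)) * Complex.I) * Real.Gamma a) *
        (Complex.exp (-((1 - α * a : ℝ) * (-θ : ℝ)) * Complex.I) *
          Real.Gamma (1 - α * a))) =
      ((Real.Gamma a * Real.Gamma (1 - α * a) : ℝ) : ℂ) *
        Complex.exp ((-(π * (α * a)) : ℝ) * Complex.I) := by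
    have e : Complex.exp ((-(π * (α * a)) : ℝ) * Complex.I) =
        Complex.exp ((-θ : ℝ) * Complex.I) *
          (Complex.exp (-(a * (α * (π - θ) : ℝ)) * Complex.I) *
          Complex.exp (-((1 - α * a : ℝ) * (-θ : ℝ)) * Complex.I)) := by
      rw [← Complex.exp_add, ← Complex.exp_add]
      congr 1
      push_cast
      ring
    rw [e]
    push_cast
    ring
  have him : ∫ s in Ioi 0, (Complex.exp ((-θ : ℝ) * Complex.I) *
      (((s ^ (a - 1) : ℝ) : ℂ) * ∫ r in Ioi 0, wrightKernel α θ s r)).im =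
      Real.Gamma a * Real.Gamma (1 - α * a) * -Real.sin (π * (α * a)) := by
    have h := Complex.imCLM.integral_comp_comm hi
    simp only [Complex.imCLM_apply] at h
    rw [h, integral_const_mul, hswap, hval, Complex.im_ofReal_mul, Complex.exp_ofReal_mul_I_im,
      Real.sin_neg]
  have hΓ := Real.Gamma_mul_Gamma_one_sub (α * a)
  have hΓ0 := (Real.Gamma_pos_of_pos hαa').ne'
  have hsin : Real.sin (π * (α * a)) ≠ 0 :=
    (Real.sin_pos_of_pos_of_lt_pi (by positivity) (by nlinarith [Real.pi_pos])).ne'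
  calc _ = ∫ s in Ioi 0, -(1 / π) * (Complex.exp ((-θ : ℝ) * Complex.I) *
      (((s ^ (a - 1) : ℝ) : ℂ) * ∫ r in Ioi 0, wrightKernel α θ s r)).im := by
        congr 1
        ext s
        rw [wright0_eq_integral hα hθ, mul_left_comm (Complex.exp _), Complex.im_ofReal_mul]
        ring
    _ = _ := by
        rw [integral_const_mul, him]
        rw [mul_comm, ← eq_div_iff hΓ0] at hΓ
        rw [hΓ]
        generalize Real.sin (π * (α * a)) = S at hsin
        field_simp

lemma integrableOn_wright0_mul_exp {α : ℝ} (hα : α ∈ Ioo (0 : ℝ) 1) (z : ℝ) :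
    IntegrableOn (fun s : ℝ => wright0 α s * Real.exp (z * s)) (Ioi 0) := by
  obtain ⟨θ, hθ, hψ⟩ := exists_ray_angle hα
  obtain ⟨C, hC⟩ := exists_abs_wright0_le_exp hα hθ hψ (M := |z| + 1) (by positivity)
  have hi : IntegrableOn (fun s : ℝ => C * Real.exp (-(1 * s))) (Ioi 0) := by
    refine Integrable.const_mul ?_ C
    simpa [IntegrableOn] using integrableOn_rpow_mul_exp_neg_mul one_pos one_pos
  refine hi.mono' ((stronglyMeasurable_wright0 hα hθ).mul
    (Measurable.stronglyMeasurable (by fun_prop))).aestronglyMeasurable ?_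
  refine (ae_restrict_iff' measurableSet_Ioi).2 (ae_of_all _ fun s hs => ?_)
  have hs' : 0 < s := hs
  rw [norm_mul, Real.norm_eq_abs, Real.norm_of_nonneg (Real.exp_nonneg _)]
  refine (mul_le_mul_of_nonneg_right (hC s hs) (Real.exp_nonneg _)).trans ?_
  have h0 : 0 ≤ C := nonneg_of_mul_nonneg_left ((abs_nonneg _).trans (hC s hs)) (Real.exp_pos _)
  rw [mul_assoc, ← Real.exp_add]
  gcongr
  nlinarith [le_abs_self z]

lemma differentiableOn_mellin_wright0 {α : ℝ} (hα : α ∈ Ioo (0 : ℝ) 1) :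
    DifferentiableOn ℂ (mellin fun s => (wright0 α s : ℂ)) {z | 0 < z.re} := by
  obtain ⟨θ, hθ, hψ⟩ := exists_ray_angle hα
  intro z hz
  refine (mellin_differentiableAt_of_isBigO_rpow_exp (a := 1) (b := 0) one_pos ?_ ?_ ?_
    hz).differentiableWithinAt
  · have h := (integrableOn_wright0_mul_exp hα 0).ofReal (𝕜 := ℂ)
    simp only [zero_mul, Real.exp_zero, mul_one] at h
    exact IntegrableOn.locallyIntegrableOn h
  · obtain ⟨C, hC⟩ := exists_abs_wright0_le_exp hα hθ hψ zero_le_one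
    refine Asymptotics.IsBigO.of_bound C ?_
    filter_upwards [eventually_gt_atTop 0] with s hs
    rw [Complex.norm_real, Real.norm_of_nonneg (Real.exp_nonneg _), neg_mul]
    exact hC s hs
  · obtain ⟨C, hC⟩ := exists_abs_wright0_le_exp hα hθ hψ le_rfl
    refine Asymptotics.IsBigO.of_bound C ?_
    filter_upwards [self_mem_nhdsWithin] with s hs
    simpa using hC s hs

/-- The Mellin transform of the Wright function. -/
lemma mellin_wright0 {α : ℝ} (hα : α ∈ Ioo (0 : ℝ) 1) {z : ℂ} (hz : 0 < z.re) :
    mellin (fun s => (wright0 α s : ℂ)) z = Complex.Gamma z * (Complex.Gamma (α * z))⁻¹ := by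
  obtain ⟨θ, hθ, hψ⟩ := exists_ray_angle hα
  have hU : IsOpen {z : ℂ | 0 < z.re} := isOpen_lt continuous_const Complex.continuous_re
  have hd : DifferentiableOn ℂ (fun z : ℂ => Complex.Gamma z * (Complex.Gamma (α * z))⁻¹)
      {z | 0 < z.re} := fun w hw => by
    have hw' : 0 < w.re := hw
    refine DifferentiableAt.differentiableWithinAt (.mul
      (Complex.differentiableAt_Gamma w fun m h => ?_) ?_)
    · rw [h] at hw'
      simp only [Complex.neg_re, Complex.natCast_re] at hw'
      linarith [(Nat.cast_nonneg m : (0 : ℝ) ≤ m)]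
    · exact (Complex.differentiable_one_div_Gamma _).comp w (by fun_prop)
  refine AnalyticOnNhd.eqOn_of_preconnected_of_frequently_eq (z₀ := ((1 / 2 : ℝ) : ℂ))
    ((differentiableOn_mellin_wright0 hα).analyticOnNhd hU)
    (hd.analyticOnNhd hU) (convex_halfSpace_re_gt 0).isPreconnected (by simp) ?_ hz
  have hr : ∃ᶠ a : ℝ in 𝓝[≠] (1 / 2 : ℝ), a ∈ Ioo (0 : ℝ) 1 :=
    (Eventually.filter_mono nhdsWithin_le_nhds
      (Ioo_mem_nhds (by norm_num) (by norm_num))).frequently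
  have hmap : Tendsto (fun x : ℝ => (x : ℂ)) (𝓝[≠] (1 / 2 : ℝ)) (𝓝[≠] ((1 / 2 : ℝ) : ℂ)) := by
    refine tendsto_nhdsWithin_of_tendsto_nhds_of_eventually_within _ ?_ ?_
    · exact Complex.continuous_ofReal.continuousAt.mono_left nhdsWithin_le_nhds
    · filter_upwards [self_mem_nhdsWithin] with x hx
      simpa only [mem_compl_iff, mem_singleton_iff, Complex.ofReal_inj] using hx
  refine hmap.frequently (hr.mono fun a ha => ?_)
  have h := congrArg (fun x : ℝ => (x : ℂ)) (integral_rpow_mul_wright0 hα hθ hψ ha)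
  simp only [← integral_complex_ofReal, Complex.ofReal_mul, Complex.ofReal_inv,
    ← Complex.Gamma_ofReal] at h
  rw [← h, mellin]
  refine setIntegral_congr_fun measurableSet_Ioi fun s hs => ?_
  simp [Complex.ofReal_cpow (le_of_lt hs)]

lemma integral_pow_mul_wright0 {α : ℝ} (hα : α ∈ Ioo (0 : ℝ) 1) (n : ℕ) :
    ∫ s in Ioi 0, s ^ n * wright0 α s = n.factorial * (Real.Gamma (α + α * n))⁻¹ := by
  have h := mellin_wright0 hα (z := (n + 1 : ℝ)) (by
    rw [Complex.ofReal_re]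
    positivity)
  rw [← Complex.ofReal_mul, Complex.Gamma_ofReal, Complex.Gamma_ofReal,
    Real.Gamma_nat_eq_factorial, ← Complex.ofReal_inv, ← Complex.ofReal_mul,
    show α * ((n : ℝ) + 1) = α + α * n by ring] at h
  rw [← Complex.ofReal_inj, ← h, mellin, ← integral_complex_ofReal]
  refine setIntegral_congr_fun measurableSet_Ioi fun s hs => ?_
  simp

lemma hasSum_mlAA_neg_integral {α : ℝ} (hα : α ∈ Ioo (0 : ℝ) 1) {z : ℝ} (hz : 0 < z) :
    HasSum (fun k : ℕ => (-z) ^ k / Real.Gamma (α + α * k))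
      (∫ s in Ioi 0, wright0 α s * Real.exp (-z * s)) := by
  obtain ⟨θ, hθ, hψ⟩ := exists_ray_angle hα
  have hs : ∀ x s w : ℝ, HasSum (fun k : ℕ => (x * s) ^ k / k.factorial * w)
      (Real.exp (x * s) * w) := fun x s w => by
    have h := NormedSpace.expSeries_div_hasSum_exp (x * s)
    rw [← Real.exp_eq_exp_ℝ] at h
    exact h.mul_right _
  have hmain := hasSum_integral_of_dominated_convergence (μ := volume.restrict (Ioi 0))
    (F := fun (k : ℕ) (s : ℝ) => (-z * s) ^ k / k.factorial * wright0 α s)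
    (f := fun s => Real.exp (-z * s) * wright0 α s)
    (fun k s => (z * s) ^ k / k.factorial * |wright0 α s|)
    (fun k => ((Measurable.stronglyMeasurable (by fun_prop)).mul
      (stronglyMeasurable_wright0 hα hθ)).aestronglyMeasurable)
    (fun k => (ae_restrict_iff' measurableSet_Ioi).2 (ae_of_all _ fun s hs => ?_))
    (ae_of_all _ fun s => (hs z s _).summable)
    ?_ (ae_of_all _ fun s => hs (-z) s _)
  · simp only [mul_comm (Real.exp _)] at hmain
    convert! hmain using 2 with k
    have e : ∀ s : ℝ, (-z * s) ^ k / k.factorial * wright0 α s =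
        (-z) ^ k / k.factorial * (s ^ k * wright0 α s) := fun s => by ring
    simp only [e]
    rw [integral_const_mul, integral_pow_mul_wright0 hα]
    have := Nat.factorial_ne_zero k
    field_simp
  · have hs' : 0 < s := hs
    rw [norm_mul, norm_div, norm_pow, norm_mul, norm_neg, Real.norm_of_nonneg hz.le,
      Real.norm_of_nonneg hs'.le, Real.norm_natCast, Real.norm_eq_abs]
  · simp only [(hs z _ _).tsum_eq]
    refine (integrableOn_wright0_mul_exp hα z).norm.congr (ae_of_all _ fun s => ?_)
    simp only [norm_mul, Real.norm_of_nonneg (Real.exp_nonneg _), mul_comm, Real.norm_eq_abs]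

/-- For every `ζ > 0` and `t > 0`,
`E_{α,α}(-ζ t^α) = t^{-α} ∫₀^∞ ₀Ψ₁[ -; (0,-α) | -s t^{-α} ] e^{-ζ s} ds`,
the integral being absolutely convergent. -/
theorem mlAA_eq_laplace_wright0
    (α : ℝ) (hα : α ∈ Set.Ioo (0 : ℝ) 1) (ζ t : ℝ) (hζ : 0 < ζ) (ht : 0 < t) :
    IntegrableOn (fun s : ℝ => wright0 α (s * t ^ (-α)) * Real.exp (-ζ * s))
      (Set.Ioi 0) ∧
    mlAA α (-(ζ * t ^ α)) =
      t ^ (-α) * ∫ s in Set.Ioi (0 : ℝ), wright0 α (s * t ^ (-α)) * Real.exp (-ζ * s) := by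
  have hc : 0 < t ^ (-α) := Real.rpow_pos_of_pos ht _
  have hz : 0 < ζ * t ^ α := mul_pos hζ (Real.rpow_pos_of_pos ht _)
  let g : ℝ → ℝ := fun x => wright0 α x * Real.exp (-(ζ * t ^ α) * x)
  have hf : (fun s : ℝ => wright0 α (s * t ^ (-α)) * Real.exp (-ζ * s)) =
      fun s : ℝ => g (s * t ^ (-α)) := by
    ext s
    have h : t ^ α * t ^ (-α) = 1 := by rw [← Real.rpow_add ht, add_neg_cancel, Real.rpow_zero]
    have e : -(ζ * t ^ α) * (s * t ^ (-α)) = -ζ * s := by linear_combination (-ζ * s) * h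
    simp only [g, e]
  rw [hf]
  constructor
  · rw [integrableOn_Ioi_comp_mul_right_iff g 0 hc, zero_mul]
    exact integrableOn_wright0_mul_exp hα _
  · rw [integral_comp_mul_right_Ioi g 0 hc, zero_mul, smul_eq_mul, mul_inv_cancel_left₀ hc.ne']
    exact (hasSum_mlAA_neg_integral hα hz).tsum_eq
end

section
/- For every ζ > 0, E_{α,0}(−ζ) = ∫₀^∞ ( ∑_{k=0}^∞ (−s)ᵏ/(k! Γ(−α−αk)) ) e^{−ζ s} ds, the integral being absolutely convergent. -/
open MeasureTheory Real

/-- The Mittag-Leffler type function `E_{α,0}(z) = ∑_{k=0}^∞ z^k / Γ(α k)`, with the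
convention `1/Γ = 0` at the poles (note `Real.Gamma` vanishes at nonpositive integers). -/
noncomputable def mlA0 (α : ℝ) (z : ℝ) : ℝ :=
  ∑' k : ℕ, z ^ k / Real.Gamma (α * k)

/-- The Wright function `₀Ψ₁[ -; (-α,-α) | -x ] = ∑_{k=0}^∞ (-x)^k / (k! Γ(-α - α k))`. -/
noncomputable def wrightMinusAlpha (α : ℝ) (x : ℝ) : ℝ :=
  ∑' k : ℕ, (-x) ^ k / (k.factorial * Real.Gamma (-α - α * k))

open Filter Topology Set

/-- The integrand of the Hankel integral in the logarithmic coordinate `z = exp w`. -/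
noncomputable def hankelKernel (b : ℝ) (w : ℂ) : ℂ := Complex.exp (Complex.exp w + b * w)

lemma differentiable_hankelKernel (b : ℝ) : Differentiable ℂ (hankelKernel b) := by
  unfold hankelKernel
  fun_prop

lemma norm_hankelKernel (b x y : ℝ) :
    ‖hankelKernel b (x + y * Complex.I)‖ = exp (exp x * cos y + b * x) := by
  simp [hankelKernel, Complex.norm_exp, Complex.exp_re]

lemma continuous_hankelKernel_line (b y : ℝ) :
    Continuous fun x : ℝ => hankelKernel b (x + y * Complex.I) :=
  (differentiable_hankelKernel b).continuous.comp (by fun_prop)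

lemma integrableOn_Ioi_zero_iff_integrable_comp_exp (g : ℝ → ℝ) :
    IntegrableOn g (Ioi 0) ↔ Integrable fun x => exp x * g (exp x) := by
  have h := integrableOn_image_iff_integrableOn_abs_deriv_smul (f := exp) (f' := exp)
    MeasurableSet.univ (fun x _ => (hasDerivAt_exp x).hasDerivWithinAt) exp_injective.injOn g
  simpa [image_univ, range_exp, integrableOn_univ] using h

lemma integral_Ioi_zero_eq_integral_comp_exp (g : ℝ → ℝ) :
    ∫ t in Ioi 0, g t = ∫ x, exp x * g (exp x) := by
  have h := integral_image_eq_integral_abs_deriv_smul (f := exp) (f' := exp)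
    MeasurableSet.univ (fun x _ => (hasDerivAt_exp x).hasDerivWithinAt) exp_injective.injOn g
  simpa [image_univ, range_exp] using h

lemma integrable_exp_neg_mul_exp_add_mul {c b : ℝ} (hc : 0 < c) (hb : 0 < b) :
    Integrable fun x => exp (-c * exp x + b * x) := by
  have h := integrableOn_rpow_mul_exp_neg_mul_rpow (p := 1) (s := b - 1) (by linarith)
    one_pos hc
  rw [integrableOn_Ioi_zero_iff_integrable_comp_exp] at h
  refine h.congr (ae_of_all _ fun x => ?_)
  simp only [rpow_one, ← exp_mul, ← exp_add]
  ring_nf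

lemma integrableOn_Ioi_exp_neg_mul_exp_add_mul {c : ℝ} (hc : 0 < c) (b L : ℝ) :
    IntegrableOn (fun x => exp (-c * exp x + b * x)) (Ioi L) := by
  have h := ((integrable_exp_neg_mul_exp_add_mul hc
    (b := |b| + 1) (by positivity)).const_mul (exp ((b - |b| - 1) * L))).integrableOn (s := Ioi L)
  refine h.mono' (by fun_prop) ((ae_restrict_mem measurableSet_Ioi).mono fun x hx => ?_)
  rw [norm_of_nonneg (exp_pos _).le, ← exp_add]
  apply exp_le_exp.2
  have := le_abs_self b
  nlinarith [mem_Ioi.1 hx]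

lemma integral_exp_neg_exp_add_mul {b : ℝ} (hb : 0 < b) :
    ∫ x, exp (-exp x + b * x) = Gamma b := by
  rw [Gamma_eq_integral hb, integral_Ioi_zero_eq_integral_comp_exp]
  refine integral_congr_ae (ae_of_all _ fun x => ?_)
  simp only [← exp_mul, ← exp_add]
  ring_nf

lemma tendsto_intervalIntegral_edge {H : ℂ → ℂ} {B : ℝ → ℝ} {θ₁ θ₂ : ℝ} {l : Filter ℝ}
    (hθ : θ₁ ≤ θ₂) (hB : Tendsto B l (𝓝 0))
    (hbd : ∀ᶠ x : ℝ in l, ∀ y ∈ Icc θ₁ θ₂, ‖H (x + y * Complex.I)‖ ≤ B x) :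
    Tendsto (fun x : ℝ => Complex.I • ∫ y in θ₁..θ₂, H (x + y * Complex.I)) l (𝓝 0) := by
  have h0 : Tendsto (fun x => B x * |θ₂ - θ₁|) l (𝓝 0) := by simpa using hB.mul_const |θ₂ - θ₁|
  refine squeeze_zero_norm' (hbd.mono fun x hx => ?_) h0
  rw [norm_smul, Complex.norm_I, one_mul]
  refine intervalIntegral.norm_integral_le_of_norm_le_const fun y hy => hx y ?_
  rw [uIoc_of_le hθ] at hy
  exact ⟨hy.1.le, hy.2⟩

lemma integral_boundary_strip_rect {H : ℂ → ℂ} {θ₁ θ₂ : ℝ} (hθ : θ₁ ≤ θ₂)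
    (hH : ∀ x y : ℝ, y ∈ Icc θ₁ θ₂ → DifferentiableAt ℂ H (x + y * Complex.I)) (a b : ℝ) :
    ((∫ x in a..b, H (x + θ₁ * Complex.I)) - ∫ x in a..b, H (x + θ₂ * Complex.I)) +
      (Complex.I • ∫ y in θ₁..θ₂, H (b + y * Complex.I)) -
      Complex.I • ∫ y in θ₁..θ₂, H (a + y * Complex.I) = 0 := by
  have h := Complex.integral_boundary_rect_eq_zero_of_differentiableOn H
    (a + θ₁ * Complex.I) (b + θ₂ * Complex.I) (by
      intro w hw
      simp only [Complex.add_re, Complex.ofReal_re, Complex.mul_re, Complex.I_re, mul_zero,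
        Complex.ofReal_im, Complex.I_im, mul_one, sub_self, add_zero, Complex.add_im,
        Complex.mul_im, zero_add, uIcc_of_le hθ, Complex.mem_reProdIm] at hw
      have := hH w.re w.im hw.2
      rw [Complex.re_add_im] at this
      exact this.differentiableWithinAt)
  simpa using h

/-- Shifting a horizontal line of integration within a strip. -/
lemma integral_line_eq_of_strip {H : ℂ → ℂ} {B : ℝ → ℝ} {θ₁ θ₂ : ℝ} (hθ : θ₁ ≤ θ₂)
    (hH : ∀ x y : ℝ, y ∈ Icc θ₁ θ₂ → DifferentiableAt ℂ H (x + y * Complex.I))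
    (hbot : Tendsto B atBot (𝓝 0)) (htop : Tendsto B atTop (𝓝 0))
    (hbd : ∀ x : ℝ, ∀ y ∈ Icc θ₁ θ₂, ‖H (x + y * Complex.I)‖ ≤ B x)
    (h₁ : Integrable fun x : ℝ => H (x + θ₁ * Complex.I))
    (h₂ : Integrable fun x : ℝ => H (x + θ₂ * Complex.I)) :
    ∫ x : ℝ, H (x + θ₁ * Complex.I) = ∫ x : ℝ, H (x + θ₂ * Complex.I) := by
  have e1 := tendsto_intervalIntegral_edge hθ htop (Eventually.of_forall hbd)
  have e2 := (tendsto_intervalIntegral_edge hθ hbot (Eventually.of_forall hbd)).comp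
    tendsto_neg_atTop_atBot
  have l1 := intervalIntegral_tendsto_integral h₁ tendsto_neg_atTop_atBot tendsto_id
  have l2 := intervalIntegral_tendsto_integral h₂ tendsto_neg_atTop_atBot tendsto_id
  have h := tendsto_nhds_unique (((l1.sub l2).add e1).sub e2)
    (tendsto_const_nhds.congr fun x => (integral_boundary_strip_rect hθ hH (-x) x).symm)
  simpa [sub_eq_zero] using h

/-- The Hankel-type functional: an arc followed by a ray, in logarithmic coordinates. -/
noncomputable def hankelContour (θ L : ℝ) (H : ℂ → ℂ) : ℂ :=
  Complex.I * (∫ y in (0 : ℝ)..θ, H (L + y * Complex.I)) + ∫ x in Ioi L, H (x + θ * Complex.I)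

/-- For a function that is real on the real axis, the ray may be replaced by the contour
consisting of an arc and the end of the ray, without changing the imaginary part. -/
lemma im_integral_line_eq_im_hankelContour {H : ℂ → ℂ} {B : ℝ → ℝ} {θ L : ℝ} (hθ : 0 ≤ θ)
    (hH : ∀ x y : ℝ, y ∈ Icc 0 θ → DifferentiableAt ℂ H (x + y * Complex.I))
    (hreal : ∀ x : ℝ, (H x).im = 0)
    (hbot : Tendsto B atBot (𝓝 0))
    (hbd : ∀ x ≤ L, ∀ y ∈ Icc 0 θ, ‖H (x + y * Complex.I)‖ ≤ B x)
    (hHint : Integrable fun x : ℝ => H (x + θ * Complex.I)) :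
    (∫ x : ℝ, H (x + θ * Complex.I)).im = (hankelContour θ L H).im := by
  have e2 := tendsto_intervalIntegral_edge hθ hbot ((eventually_le_atBot L).mono hbd)
  have l2 := intervalIntegral_tendsto_integral_Iic L hHint.integrableOn tendsto_id
  have key : ∀ a : ℝ, (∫ x in a..L, H (x + θ * Complex.I)).im =
      (Complex.I * ∫ y in (0 : ℝ)..θ, H (L + y * Complex.I)).im -
      (Complex.I • ∫ y in (0 : ℝ)..θ, H (a + y * Complex.I)).im := by
    intro a
    have h := congrArg Complex.im (integral_boundary_strip_rect hθ hH a L)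
    have hc : ContinuousOn (fun x : ℝ => H x) (uIcc a L) := fun x _ => by
      have := (hH x 0 ⟨le_rfl, hθ⟩).continuousAt
      simp only [Complex.ofReal_zero, zero_mul, add_zero] at this
      exact (this.comp Complex.continuous_ofReal.continuousAt).continuousWithinAt
    have h0 : (∫ x in a..L, H (x + ((0 : ℝ) : ℂ) * Complex.I)).im = 0 := by
      simp only [Complex.ofReal_zero, zero_mul, add_zero]
      have := Complex.imCLM.intervalIntegral_comp_comm (hc.intervalIntegrable (μ := volume))
      simp only [Complex.imCLM_apply, hreal, intervalIntegral.integral_zero] at this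
      exact this.symm
    simp only [Complex.sub_im, Complex.add_im, h0, Complex.zero_im, smul_eq_mul] at h ⊢
    linarith
  have t1 := (Complex.continuous_im.tendsto _).comp l2
  have t2 := (tendsto_const_nhds (x :=
    (Complex.I * ∫ y in (0 : ℝ)..θ, H (L + y * Complex.I)).im)).sub
    ((Complex.continuous_im.tendsto _).comp e2)
  have h := tendsto_nhds_unique (t1.congr fun a => key a) t2
  rw [← intervalIntegral.integral_Iic_add_Ioi hHint.integrableOn hHint.integrableOn (b := L)]
  rw [hankelContour, Complex.add_im, Complex.add_im, h]
  simp

lemma tendsto_neg_mul_exp_add_mul_atTop {c : ℝ} (hc : 0 < c) (b : ℝ) :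
    Tendsto (fun x => -c * exp x + b * x) atTop atBot := by
  have h := (tendsto_pow_mul_exp_neg_atTop_nhds_zero 1).const_mul b
  have h2 : Tendsto (fun x : ℝ => -c + b * (x ^ 1 * exp (-x))) atTop (𝓝 (-c + b * 0)) :=
    tendsto_const_nhds.add h
  refine (tendsto_exp_atTop.atTop_mul_neg (by simpa using hc) h2).congr fun x => ?_
  rw [exp_neg]
  field_simp

lemma tendsto_exp_neg_mul_exp_add_mul_atTop {c : ℝ} (hc : 0 < c) (b : ℝ) :
    Tendsto (fun x => exp (-c * exp x + b * x)) atTop (𝓝 0) :=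
  tendsto_exp_atBot.comp (tendsto_neg_mul_exp_add_mul_atTop hc b)

lemma tendsto_exp_mul_atBot {b : ℝ} (hb : 0 < b) :
    Tendsto (fun x => exp (b * x)) atBot (𝓝 0) :=
  tendsto_exp_atBot.comp (tendsto_id.const_mul_atBot hb)

lemma tendsto_exp_neg_mul_exp_add_mul_atBot {c b : ℝ} (hc : 0 < c) (hb : 0 < b) :
    Tendsto (fun x => exp (-c * exp x + b * x)) atBot (𝓝 0) := by
  refine squeeze_zero (fun x => (exp_pos _).le) (fun x => ?_) (tendsto_exp_mul_atBot hb)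
  apply exp_le_exp.2
  nlinarith [exp_pos x]

lemma cos_neg_of_mem_Ioc {θ : ℝ} (hθ : θ ∈ Ioc (π / 2) π) : cos θ < 0 :=
  cos_neg_of_pi_div_two_lt_of_lt hθ.1 (by linarith [hθ.2, pi_pos])

lemma integrable_hankelKernel_line {θ b : ℝ} (hθ : θ ∈ Ioc (π / 2) π) (hb : 0 < b) :
    Integrable fun x : ℝ => hankelKernel b (x + θ * Complex.I) := by
  have h := integrable_exp_neg_mul_exp_add_mul (neg_pos.2 (cos_neg_of_mem_Ioc hθ)) hb
  refine h.mono' (continuous_hankelKernel_line b θ).aestronglyMeasurable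
    (ae_of_all _ fun x => ?_)
  rw [norm_hankelKernel, neg_neg, mul_comm (exp x)]

lemma integrableOn_Ioi_hankelKernel_line {θ : ℝ} (hθ : θ ∈ Ioc (π / 2) π) (b L : ℝ) :
    IntegrableOn (fun x : ℝ => hankelKernel b (x + θ * Complex.I)) (Ioi L) := by
  have h := integrableOn_Ioi_exp_neg_mul_exp_add_mul (neg_pos.2 (cos_neg_of_mem_Ioc hθ)) b L
  refine h.mono' (continuous_hankelKernel_line b θ).aestronglyMeasurable
    (ae_of_all _ fun x => ?_)
  rw [norm_hankelKernel, neg_neg, mul_comm (exp x)]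

/-- Euler's integral along a rotated ray. -/
lemma integral_hankelKernel_line {θ b : ℝ} (hθ : θ ∈ Ioc (π / 2) π) (hb : 0 < b) :
    ∫ x : ℝ, hankelKernel b (x + θ * Complex.I) =
      Gamma b * Complex.exp ((π * b : ℝ) * Complex.I) := by
  have hc := neg_pos.2 (cos_neg_of_mem_Ioc hθ)
  rw [integral_line_eq_of_strip hθ.2 (fun x y _ => differentiable_hankelKernel b _)
    (tendsto_exp_neg_mul_exp_add_mul_atBot hc hb) (tendsto_exp_neg_mul_exp_add_mul_atTop hc b)
    (fun x y hy => ?_) (integrable_hankelKernel_line hθ hb)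
    (integrable_hankelKernel_line ⟨by linarith [pi_pos], le_rfl⟩ hb),
    ← integral_exp_neg_exp_add_mul hb, ← integral_complex_ofReal, ← integral_mul_const]
  · refine integral_congr_ae (ae_of_all _ fun x => ?_)
    simp only [hankelKernel, Complex.exp_add (x : ℂ), Complex.exp_pi_mul_I, Complex.ofReal_exp,
      ← Complex.exp_add]
    congr 1
    push_cast
    ring
  · rw [norm_hankelKernel]
    apply exp_le_exp.2
    have : cos y ≤ cos θ := cos_le_cos_of_nonneg_of_le_pi
      (by linarith [hθ.1, pi_pos]) hy.2 hy.1
    nlinarith [exp_pos x]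

lemma im_integral_hankelKernel_line {θ b : ℝ} (hθ : θ ∈ Ioc (π / 2) π) (hb : 0 < b) :
    (∫ x : ℝ, hankelKernel b (x + θ * Complex.I)).im = π / Gamma (1 - b) := by
  rw [integral_hankelKernel_line hθ hb, Complex.im_ofReal_mul, Complex.exp_ofReal_mul_I_im]
  have h := Gamma_mul_Gamma_one_sub b
  have hG := Gamma_pos_of_pos hb
  by_cases hs : sin (π * b) = 0
  · rw [hs, div_zero, mul_eq_zero] at h
    rw [hs, h.resolve_left hG.ne', mul_zero, div_zero]
  · have : Gamma (1 - b) ≠ 0 := by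
      intro h0
      rw [h0, mul_zero, eq_comm, div_eq_zero_iff] at h
      exact h.elim pi_ne_zero hs
    rw [eq_div_iff hs] at h
    rw [eq_div_iff this]
    linarith

lemma im_hankelKernel_ofReal (b x : ℝ) : (hankelKernel b x).im = 0 := by
  rw [hankelKernel, ← Complex.ofReal_exp, ← Complex.ofReal_mul, ← Complex.ofReal_add,
    Complex.exp_ofReal_im]

lemma norm_hankelKernel_le (b : ℝ) {x L : ℝ} (hx : x ≤ L) (y : ℝ) :
    ‖hankelKernel b (x + y * Complex.I)‖ ≤ exp (exp L) * exp (b * x) := by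
  rw [norm_hankelKernel, ← exp_add]
  apply exp_le_exp.2
  have := exp_le_exp.2 hx
  nlinarith [exp_pos x, cos_le_one y]

lemma hasDerivAt_hankelKernel (b : ℝ) (w : ℂ) :
    HasDerivAt (hankelKernel b) (hankelKernel (b + 1) w + b * hankelKernel b w) w := by
  have h := ((Complex.hasDerivAt_exp w).add ((hasDerivAt_id w).const_mul (b : ℂ))).cexp
  refine h.congr_deriv ?_
  have : hankelKernel (b + 1) w = Complex.exp w * hankelKernel b w := by
    rw [hankelKernel, hankelKernel, ← Complex.exp_add]
    congr 1
    push_cast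
    ring
  rw [this, hankelKernel]
  simp only [Pi.add_apply, id]
  ring

lemma hankelContour_hankelKernel_add_one {θ : ℝ} (hθ : θ ∈ Ioc (π / 2) π) (L b : ℝ) :
    hankelContour θ L (hankelKernel (b + 1)) + b * hankelContour θ L (hankelKernel b) =
      -hankelKernel b L := by
  have hcont : ∀ b : ℝ, Continuous fun y : ℝ => hankelKernel b (L + y * Complex.I) := fun b =>
    (differentiable_hankelKernel b).continuous.comp (by fun_prop)
  have hcont' : Continuous fun y : ℝ => (b : ℂ) * hankelKernel b (L + y * Complex.I) :=
    continuous_const.mul (hcont b)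
  have harc : Complex.I * (∫ y in (0 : ℝ)..θ, hankelKernel (b + 1) (L + y * Complex.I)) +
      b * (Complex.I * ∫ y in (0 : ℝ)..θ, hankelKernel b (L + y * Complex.I)) =
      hankelKernel b (L + θ * Complex.I) - hankelKernel b L := by
    have hd : ∀ y ∈ uIcc 0 θ, HasDerivAt (fun y : ℝ => hankelKernel b (L + y * Complex.I))
        ((hankelKernel (b + 1) (L + y * Complex.I) +
          b * hankelKernel b (L + y * Complex.I)) * Complex.I) y := fun y _ => by
      have h1 : HasDerivAt (fun y : ℂ => (L : ℂ) + y * Complex.I) Complex.I y := by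
        simpa using ((hasDerivAt_id (y : ℂ)).mul_const Complex.I).const_add (L : ℂ)
      exact ((hasDerivAt_hankelKernel b _).comp (y : ℂ) h1).comp_ofReal
    have h := intervalIntegral.integral_eq_sub_of_hasDerivAt hd
      (Continuous.intervalIntegrable
        (((hcont _).add hcont').mul continuous_const) _ _)
    rw [intervalIntegral.integral_mul_const, intervalIntegral.integral_add
      ((hcont _).intervalIntegrable _ _)
      (hcont'.intervalIntegrable _ _),
      intervalIntegral.integral_const_mul] at h
    simp only [Complex.ofReal_zero, zero_mul, add_zero] at h
    rw [← h]
    ring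
  have hray : (∫ x in Ioi L, hankelKernel (b + 1) (x + θ * Complex.I)) +
      b * (∫ x in Ioi L, hankelKernel b (x + θ * Complex.I)) =
      -hankelKernel b (L + θ * Complex.I) := by
    have hi1 := integrableOn_Ioi_hankelKernel_line hθ (b + 1) L
    have hi2 := (integrableOn_Ioi_hankelKernel_line hθ b L).const_mul (b : ℂ)
    have ht : Tendsto (fun x : ℝ => hankelKernel b (x + θ * Complex.I)) atTop (𝓝 0) := by
      rw [tendsto_zero_iff_norm_tendsto_zero]
      refine (tendsto_exp_neg_mul_exp_add_mul_atTop
        (neg_pos.2 (cos_neg_of_mem_Ioc hθ)) b).congr fun x => ?_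
      rw [norm_hankelKernel, neg_neg, mul_comm (exp x)]
    have hd : ∀ x ∈ Ici L, HasDerivAt (fun x : ℝ => hankelKernel b (x + θ * Complex.I))
        (hankelKernel (b + 1) (x + θ * Complex.I) +
          b * hankelKernel b (x + θ * Complex.I)) x := fun x _ => by
      have h1 : HasDerivAt (fun x : ℂ => x + θ * Complex.I) 1 x :=
        (hasDerivAt_id (x : ℂ)).add_const _
      simpa using ((hasDerivAt_hankelKernel b _).comp (x : ℂ) h1).comp_ofReal
    have h := integral_Ioi_of_hasDerivAt_of_tendsto' hd (hi1.add hi2) ht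
    rw [integral_add hi1 hi2, integral_const_mul, zero_sub] at h
    exact h
  rw [hankelContour, hankelContour]
  linear_combination harc + hray

lemma continuousOn_hankelContour_hankelKernel {θ : ℝ} (hθ : θ ∈ Ioc (π / 2) π) (L : ℝ) :
    ContinuousOn (fun b => hankelContour θ L (hankelKernel b)) (Icc (-1) 1) := by
  have hc := neg_pos.2 (cos_neg_of_mem_Ioc hθ)
  refine ContinuousOn.add (Continuous.continuousOn (continuous_const.mul ?_)) ?_
  · refine intervalIntegral.continuous_parametric_intervalIntegral_of_continuous'
      (f := fun b y => hankelKernel b (L + y * Complex.I)) ?_ _ _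
    unfold hankelKernel Function.uncurry
    fun_prop
  · refine continuousOn_of_dominated (bound := fun x =>
      exp (-(-cos θ) * exp x + 1 * x) + exp (-(-cos θ) * exp x + (-1) * x))
      (fun b _ => (continuous_hankelKernel_line b θ).aestronglyMeasurable)
      (fun b hb => ae_of_all _ fun x => ?_)
      ((integrableOn_Ioi_exp_neg_mul_exp_add_mul hc _ _).add
        (integrableOn_Ioi_exp_neg_mul_exp_add_mul hc _ _))
      (ae_of_all _ fun x => ?_)
    · rw [norm_hankelKernel]
      rcases le_total 0 x with hx | hx
      · refine le_add_of_le_of_nonneg (exp_le_exp.2 ?_) (exp_pos _).le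
        nlinarith [hb.2]
      · refine le_add_of_nonneg_of_le (exp_pos _).le (exp_le_exp.2 ?_)
        nlinarith [hb.1]
    · unfold hankelKernel
      fun_prop

/-- Hankel's formula for the reciprocal Gamma function. -/
lemma im_hankelContour_hankelKernel {θ : ℝ} (hθ : θ ∈ Ioc (π / 2) π) (L β : ℝ) :
    (hankelContour θ L (hankelKernel (1 - β))).im = π / Gamma β := by
  have hpos : ∀ b : ℝ, 0 < b →
      (hankelContour θ L (hankelKernel b)).im = π / Gamma (1 - b) := fun b hb => by
    rw [← im_integral_hankelKernel_line hθ hb]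
    have hB : Tendsto (fun x => exp (exp L) * exp (b * x)) atBot (𝓝 0) := by
      simpa using (tendsto_exp_mul_atBot hb).const_mul (exp (exp L))
    exact (im_integral_line_eq_im_hankelContour (by linarith [hθ.1, pi_pos])
      (fun x y _ => differentiable_hankelKernel b _) (im_hankelKernel_ofReal b) hB
      (fun x hx y _ => norm_hankelKernel_le b hx y) (integrable_hankelKernel_line hθ hb)).symm
  have hzero : (hankelContour θ L (hankelKernel 0)).im = π / Gamma (1 - 0) := by
    have h1 : Tendsto (fun b => (hankelContour θ L (hankelKernel b)).im) (𝓝[>] 0)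
        (𝓝 (hankelContour θ L (hankelKernel 0)).im) :=
      (Complex.continuous_im.continuousAt.comp
        ((continuousOn_hankelContour_hankelKernel hθ L).continuousAt
          (Icc_mem_nhds (by norm_num) (by norm_num)))).tendsto.mono_left nhdsWithin_le_nhds
    have h2 : ContinuousAt (fun b : ℝ => π / Gamma (1 - b)) 0 := by
      refine continuousAt_const.div ?_ (by simp)
      refine ContinuousAt.comp (g := Gamma) ?_ (by fun_prop)
      refine (differentiableAt_Gamma fun m => ?_).continuousAt
      have : (0 : ℝ) ≤ m := m.cast_nonneg
      linarith
    refine tendsto_nhds_unique h1 ((h2.tendsto.mono_left nhdsWithin_le_nhds).congr' ?_)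
    filter_upwards [self_mem_nhdsWithin] with b hb using (hpos b hb).symm
  have key : ∀ n : ℕ, ∀ β ≤ (n : ℝ) + 1,
      (hankelContour θ L (hankelKernel (1 - β))).im = π / Gamma β := by
    intro n
    induction n with
    | zero =>
      intro β hβ
      rcases hβ.lt_or_eq with h | h
      · simpa using hpos (1 - β) (by simpa using h)
      · simp only [Nat.cast_zero, zero_add] at h
        simpa [h] using hzero
    | succ n ih =>
      intro β hβ
      push_cast at hβ
      rcases le_or_gt β 1 with h | h
      · exact ih β (h.trans (by simp))
      · have h1 := ih (β - 1) (by linarith)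
        have h2 := congrArg Complex.im (hankelContour_hankelKernel_add_one hθ L (1 - β))
        rw [Complex.add_im, Complex.im_ofReal_mul, Complex.neg_im, im_hankelKernel_ofReal,
          show 1 - β + 1 = 1 - (β - 1) by ring, h1] at h2
        have h3 := Gamma_add_one (s := β - 1) (by linarith)
        rw [sub_add_cancel] at h3
        have h4 := Gamma_pos_of_pos (s := β - 1) (by linarith)
        have h5 : β - 1 ≠ 0 := by linarith
        rw [h3]
        field_simp at h2 ⊢
        linarith
  exact key ⌈β⌉₊ β ((Nat.le_ceil β).trans (by simp))

lemma re_exp_mul_pos {α θ : ℝ} (hα : 0 ≤ α) (hαθ : α * θ < π / 2) (x : ℝ) {y : ℝ}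
    (hy : y ∈ Icc 0 θ) : 0 < (Complex.exp (α * (x + y * Complex.I))).re := by
  rw [Complex.exp_re]
  simp only [Complex.mul_re, Complex.ofReal_re, Complex.add_re, Complex.I_re, mul_zero,
    Complex.ofReal_im, Complex.I_im, mul_one, sub_self, add_zero, Complex.add_im, Complex.mul_im,
    zero_add, zero_mul, sub_zero]
  refine mul_pos (exp_pos _) (cos_pos_of_mem_Ioo ⟨?_, ?_⟩)
  · have := mul_nonneg hα hy.1
    linarith [pi_pos]
  · exact (mul_le_mul_of_nonneg_left hy.2 hα).trans_lt hαθ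

/-- The integrand representing `E_{α,0}(-ζ)`, in logarithmic coordinates. -/
noncomputable def mittagLefflerKernel (α ζ : ℝ) (w : ℂ) : ℂ :=
  hankelKernel (1 + α) w / (Complex.exp (α * w) + ζ)

lemma le_norm_exp_add {ζ : ℝ} {z : ℂ} (hz : 0 < z.re) : ζ ≤ ‖z + ζ‖ := by
  have h : (z + ζ).re ≤ ‖z + ζ‖ := Complex.re_le_norm _
  simp only [Complex.add_re, Complex.ofReal_re] at h
  linarith

lemma norm_mittagLefflerKernel_le {α ζ θ : ℝ} (hα : 0 ≤ α) (hζ : 0 < ζ) (hαθ : α * θ < π / 2)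
    (x : ℝ) {y : ℝ} (hy : y ∈ Icc 0 θ) :
    ‖mittagLefflerKernel α ζ (x + y * Complex.I)‖ ≤
      ‖hankelKernel (1 + α) (x + y * Complex.I)‖ / ζ := by
  rw [mittagLefflerKernel, norm_div]
  have := le_norm_exp_add (ζ := ζ) (re_exp_mul_pos hα hαθ x hy)
  gcongr

lemma differentiableAt_mittagLefflerKernel {α ζ θ : ℝ} (hα : 0 ≤ α) (hζ : 0 < ζ)
    (hαθ : α * θ < π / 2) (x y : ℝ) (hy : y ∈ Icc 0 θ) :
    DifferentiableAt ℂ (mittagLefflerKernel α ζ) (x + y * Complex.I) := by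
  refine (differentiable_hankelKernel _ _).div (by fun_prop) ?_
  rw [← norm_pos_iff]
  exact hζ.trans_le (le_norm_exp_add (re_exp_mul_pos hα hαθ x hy))

lemma im_mittagLefflerKernel_ofReal (α ζ x : ℝ) : (mittagLefflerKernel α ζ x).im = 0 := by
  rw [mittagLefflerKernel, hankelKernel, ← Complex.ofReal_exp, ← Complex.ofReal_mul,
    ← Complex.ofReal_mul, ← Complex.ofReal_add, ← Complex.ofReal_exp, ← Complex.ofReal_exp,
    ← Complex.ofReal_add, ← Complex.ofReal_div, Complex.ofReal_im]

lemma integrable_mittagLefflerKernel_line {α ζ θ : ℝ} (hα : 0 < α) (hζ : 0 < ζ)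
    (hθ : θ ∈ Ioc (π / 2) π) (hαθ : α * θ < π / 2) :
    Integrable fun x : ℝ => mittagLefflerKernel α ζ (x + θ * Complex.I) := by
  have hmem : θ ∈ Icc 0 θ := ⟨by linarith [hθ.1, pi_pos], le_rfl⟩
  refine ((integrable_hankelKernel_line hθ (b := 1 + α) (by linarith)).norm.div_const ζ).mono'
    (Continuous.aestronglyMeasurable ?_)
    (ae_of_all _ fun x => norm_mittagLefflerKernel_le hα.le hζ hαθ x hmem)
  refine continuous_iff_continuousAt.2 fun x => ?_
  exact (differentiableAt_mittagLefflerKernel hα.le hζ hαθ x θ hmem).continuousAt.comp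
    (f := fun x : ℝ => (x : ℂ) + θ * Complex.I) (by fun_prop)

lemma im_integral_mittagLefflerKernel_line {α ζ θ : ℝ} (hα : 0 < α) (hζ : 0 < ζ)
    (hθ : θ ∈ Ioc (π / 2) π) (hαθ : α * θ < π / 2) (L : ℝ) :
    (∫ x : ℝ, mittagLefflerKernel α ζ (x + θ * Complex.I)).im =
      (hankelContour θ L (mittagLefflerKernel α ζ)).im := by
  have hB : Tendsto (fun x => exp (exp L) * exp ((1 + α) * x) / ζ) atBot (𝓝 0) := by
    simpa using ((tendsto_exp_mul_atBot (b := 1 + α) (by linarith)).const_mul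
      (exp (exp L))).div_const ζ
  refine im_integral_line_eq_im_hankelContour (by linarith [hθ.1, pi_pos])
    (differentiableAt_mittagLefflerKernel hα.le hζ hαθ) (im_mittagLefflerKernel_ofReal α ζ) hB
    (fun x hx y hy => (norm_mittagLefflerKernel_le hα.le hζ hαθ x hy).trans ?_)
    (integrable_mittagLefflerKernel_line hα hζ hθ hαθ)
  have := norm_hankelKernel_le (1 + α) hx y
  gcongr

/-- A geometric expansion may be integrated termwise along the Hankel contour. -/
lemma hasSum_hankelContour {F : ℕ → ℂ → ℂ} {H G : ℂ → ℂ} {θ L r : ℝ} (hθ : 0 ≤ θ)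
    (hr0 : 0 ≤ r) (hr : r < 1) (hF : ∀ k, Continuous (F k)) (hG : Continuous G)
    (hGint : IntegrableOn (fun x : ℝ => G (x + θ * Complex.I)) (Ioi L))
    (hbd : ∀ k, ∀ x y : ℝ, L ≤ x →
      ‖F k (x + y * Complex.I)‖ ≤ ‖G (x + y * Complex.I)‖ * r ^ k)
    (hsum : ∀ x y : ℝ, L ≤ x → y ∈ Icc 0 θ →
      HasSum (fun k => F k (x + y * Complex.I)) (H (x + y * Complex.I))) :
    HasSum (fun k => hankelContour θ L (F k)) (hankelContour θ L H) := by
  have hgeom := summable_geometric_of_lt_one hr0 hr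
  refine HasSum.add (HasSum.mul_left _ ?_) ?_
  · refine intervalIntegral.hasSum_integral_of_dominated_convergence
      (fun k y => ‖G (L + y * Complex.I)‖ * r ^ k) (fun k => ?_)
      (fun k => ae_of_all _ fun y _ => hbd k L y le_rfl)
      (ae_of_all _ fun y _ => hgeom.mul_left _) ?_ (ae_of_all _ fun y hy => ?_)
    · exact ((hF k).comp (by fun_prop : Continuous fun y : ℝ =>
        (L : ℂ) + y * Complex.I)).aestronglyMeasurable
    · simp only [tsum_mul_left]
      exact ((hG.comp (by fun_prop : Continuous fun y : ℝ =>
        (L : ℂ) + y * Complex.I)).norm.mul continuous_const).intervalIntegrable _ _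
    · rw [uIoc_of_le hθ] at hy
      exact hsum L y le_rfl ⟨hy.1.le, hy.2⟩
  · refine hasSum_integral_of_dominated_convergence
      (fun k (x : ℝ) => ‖G (x + θ * Complex.I)‖ * r ^ k) (fun k => ?_)
      (fun k => (ae_restrict_mem measurableSet_Ioi).mono fun x hx => hbd k x θ (le_of_lt hx))
      (ae_of_all _ fun x => hgeom.mul_left _) ?_
      ((ae_restrict_mem measurableSet_Ioi).mono fun x hx =>
        hsum x θ (le_of_lt hx) ⟨hθ, le_rfl⟩)
    · exact ((hF k).comp (by fun_prop : Continuous fun x : ℝ =>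
        (x : ℂ) + θ * Complex.I)).aestronglyMeasurable
    · simp only [tsum_mul_left]
      exact hGint.norm.mul_const _

/-- The integral representation of `E_{α,0}(-ζ)`. -/
lemma mlA0_neg_eq_im_integral {α ζ θ : ℝ} (hα : 0 < α) (hζ : 0 < ζ)
    (hθ : θ ∈ Ioc (π / 2) π) (hαθ : α * θ < π / 2) :
    mlA0 α (-ζ) = (∫ x : ℝ, mittagLefflerKernel α ζ (x + θ * Complex.I)).im / π := by
  set L := log (2 * ζ) / α with hL
  have hαL : exp (-(α * L)) * ζ = 1 / 2 := by
    rw [hL, mul_div_cancel₀ _ hα.ne', exp_neg, exp_log (by positivity)]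
    field_simp
  have hterm : ∀ (k : ℕ) (w : ℂ), ((-ζ) ^ k : ℝ) * hankelKernel (1 - α * k) w =
      hankelKernel 1 w * (-ζ * Complex.exp (-(α * w))) ^ k := fun k w => by
    rw [mul_pow, ← Complex.exp_nat_mul, hankelKernel, hankelKernel, mul_left_comm,
      ← Complex.exp_add]
    push_cast
    congr 2
    ring
  have hratio : ∀ x y : ℝ, L ≤ x →
      ‖-ζ * Complex.exp (-(α * (x + y * Complex.I)))‖ ≤ 1 / 2 := fun x y hx => by
    rw [norm_mul, Complex.norm_exp, norm_neg, Complex.norm_real, norm_of_nonneg hζ.le, ← hαL,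
      mul_comm]
    simp only [Complex.neg_re, Complex.mul_re, Complex.ofReal_re, Complex.add_re, Complex.I_re,
      mul_zero, Complex.ofReal_im, Complex.I_im, mul_one, sub_self, add_zero, zero_mul, sub_zero]
    gcongr
  have hsum : HasSum
      (fun k : ℕ => hankelContour θ L fun w => ((-ζ) ^ k : ℝ) * hankelKernel (1 - α * k) w)
      (hankelContour θ L (mittagLefflerKernel α ζ)) := by
    refine hasSum_hankelContour (G := hankelKernel 1) (r := 1 / 2) (by linarith [hθ.1, pi_pos])
      (by norm_num) (by norm_num)
      (fun k => continuous_const.mul (differentiable_hankelKernel _).continuous)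
      (differentiable_hankelKernel _).continuous (integrableOn_Ioi_hankelKernel_line hθ 1 L)
      (fun k x y hx => ?_) (fun x y hx hy => ?_)
    · rw [hterm, norm_mul, norm_pow]
      gcongr
      exact hratio x y hx
    · simp only [hterm]
      set w : ℂ := x + y * Complex.I
      have hne : Complex.exp (α * w) + ζ ≠ 0 := by
        rw [← norm_pos_iff]
        exact hζ.trans_le (le_norm_exp_add (re_exp_mul_pos hα.le hαθ x hy))
      have h := (hasSum_geometric_of_norm_lt_one
        ((hratio x y hx).trans_lt (by norm_num))).mul_left (hankelKernel 1 w)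
      have h1 : hankelKernel (1 + α) w = hankelKernel 1 w * Complex.exp (α * w) := by
        rw [hankelKernel, hankelKernel, ← Complex.exp_add]
        congr 1
        push_cast
        ring
      have h2 : 1 - -ζ * Complex.exp (-(α * w)) =
          (Complex.exp (α * w) + ζ) / Complex.exp (α * w) := by
        rw [Complex.exp_neg]
        field_simp [Complex.exp_ne_zero]
        ring
      rwa [h2, inv_div, ← mul_div_assoc, ← h1] at h
  rw [im_integral_mittagLefflerKernel_line hα hζ hθ hαθ L, mlA0]
  rw [← ((Complex.hasSum_im hsum).div_const π).tsum_eq]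
  refine tsum_congr fun k => ?_
  have h : (hankelContour θ L fun w => ((-ζ) ^ k : ℝ) * hankelKernel (1 - α * k) w) =
      ((-ζ) ^ k : ℝ) * hankelContour θ L (hankelKernel (1 - α * k)) := by
    simp only [hankelContour, intervalIntegral.integral_const_mul, integral_const_mul]
    ring
  rw [h, Complex.im_ofReal_mul, im_hankelContour_hankelKernel hθ]
  field_simp

lemma integrable_exp_neg_mul_exp_add_mul_mul_exp {α b c s : ℝ} (hα : α ∈ Ioo 0 1) (hb : 0 < b)
    (hc : 0 < c) (hs : 0 ≤ s) :
    Integrable fun x => exp (-c * exp x + b * x) * exp (s * exp (α * x)) := by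
  obtain ⟨C, hC⟩ : ∃ C, ∀ x, s * exp (α * x) ≤ c / 2 * exp x + C := by
    obtain ⟨x₀, hx₀⟩ := eventually_atTop.1 ((tendsto_exp_atTop.comp
      (tendsto_id.const_mul_atTop (sub_pos.2 hα.2))).eventually_ge_atTop (2 * s / c))
    refine ⟨s * exp (α * x₀), fun x => ?_⟩
    rcases le_total x₀ x with hx | hx
    · have h := hx₀ x hx
      simp only [Function.comp_apply, id, div_le_iff₀ hc] at h
      have h2 : exp x = exp ((1 - α) * x) * exp (α * x) := by
        rw [← exp_add]
        ring_nf
      have h3 : 0 ≤ s * exp (α * x₀) := by positivity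
      rw [h2]
      nlinarith [exp_pos (α * x)]
    · have h : s * exp (α * x) ≤ s * exp (α * x₀) := by
        have := hα.1
        gcongr
      have h3 : 0 ≤ c / 2 * exp x := by positivity
      linarith
  refine ((integrable_exp_neg_mul_exp_add_mul (half_pos hc) hb).const_mul (exp C)).mono'
    (by fun_prop) (ae_of_all _ fun x => ?_)
  rw [norm_of_nonneg (by positivity), ← exp_add, ← exp_add]
  apply exp_le_exp.2
  linarith [hC x]

/-- The integral representation of the Wright function. -/
lemma wrightMinusAlpha_eq_im_integral {α θ s : ℝ} (hα : α ∈ Ioo 0 1) (hs : 0 ≤ s)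
    (hθ : θ ∈ Ioc (π / 2) π) :
    wrightMinusAlpha α s = (∫ x : ℝ, hankelKernel (1 + α) (x + θ * Complex.I) *
      Complex.exp (-s * Complex.exp (α * (x + θ * Complex.I)))).im / π := by
  have hc := neg_pos.2 (cos_neg_of_mem_Ioc hθ)
  have hterm : ∀ (k : ℕ) (w : ℂ),
      ((-s) ^ k / k.factorial : ℝ) * hankelKernel (1 + α * (k + 1)) w =
        hankelKernel (1 + α) w * ((-s * Complex.exp (α * w)) ^ k / k.factorial) := fun k w => by
    have : hankelKernel (1 + α * (k + 1)) w =
        hankelKernel (1 + α) w * Complex.exp (α * w) ^ k := by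
      rw [hankelKernel, hankelKernel, ← Complex.exp_nat_mul, ← Complex.exp_add]
      congr 1
      push_cast
      ring
    rw [this, mul_pow]
    push_cast
    ring
  have hnorm : ∀ x : ℝ, ‖-s * Complex.exp (α * (x + θ * Complex.I))‖ = s * exp (α * x) :=
    fun x => by
      rw [norm_mul, Complex.norm_exp, norm_neg, Complex.norm_real, norm_of_nonneg hs]
      simp
  have hexp : ∀ x : ℝ, HasSum (fun k : ℕ => (s * exp (α * x)) ^ k / k.factorial)
      (exp (s * exp (α * x))) := fun x => by
    rw [exp_eq_exp_ℝ]
    exact NormedSpace.expSeries_div_hasSum_exp _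
  have hsum := hasSum_integral_of_dominated_convergence (μ := volume)
    (F := fun (k : ℕ) (x : ℝ) => ((-s) ^ k / k.factorial : ℝ) *
      hankelKernel (1 + α * (k + 1)) (x + θ * Complex.I))
    (f := fun x : ℝ => hankelKernel (1 + α) (x + θ * Complex.I) *
      Complex.exp (-s * Complex.exp (α * (x + θ * Complex.I))))
    (fun k x => ‖hankelKernel (1 + α) (x + θ * Complex.I)‖ *
      ((s * exp (α * x)) ^ k / k.factorial))
    (fun k => (continuous_const.mul (continuous_hankelKernel_line _ θ)).aestronglyMeasurable)
    (fun k => ae_of_all _ fun x => by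
      simp only [hterm, norm_mul, norm_div, norm_pow, hnorm, Complex.norm_natCast, le_refl])
    (ae_of_all _ fun x => (hexp x).summable.mul_left _)
    (by
      simp only [tsum_mul_left, fun x => (hexp x).tsum_eq, norm_hankelKernel]
      refine (integrable_exp_neg_mul_exp_add_mul_mul_exp hα
        (b := 1 + α) (by linarith [hα.1]) hc hs).congr (ae_of_all _ fun x => ?_)
      simp only [neg_neg, mul_comm (exp x)])
    (ae_of_all _ fun x => by
      simp only [hterm]
      refine HasSum.mul_left _ ?_
      rw [Complex.exp_eq_exp_ℂ]
      exact NormedSpace.expSeries_div_hasSum_exp _)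
  rw [← ((Complex.hasSum_im hsum).div_const π).tsum_eq, wrightMinusAlpha]
  refine tsum_congr fun k => ?_
  have hb : 0 < 1 + α * (k + 1 : ℝ) := by
    have := hα.1
    positivity
  rw [integral_const_mul, Complex.im_ofReal_mul, im_integral_hankelKernel_line hθ hb,
    show 1 - (1 + α * (k + 1 : ℝ)) = -α - α * k by ring]
  field_simp

lemma integrable_prod_laplace_kernel {α ζ θ : ℝ} (hα : 0 < α) (hζ : 0 < ζ)
    (hθ : θ ∈ Ioc (π / 2) π) (hαθ : α * θ < π / 2) :
    Integrable (fun p : ℝ × ℝ => hankelKernel (1 + α) (p.2 + θ * Complex.I) *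
      Complex.exp (-(Complex.exp (α * (p.2 + θ * Complex.I)) + ζ) * p.1))
      ((volume.restrict (Ioi 0)).prod volume) := by
  have hs : Integrable (fun s => exp (-ζ * s)) (volume.restrict (Ioi 0)) :=
    exp_neg_integrableOn_Ioi 0 hζ
  have hx := (integrable_hankelKernel_line hθ (b := 1 + α) (by linarith)).norm
  refine (hs.mul_prod hx).mono' (Continuous.aestronglyMeasurable ?_) ?_
  · unfold hankelKernel
    fun_prop
  · have hmem : ∀ᵐ p : ℝ × ℝ ∂(volume.restrict (Ioi 0)).prod volume, 0 < p.1 :=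
      Measure.quasiMeasurePreserving_fst.ae (ae_restrict_mem measurableSet_Ioi)
    filter_upwards [hmem] with p hp
    rw [norm_mul, mul_comm, Complex.norm_exp]
    gcongr
    rw [Complex.re_mul_ofReal, Complex.neg_re, Complex.add_re, Complex.ofReal_re]
    have := re_exp_mul_pos hα.le hαθ p.2 ⟨by linarith [hθ.1, pi_pos], le_rfl⟩
    nlinarith

/-- For every `ζ > 0`,
`E_{α,0}(-ζ) = ∫₀^∞ ₀Ψ₁[ -; (-α,-α) | -s ] e^{-ζ s} ds`,
the integral being absolutely convergent. -/
theorem mlA0_eq_laplace_wright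
    (α : ℝ) (hα : α ∈ Set.Ioo (0 : ℝ) 1) (ζ : ℝ) (hζ : 0 < ζ) :
    IntegrableOn (fun s : ℝ => wrightMinusAlpha α s * Real.exp (-ζ * s)) (Set.Ioi 0) ∧
    mlA0 α (-ζ) = ∫ s in Set.Ioi (0 : ℝ), wrightMinusAlpha α s * Real.exp (-ζ * s) := by
  obtain ⟨θ, hθ, hαθ⟩ : ∃ θ, θ ∈ Ioc (π / 2) π ∧ α * θ < π / 2 := by
    have h1 : 0 < 1 + α := by linarith [hα.1]
    refine ⟨π / (1 + α), ⟨?_, ?_⟩, ?_⟩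
    · rw [div_lt_div_iff₀ two_pos h1]
      nlinarith [pi_pos, hα.2]
    · rw [div_le_iff₀ h1]
      nlinarith [pi_pos, hα.1]
    · rw [← mul_div_assoc, div_lt_div_iff₀ h1 two_pos]
      nlinarith [pi_pos, hα.2]
  have hHint := integrable_prod_laplace_kernel hα.1 hζ hθ hαθ
  have hF : ∀ s ∈ Ioi (0 : ℝ), wrightMinusAlpha α s * Real.exp (-ζ * s) =
      (∫ x : ℝ, hankelKernel (1 + α) (x + θ * Complex.I) *
        Complex.exp (-(Complex.exp (α * (x + θ * Complex.I)) + ζ) * s)).im / π := fun s hs => by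
    rw [wrightMinusAlpha_eq_im_integral hα (le_of_lt hs) hθ, div_mul_eq_mul_div,
      ← Complex.im_mul_ofReal, ← integral_mul_const]
    congr 3
    ext x
    rw [mul_assoc, Complex.ofReal_exp, ← Complex.exp_add]
    congr 2
    push_cast
    ring
  constructor
  · exact (hHint.integral_prod_left.im.div_const π).congr
      ((ae_restrict_mem measurableSet_Ioi).mono fun s hs => (hF s hs).symm)
  · rw [setIntegral_congr_fun measurableSet_Ioi hF, integral_div,
      mlA0_neg_eq_im_integral hα.1 hζ hθ hαθ]
    have him := integral_im (𝕜 := ℂ) hHint.integral_prod_left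
    simp only [RCLike.im_to_complex] at him
    rw [him, integral_integral_swap hHint]
    congr 3
    ext x
    have hre := re_exp_mul_pos hα.1.le hαθ x ⟨by linarith [hθ.1, pi_pos], le_rfl⟩
    rw [integral_const_mul, integral_exp_mul_complex_Ioi, mittagLefflerKernel, div_eq_mul_inv]
    · rw [Complex.ofReal_zero, mul_zero, Complex.exp_zero, neg_div_neg_eq, one_div]
    · rw [Complex.neg_re, Complex.add_re, Complex.ofReal_re]
      linarith
end

section
/- There exist constants C, c > 0, depending only on α, such that for all s > 0 and t > 0, 0 ≤ φ_{t,α}(s) ≤ C t^{−α} exp( −c s^{1/(1−α)} t^{−α/(1−α)} ). -/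
open Real

namespace WrightFunction

open Set Filter Topology MeasureTheory

lemma mul_sin_le_sin_mul {a θ : ℝ} (ha0 : 0 ≤ a) (ha1 : a ≤ 1) (h0 : 0 ≤ θ) (hπ : θ ≤ π) :
    a * sin θ ≤ sin (a * θ) := by
  have h := strictConcaveOn_sin_Icc.concaveOn.2 (x := θ) (y := 0) ⟨h0, hπ⟩ ⟨le_rfl, pi_pos.le⟩
    ha0 (sub_nonneg.2 ha1) (by ring)
  simpa using h

lemma sin_mul_pos {a θ : ℝ} (ha0 : 0 < a) (ha1 : a ≤ 1) (hθ : θ ∈ Ioo 0 π) :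
    0 < sin (a * θ) :=
  (mul_pos ha0 (sin_pos_of_mem_Ioo hθ)).trans_le
    (mul_sin_le_sin_mul ha0.le ha1 hθ.1.le hθ.2.le)

/-- The integrand of the Hankel-type representation of the Wright function, in the logarithmic
coordinate `w = log σ`. -/
noncomputable def hankelIntegrand (α s : ℝ) (w : ℂ) : ℂ :=
  Complex.exp (s * (Complex.exp w - Complex.exp (α * w))) * Complex.exp (α * w)

/-- The logarithm of the modulus of the point of argument `θ` on the path of steepest descent. -/
noncomputable def descentLog (α θ : ℝ) : ℝ := (log (sin (α * θ)) - log (sin θ)) / (1 - α)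

/-- Minus the exponent of `hankelIntegrand` along the path of steepest descent. -/
noncomputable def descentExponent (α θ : ℝ) : ℝ :=
  exp (α * descentLog α θ) * sin ((1 - α) * θ) / sin θ

lemma exp_add_mul_I (x θ : ℝ) :
    Complex.exp (x + θ * Complex.I) = ⟨exp x * cos θ, exp x * sin θ⟩ := by
  apply Complex.ext <;> simp [Complex.exp_re, Complex.exp_im]

lemma exp_mul_add_mul_I (α x θ : ℝ) :
    Complex.exp (α * (x + θ * Complex.I)) =
      ⟨exp (α * x) * cos (α * θ), exp (α * x) * sin (α * θ)⟩ := by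
  rw [← exp_add_mul_I]; push_cast; ring_nf

lemma norm_hankelIntegrand (α s x θ : ℝ) :
    ‖hankelIntegrand α s (x + θ * Complex.I)‖ =
      exp (s * (exp x * cos θ - exp (α * x) * cos (α * θ))) * exp (α * x) := by
  rw [hankelIntegrand, norm_mul, Complex.norm_exp, Complex.norm_exp, exp_add_mul_I,
    exp_mul_add_mul_I]
  simp

lemma differentiable_hankelIntegrand (α s : ℝ) : Differentiable ℂ (hankelIntegrand α s) := by
  unfold hankelIntegrand; fun_prop

lemma exp_descentLog_mul_sin {α θ : ℝ} (hα : α ∈ Ioo (0 : ℝ) 1) (hθ : θ ∈ Ioo 0 π) :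
    exp (descentLog α θ) * sin θ = exp (α * descentLog α θ) * sin (α * θ) := by
  have h1 := sin_pos_of_mem_Ioo hθ
  have h2 := sin_mul_pos hα.1 hα.2.le hθ
  have h3 : 1 - α ≠ 0 := by linarith [hα.2]
  have h : descentLog α θ + log (sin θ) = α * descentLog α θ + log (sin (α * θ)) := by
    unfold descentLog; field_simp; ring
  simpa only [exp_add, exp_log h1, exp_log h2] using congrArg exp h

lemma exp_descentLog_mul_cos {α θ : ℝ} (hα : α ∈ Ioo (0 : ℝ) 1) (hθ : θ ∈ Ioo 0 π) :
    exp (descentLog α θ) * cos θ - exp (α * descentLog α θ) * cos (α * θ) =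
      -descentExponent α θ := by
  have h1 := sin_pos_of_mem_Ioo hθ
  have h := exp_descentLog_mul_sin hα hθ
  rw [descentExponent, show (1 - α) * θ = θ - α * θ by ring, sin_sub]
  field_simp
  linear_combination cos θ * h

lemma hankelIntegrand_descent {α s θ : ℝ} (hα : α ∈ Ioo (0 : ℝ) 1) (hθ : θ ∈ Ioo 0 π) :
    hankelIntegrand α s (descentLog α θ + θ * Complex.I) =
      (exp (-(s * descentExponent α θ)) : ℝ) *
        ⟨exp (α * descentLog α θ) * cos (α * θ), exp (α * descentLog α θ) * sin (α * θ)⟩ := by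
  have h : Complex.exp (descentLog α θ + θ * Complex.I) -
      Complex.exp (α * (descentLog α θ + θ * Complex.I)) = ((-descentExponent α θ : ℝ) : ℂ) := by
    rw [exp_add_mul_I, exp_mul_add_mul_I]
    exact Complex.ext (exp_descentLog_mul_cos hα hθ)
      (sub_eq_zero.2 (exp_descentLog_mul_sin hα hθ))
  rw [hankelIntegrand, h, exp_mul_add_mul_I, Complex.ofReal_exp]
  congr 2
  push_cast; ring

lemma descentLog_lower {α θ : ℝ} (hα : α ∈ Ioo (0 : ℝ) 1) (hθ : θ ∈ Ioo 0 π) :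
    log α / (1 - α) ≤ descentLog α θ := by
  have h1 := sin_pos_of_mem_Ioo hθ
  have h3 : 0 < 1 - α := by linarith [hα.2]
  unfold descentLog
  gcongr
  rw [le_sub_iff_add_le, ← log_mul hα.1.ne' h1.ne']
  exact log_le_log (mul_pos hα.1 h1) (mul_sin_le_sin_mul hα.1.le hα.2.le hθ.1.le hθ.2.le)

lemma descentExponent_lower {α θ : ℝ} (hα : α ∈ Ioo (0 : ℝ) 1) (hθ : θ ∈ Ioo 0 π) :
    exp (α * (log α / (1 - α))) * (1 - α) ≤ descentExponent α θ := by
  have h1 := sin_pos_of_mem_Ioo hθ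
  have h3 : 0 < 1 - α := by linarith [hα.2]
  rw [descentExponent, le_div_iff₀ h1, mul_assoc]
  have := mul_sin_le_sin_mul h3.le (by linarith [hα.1]) hθ.1.le hθ.2.le
  have := descentLog_lower hα hθ
  have := hα.1
  gcongr

lemma hasDerivAt_descentLog {α θ : ℝ} (hα : α ∈ Ioo (0 : ℝ) 1) (hθ : θ ∈ Ioo 0 π) :
    HasDerivAt (descentLog α)
      ((α * cos (α * θ) / sin (α * θ) - cos θ / sin θ) / (1 - α)) θ := by
  have h1 := sin_pos_of_mem_Ioo hθ
  have h2 := sin_mul_pos hα.1 hα.2.le hθ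
  have h4 : HasDerivAt (fun θ : ℝ => sin (α * θ)) (α * cos (α * θ)) θ := by
    simpa [mul_comm] using ((hasDerivAt_id θ).const_mul α).sin
  exact ((h4.log h2.ne').sub ((hasDerivAt_sin θ).log h1.ne')).div_const _

lemma hasDerivAt_im {f : ℝ → ℂ} {f' : ℂ} {x : ℝ} (h : HasDerivAt f f' x) :
    HasDerivAt (fun t => (f t).im) f'.im x :=
  Complex.imCLM.hasFDerivAt.comp_hasDerivAt x h

lemma hasDerivAt_im_primitive_descent {α s θ : ℝ} (hα : α ∈ Ioo (0 : ℝ) 1) (hθ : θ ∈ Ioo 0 π)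
    {G : ℂ → ℂ} (hG : ∀ w, HasDerivAt G (hankelIntegrand α s w) w) :
    HasDerivAt (fun θ : ℝ => (G (descentLog α θ + θ * Complex.I)).im)
      (exp (-(s * descentExponent α θ)) * descentExponent α θ / (1 - α)) θ := by
  have h1 := sin_pos_of_mem_Ioo hθ
  have h2 := sin_mul_pos hα.1 hα.2.le hθ
  have h3 : 1 - α ≠ 0 := by linarith [hα.2]
  have hγ : HasDerivAt (fun θ : ℝ => (descentLog α θ : ℂ) + θ * Complex.I)
      ((((α * cos (α * θ) / sin (α * θ) - cos θ / sin θ) / (1 - α) : ℝ) : ℂ) + 1 * Complex.I) θ :=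
    (hasDerivAt_descentLog hα hθ).ofReal_comp.add
      ((hasDerivAt_id θ).ofReal_comp.mul_const Complex.I)
  refine (hasDerivAt_im ((hG _).comp θ hγ)).congr_deriv ?_
  rw [hankelIntegrand_descent hα hθ, mul_assoc, Complex.im_ofReal_mul]
  simp only [Complex.mul_im, Complex.add_im, Complex.add_re, Complex.ofReal_re, Complex.ofReal_im,
    one_mul, Complex.I_re, Complex.I_im, add_zero, zero_add, mul_one]
  rw [descentExponent, show (1 - α) * θ = θ - α * θ by ring, sin_sub]
  field_simp
  ring

lemma im_primitive_ofReal {α s : ℝ} {G : ℂ → ℂ}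
    (hG : ∀ w, HasDerivAt G (hankelIntegrand α s w) w) (h0 : G 0 = 0) (x : ℝ) :
    (G x).im = 0 := by
  have h : ∀ x : ℝ, HasDerivAt (fun x : ℝ => (G x).im) 0 x := fun x => by
    refine (hasDerivAt_im (hG x).comp_ofReal).congr_deriv ?_
    rw [hankelIntegrand]
    norm_cast
  have := is_const_of_deriv_eq_zero (fun x => (h x).differentiableAt) (fun x => (h x).deriv) x 0
  simpa [h0] using this

lemma norm_primitive_vertical_le {α s : ℝ} {G : ℂ → ℂ}
    (hG : ∀ w, HasDerivAt G (hankelIntegrand α s w) w) {x φ ψ M : ℝ} (hφψ : φ ≤ ψ)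
    (hM : ∀ y ∈ Icc φ ψ, ‖hankelIntegrand α s (x + y * Complex.I)‖ ≤ M) :
    ‖G (x + ψ * Complex.I) - G (x + φ * Complex.I)‖ ≤ M * (ψ - φ) := by
  have h : ∀ y ∈ Icc φ ψ, HasDerivWithinAt (fun y : ℝ => G (x + y * Complex.I))
      (hankelIntegrand α s (x + y * Complex.I) * Complex.I) (Icc φ ψ) y := fun y _ => by
    have hγ : HasDerivAt (fun y : ℝ => (x : ℂ) + y * Complex.I) Complex.I y := by
      simpa using ((hasDerivAt_id y).ofReal_comp.mul_const Complex.I).const_add (x : ℂ)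
    exact ((hG _).comp y hγ).hasDerivWithinAt
  have := (convex_Icc φ ψ).norm_image_sub_le_of_norm_hasDerivWithin_le h
    (fun y hy => by simpa using hM y hy) (left_mem_Icc.2 hφψ) (right_mem_Icc.2 hφψ)
  rwa [Real.norm_of_nonneg (sub_nonneg.2 hφψ)] at this

lemma norm_hankelIntegrand_le {α s : ℝ} (hs : 0 ≤ s) (x θ : ℝ) :
    ‖hankelIntegrand α s (x + θ * Complex.I)‖ ≤
      exp (s * (exp x + exp (α * x))) * exp (α * x) := by
  rw [norm_hankelIntegrand]
  gcongr
  nlinarith [cos_le_one θ, neg_one_le_cos (α * θ), exp_pos x, exp_pos (α * x)]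

lemma abs_im_primitive_le {α s : ℝ} (hs : 0 ≤ s) {G : ℂ → ℂ}
    (hG : ∀ w, HasDerivAt G (hankelIntegrand α s w) w) (h0 : G 0 = 0) (x : ℝ) {θ : ℝ}
    (hθ : 0 ≤ θ) :
    |(G (x + θ * Complex.I)).im| ≤ exp (s * (exp x + exp (α * x))) * exp (α * x) * θ := by
  have h := norm_primitive_vertical_le hG hθ (fun y _ => norm_hankelIntegrand_le hs x y)
  have h' := (Complex.abs_im_le_norm _).trans h
  simpa [im_primitive_ofReal hG h0] using h'

lemma tendsto_im_primitive_atBot {α s : ℝ} (hα : 0 < α) (hs : 0 ≤ s) {G : ℂ → ℂ}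
    (hG : ∀ w, HasDerivAt G (hankelIntegrand α s w) w) (h0 : G 0 = 0) :
    Tendsto (fun x : ℝ => (G (x + π * Complex.I)).im) atBot (𝓝 0) := by
  have h1 : Tendsto (fun x : ℝ => exp (α * x)) atBot (𝓝 0) :=
    tendsto_exp_atBot.comp (tendsto_id.const_mul_atBot hα)
  have h2 : Tendsto (fun x : ℝ => exp (s * (exp x + exp (α * x))) * exp (α * x) * π) atBot
      (𝓝 (exp (s * (0 + 0)) * 0 * π)) :=
    (((continuous_exp.tendsto _).comp ((tendsto_exp_atBot.add h1).const_mul s)).mul h1).mul_const π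
  rw [mul_zero, zero_mul] at h2
  exact squeeze_zero_norm (fun x => abs_im_primitive_le hs hG h0 x pi_pos.le) h2

lemma descentLog_upper {α θ : ℝ} (hα : α ∈ Ioo (0 : ℝ) 1) (hθ : θ ∈ Ioo 0 (π / 2)) :
    descentLog α θ ≤ log (π / 2) / (1 - α) := by
  have hθ' : θ ∈ Ioo 0 π := ⟨hθ.1, hθ.2.trans (by linarith [pi_pos])⟩
  have h1 := sin_pos_of_mem_Ioo hθ'
  have h2 := sin_mul_pos hα.1 hα.2.le hθ'
  have h3 : 0 < 1 - α := by linarith [hα.2]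
  have h4 : 2 / π * θ ≤ sin θ := mul_le_sin hθ.1.le hθ.2.le
  have h5 : sin (α * θ) ≤ θ :=
    (sin_le (mul_nonneg hα.1.le hθ.1.le)).trans (by nlinarith [hθ.1, hα.2])
  unfold descentLog
  gcongr
  rw [sub_le_iff_le_add, ← log_mul (by positivity) h1.ne']
  refine log_le_log h2 (h5.trans ?_)
  calc θ = π / 2 * (2 / π * θ) := by field_simp
    _ ≤ _ := by gcongr

lemma tendsto_im_primitive_descent_zero {α s : ℝ} (hα : α ∈ Ioo (0 : ℝ) 1) (hs : 0 ≤ s)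
    {G : ℂ → ℂ} (hG : ∀ w, HasDerivAt G (hankelIntegrand α s w) w) (h0 : G 0 = 0) :
    Tendsto (fun θ : ℝ => (G (descentLog α θ + θ * Complex.I)).im) (𝓝[>] 0) (𝓝 0) := by
  set R := log (π / 2) / (1 - α)
  have h : Tendsto (fun θ : ℝ => exp (s * (exp R + exp (α * R))) * exp (α * R) * θ) (𝓝[>] 0)
      (𝓝 (exp (s * (exp R + exp (α * R))) * exp (α * R) * 0)) :=
    (tendsto_id.mono_left nhdsWithin_le_nhds).const_mul _
  rw [mul_zero] at h
  refine squeeze_zero_norm' ?_ h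
  filter_upwards [Ioo_mem_nhdsGT (show (0 : ℝ) < π / 2 by positivity)] with θ hθ
  refine (abs_im_primitive_le hs hG h0 _ hθ.1.le).trans ?_
  have := descentLog_upper hα hθ
  have := hα.1
  have := hθ.1.le
  gcongr

lemma tendsto_descentLog {α : ℝ} (hα : α ∈ Ioo (0 : ℝ) 1) :
    Tendsto (descentLog α) (𝓝[<] π) atTop := by
  have h2 : sin (α * π) ≠ 0 :=
    (sin_pos_of_mem_Ioo ⟨mul_pos hα.1 pi_pos, by nlinarith [hα.2, pi_pos]⟩).ne'
  have h3 : 0 < 1 - α := by linarith [hα.2]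
  have h4 : Tendsto (fun θ => log (sin (α * θ))) (𝓝[<] π) (𝓝 (log (sin (α * π)))) := by
    have : ContinuousAt (fun θ => log (sin (α * θ))) π := by fun_prop (disch := exact h2)
    exact this.tendsto.mono_left nhdsWithin_le_nhds
  have h5 : Tendsto sin (𝓝[<] π) (𝓝[>] 0) := by
    refine tendsto_nhdsWithin_iff.2 ⟨?_, ?_⟩
    · simpa using (continuous_sin.tendsto π).mono_left nhdsWithin_le_nhds
    · filter_upwards [Ioo_mem_nhdsLT pi_pos] with θ hθ using sin_pos_of_mem_Ioo hθ
  have h6 := tendsto_neg_atBot_atTop.comp (tendsto_log_nhdsGT_zero.comp h5)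
  exact ((h4.add_atTop h6).atTop_div_const h3).congr fun θ => by
    simp [descentLog, sub_eq_add_neg]

lemma exp_mul_le {α : ℝ} (hα : α ∈ Ioo (0 : ℝ) 1) (x : ℝ) :
    exp (α * x) ≤ α * exp x + (1 - α) := by
  have := rpow_one_add_le_one_add_mul_self (s := exp x - 1) (by linarith [exp_pos x]) hα.1.le
    hα.2.le
  rw [add_sub_cancel, ← exp_mul, mul_comm x] at this
  linarith

lemma exists_norm_hankelIntegrand_le {α s : ℝ} (hα : α ∈ Ioo (0 : ℝ) 1) (hs : 0 < s) :
    ∃ M : ℝ, ∀ x θ : ℝ, cos θ ≤ -(1 + α) / 2 →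
      ‖hankelIntegrand α s (x + θ * Complex.I)‖ ≤ M := by
  have h3 : 0 < 1 - α := by linarith [hα.2]
  set c := s * (1 - α) / 2 with hc
  have hcpos : 0 < c := by positivity
  refine ⟨exp (s * (1 - α)) * (1 / c + 1), fun x θ hθ => ?_⟩
  have h1 := exp_mul_le hα x
  have hx := exp_pos x
  rw [norm_hankelIntegrand]
  have h2 : s * (exp x * cos θ - exp (α * x) * cos (α * θ)) ≤ s * (1 - α) + -(c * exp x) := by
    have : exp x * cos θ - exp (α * x) * cos (α * θ) ≤ (1 - α) - (1 - α) / 2 * exp x := by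
      nlinarith [neg_one_le_cos (α * θ), exp_pos (α * x)]
    calc _ ≤ s * ((1 - α) - (1 - α) / 2 * exp x) := by gcongr
      _ = _ := by rw [hc]; ring
  have h4 : exp (-(c * exp x)) * exp (α * x) ≤ 1 / c + 1 := by
    rw [exp_neg, inv_mul_le_iff₀ (exp_pos _)]
    have h5 := add_one_le_exp (c * exp x)
    have h6 : exp (α * x) ≤ exp x + 1 := by nlinarith [hα.1, hα.2]
    refine h6.trans ?_
    calc exp x + 1 ≤ (c * exp x + 1) * (1 / c + 1) := by
          have : c * exp x * (1 / c) = exp x := by field_simp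
          have : 0 < 1 / c := by positivity
          nlinarith [mul_pos hcpos hx]
      _ ≤ _ := by gcongr
  calc _ ≤ exp (s * (1 - α) + -(c * exp x)) * exp (α * x) := by gcongr
    _ = exp (s * (1 - α)) * (exp (-(c * exp x)) * exp (α * x)) := by rw [exp_add]; ring
    _ ≤ _ := by gcongr

lemma tendsto_im_primitive_descent_pi {α s I : ℝ} (hα : α ∈ Ioo (0 : ℝ) 1) (hs : 0 < s)
    {G : ℂ → ℂ} (hG : ∀ w, HasDerivAt G (hankelIntegrand α s w) w)
    (hI : Tendsto (fun x : ℝ => (G (x + π * Complex.I)).im) atTop (𝓝 I)) :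
    Tendsto (fun θ : ℝ => (G (descentLog α θ + θ * Complex.I)).im) (𝓝[<] π) (𝓝 I) := by
  obtain ⟨M, hM⟩ := exists_norm_hankelIntegrand_le hα hs
  have hev : ∀ᶠ θ in 𝓝 π, cos θ < -(1 + α) / 2 :=
    continuous_cos.continuousAt.eventually_lt continuousAt_const
      (by rw [cos_pi]; linarith [hα.2])
  obtain ⟨δ, hδ, hδ'⟩ := Metric.eventually_nhds_iff.1 hev
  have h : Tendsto (fun θ : ℝ => M * (π - θ)) (𝓝[<] π) (𝓝 (M * (π - π))) :=
    ((tendsto_id.mono_left nhdsWithin_le_nhds).const_sub π).const_mul M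
  rw [sub_self, mul_zero] at h
  have hdiff : Tendsto (fun θ : ℝ => (G (descentLog α θ + π * Complex.I)).im -
      (G (descentLog α θ + θ * Complex.I)).im) (𝓝[<] π) (𝓝 0) := by
    refine squeeze_zero_norm' ?_ h
    filter_upwards [Ioo_mem_nhdsLT (show π - δ < π by linarith)] with θ hθ
    rw [← Complex.sub_im]
    refine (Complex.abs_im_le_norm _).trans (norm_primitive_vertical_le hG hθ.2.le ?_)
    intro y hy
    refine hM _ _ (hδ' ?_).le
    rw [dist_comm, Real.dist_eq, abs_of_nonneg (by linarith [hy.2])]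
    linarith [hθ.1, hy.1]
  simpa using (hI.comp (tendsto_descentLog hα)).sub hdiff

/-- Along the horizontal line of height `π`, the imaginary part of the integral of
`hankelIntegrand` is nonnegative and decays exponentially in `s`. -/
lemma limit_im_primitive_mem {α s I : ℝ} (hα : α ∈ Ioo (0 : ℝ) 1) (hs : 0 < s)
    {G : ℂ → ℂ} (hG : ∀ w, HasDerivAt G (hankelIntegrand α s w) w) (h0 : G 0 = 0)
    (hI : Tendsto (fun x : ℝ => (G (x + π * Complex.I)).im) atTop (𝓝 I)) :
    0 ≤ I ∧ I ≤ 2 / (s * (1 - α)) *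
      exp (-(s * (exp (α * (log α / (1 - α))) * (1 - α)) / 2)) * π := by
  have h3 : 0 < 1 - α := by linarith [hα.2]
  set κ := exp (α * (log α / (1 - α))) * (1 - α) with hκ
  have hκ0 : 0 < κ := by positivity
  set A := 2 / (s * (1 - α)) * exp (-(s * κ / 2)) with hA
  set f : ℝ → ℝ := fun θ => (G (descentLog α θ + θ * Complex.I)).im with hf
  set f' : ℝ → ℝ := fun θ => exp (-(s * descentExponent α θ)) * descentExponent α θ / (1 - α)
  have hd : ∀ θ ∈ Ioo 0 π, HasDerivAt f (f' θ) θ :=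
    fun θ hθ => hasDerivAt_im_primitive_descent hα hθ hG
  have hf'0 : ∀ θ ∈ Ioo 0 π, 0 ≤ f' θ := fun θ hθ => by
    have := hκ0.trans_le (descentExponent_lower hα hθ)
    positivity
  have hf'A : ∀ θ ∈ Ioo 0 π, f' θ ≤ A := fun θ hθ => by
    have hK := descentExponent_lower hα hθ
    have hK0 := hκ0.trans_le hK
    simp only [f', hA]
    set K := descentExponent α θ
    have h1 : s * K / 2 ≤ exp (s * K / 2) := by linarith [add_one_le_exp (s * K / 2)]
    have h2 : exp (-(s * K)) * exp (s * K / 2) ≤ exp (-(s * κ / 2)) := by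
      rw [← exp_add, exp_le_exp]
      nlinarith
    calc exp (-(s * K)) * K / (1 - α)
        = 2 / (s * (1 - α)) * (exp (-(s * K)) * (s * K / 2)) := by field_simp
      _ ≤ 2 / (s * (1 - α)) * (exp (-(s * K)) * exp (s * K / 2)) := by gcongr
      _ ≤ _ := by gcongr
  have hc : ContinuousOn f (Ioo 0 π) := fun θ hθ => (hd θ hθ).continuousAt.continuousWithinAt
  have hdiff : DifferentiableOn ℝ f (interior (Ioo 0 π)) := by
    rw [interior_Ioo]
    exact fun θ hθ => (hd θ hθ).differentiableAt.differentiableWithinAt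
  have hmem0 : ∀ᶠ θ in 𝓝[>] (0 : ℝ), θ ∈ Ioo 0 π := Ioo_mem_nhdsGT pi_pos
  have hmemπ : ∀ᶠ θ in 𝓝[<] π, θ ∈ Ioo 0 π := Ioo_mem_nhdsLT pi_pos
  have hlim0 : Tendsto f (𝓝[>] 0) (𝓝 0) := tendsto_im_primitive_descent_zero hα hs.le hG h0
  have hlimπ : Tendsto f (𝓝[<] π) (𝓝 I) := tendsto_im_primitive_descent_pi hα hs hG hI
  have hA0 : 0 < A := by positivity
  constructor
  · have hmono : MonotoneOn f (Ioo 0 π) := by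
      refine monotoneOn_of_deriv_nonneg (convex_Ioo _ _) hc hdiff fun θ hθ => ?_
      rw [interior_Ioo] at hθ
      rw [(hd θ hθ).deriv]
      exact hf'0 θ hθ
    refine ge_of_tendsto hlimπ ?_
    filter_upwards [hmemπ] with θ hθ
    refine le_of_tendsto hlim0 ?_
    filter_upwards [Ioo_mem_nhdsGT hθ.1] with η hη
    exact hmono ⟨hη.1, hη.2.trans hθ.2⟩ hθ hη.2.le
  · refine le_of_tendsto hlimπ ?_
    filter_upwards [hmemπ] with θ hθ
    have : Tendsto (fun η => f η + A * π) (𝓝[>] 0) (𝓝 (0 + A * π)) := hlim0.add_const _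
    rw [zero_add] at this
    refine ge_of_tendsto this ?_
    filter_upwards [Ioo_mem_nhdsGT hθ.1] with η hη
    have h := (convex_Ioo 0 π).image_sub_le_mul_sub_of_deriv_le hc hdiff (C := A)
      (fun x hx => by
        rw [interior_Ioo] at hx
        rw [(hd x hx).deriv]
        exact hf'A x hx) η ⟨hη.1, hη.2.trans hθ.2⟩ θ hθ hη.2.le
    nlinarith [hη.1, hθ.2]

/-- The dominating terms in the expansion of the Hankel-type integral. -/
noncomputable def hankelTerm (α s : ℝ) (k : ℕ) (u : ℝ) : ℝ :=
  exp (-(s * u)) * u ^ (α - 1) * ((s * u ^ α) ^ k / k.factorial)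

lemma hasSum_hankelTerm (α s u : ℝ) :
    HasSum (fun k => hankelTerm α s k u) (exp (-(s * u)) * u ^ (α - 1) * exp (s * u ^ α)) := by
  have := NormedSpace.expSeries_div_hasSum_exp (s * u ^ α)
  rw [← Real.exp_eq_exp_ℝ] at this
  exact this.mul_left _

lemma integrableOn_hankelBound {α s : ℝ} (hα : α ∈ Ioo (0 : ℝ) 1) (hs : 0 < s) :
    IntegrableOn (fun u : ℝ => exp (-(s * u)) * u ^ (α - 1) * exp (s * u ^ α)) (Ioi 0) := by
  have h3 : 0 < 1 - α := by linarith [hα.2]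
  have h := (integrableOn_rpow_mul_exp_neg_mul_rpow (p := 1) (s := α - 1) (b := s * (1 - α))
    (by linarith [hα.1]) one_pos (by positivity)).const_mul (exp (s * (1 - α)))
  refine h.mono' ?_ ?_
  · exact (by fun_prop : Measurable fun u : ℝ =>
      exp (-(s * u)) * u ^ (α - 1) * exp (s * u ^ α)).aestronglyMeasurable
  · filter_upwards [ae_restrict_mem measurableSet_Ioi] with u hu
    have hu : 0 < u := hu
    have hle := exp_mul_le hα (log u)
    rw [mul_comm α, ← rpow_def_of_pos hu, exp_log hu] at hle
    rw [Real.norm_of_nonneg (by positivity), rpow_one]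
    have hle' : -(s * u) + s * u ^ α ≤ s * (1 - α) + -(s * (1 - α)) * u := by nlinarith
    calc _ = u ^ (α - 1) * exp (-(s * u) + s * u ^ α) := by rw [exp_add]; ring
      _ ≤ u ^ (α - 1) * exp (s * (1 - α) + -(s * (1 - α)) * u) := by
          gcongr u ^ (α - 1) * ?_
          exact exp_le_exp.2 hle'
      _ = _ := by rw [exp_add]; ring

lemma abs_sign_mul_sin_le_one (k : ℕ) (x : ℝ) : |(-1) ^ k * sin x| ≤ 1 := by
  simpa [abs_mul] using abs_sin_le_one x

lemma norm_mul_hankelTerm_le {α s u a : ℝ} (hs : 0 ≤ s) (hu : 0 ≤ u) (ha : |a| ≤ 1) (k : ℕ) :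
    ‖a * hankelTerm α s k u‖ ≤ hankelTerm α s k u := by
  have : 0 ≤ hankelTerm α s k u := by unfold hankelTerm; positivity
  rw [norm_mul, Real.norm_of_nonneg this]
  exact mul_le_of_le_one_left this ha

lemma integral_hankelTerm {α s : ℝ} (hα : 0 < α) (hs : 0 < s) (k : ℕ) :
    ∫ u in Ioi 0, hankelTerm α s k u =
      s ^ (-α) * ((s ^ (1 - α)) ^ k * (Gamma (α * (k + 1)) / k.factorial)) := by
  have h := integral_rpow_mul_exp_neg_mul_Ioi (a := α * (k + 1)) (r := s) (by positivity) hs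
  have h1 : ∫ u in Ioi 0, hankelTerm α s k u = ∫ u in Ioi 0, s ^ k / k.factorial *
      (u ^ (α * (k + 1) - 1) * exp (-(s * u))) := by
    refine setIntegral_congr_fun measurableSet_Ioi fun u hu => ?_
    have hu : 0 < u := hu
    simp only [hankelTerm]
    rw [show α * ((k : ℝ) + 1) - 1 = (α - 1) + α * k by ring, rpow_add hu, rpow_mul hu.le,
      rpow_natCast, mul_pow]
    ring
  rw [h1, integral_const_mul, h]
  have h2 : s ^ k * (1 / s) ^ (α * ((k : ℝ) + 1)) = s ^ (-α) * (s ^ (1 - α)) ^ k := by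
    rw [one_div, inv_rpow hs.le, ← rpow_neg hs.le, ← rpow_natCast, ← rpow_natCast,
      ← rpow_mul hs.le, ← rpow_add hs, ← rpow_add hs]
    ring_nf
  linear_combination (Gamma (α * (k + 1)) / k.factorial) * h2

lemma hasSum_integral_hankelTerm {α s : ℝ} (hα : α ∈ Ioo (0 : ℝ) 1) (hs : 0 < s) {a : ℕ → ℝ}
    (ha : ∀ k, |a k| ≤ 1) {f : ℝ → ℝ}
    (hf : ∀ u, 0 < u → HasSum (fun k => a k * hankelTerm α s k u) (f u)) :
    HasSum (fun k : ℕ => a k * (s ^ (-α) *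
      ((s ^ (1 - α)) ^ k * (Gamma (α * (k + 1)) / k.factorial)))) (∫ u in Ioi 0, f u) := by
  have hmeas : ∀ k, Measurable (hankelTerm α s k) := fun k => by
    unfold hankelTerm; fun_prop
  have h := hasSum_integral_of_dominated_convergence (μ := volume.restrict (Ioi (0 : ℝ)))
    (F := fun k u => a k * hankelTerm α s k u) (f := f) (hankelTerm α s)
    (fun k => ((hmeas k).const_mul _).aestronglyMeasurable)
    (fun k => by
      filter_upwards [ae_restrict_mem measurableSet_Ioi] with u hu
        using norm_mul_hankelTerm_le hs.le (le_of_lt hu) (ha k) k)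
    (ae_of_all _ fun u => (hasSum_hankelTerm α s u).summable)
    (by
      simp only [(hasSum_hankelTerm α s _).tsum_eq]
      exact integrableOn_hankelBound hα hs)
    (by
      filter_upwards [ae_restrict_mem measurableSet_Ioi] with u hu using hf u hu)
  simpa only [integral_const_mul, integral_hankelTerm hα.1 hs] using h

lemma inv_Gamma_eq {x : ℝ} (hx : 0 < x) : 1 / Gamma (1 - x) = Gamma x * sin (π * x) / π := by
  have h := Gamma_mul_Gamma_one_sub x
  have hx' := (Gamma_pos_of_pos hx).ne'
  rw [mul_comm, ← eq_div_iff hx'] at h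
  rw [h]
  field_simp

lemma wrightPhi_term {α : ℝ} (hα : 0 < α) (z : ℝ) (k : ℕ) :
    (-z) ^ k / (k.factorial * Gamma (1 - α - α * k)) =
      (-1) ^ k * sin (π * (α * (k + 1))) * (z ^ k * (Gamma (α * (k + 1)) / k.factorial)) / π := by
  have h := inv_Gamma_eq (x := α * (k + 1)) (by positivity)
  rw [show 1 - α - α * (k : ℝ) = 1 - α * (k + 1) by ring, neg_pow z, div_mul_eq_div_div,
    div_eq_mul_one_div _ (Gamma _), h]
  ring

lemma exp_mul_log_add_pi {α u : ℝ} (hu : 0 < u) :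
    Complex.exp (α * (log u + π * Complex.I)) =
      (u ^ α : ℝ) * Complex.exp ((π * α : ℝ) * Complex.I) := by
  rw [rpow_def_of_pos hu, Complex.ofReal_exp, ← Complex.exp_add]
  push_cast; ring_nf

lemma hankelIntegrand_log_add_pi {α s u : ℝ} (hu : 0 < u) :
    hankelIntegrand α s (log u + π * Complex.I) =
      (exp (-(s * u)) * u ^ α : ℝ) * (Complex.exp ((π * α : ℝ) * Complex.I) *
        Complex.exp (-(s * u ^ α : ℝ) * Complex.exp ((π * α : ℝ) * Complex.I))) := by
  have h1 : Complex.exp (log u + π * Complex.I) = -u := by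
    rw [Complex.exp_add, Complex.exp_pi_mul_I, ← Complex.ofReal_exp, exp_log hu]; ring
  rw [hankelIntegrand, exp_mul_log_add_pi hu, h1,
    show (s : ℂ) * (-u - (u ^ α : ℝ) * Complex.exp ((π * α : ℝ) * Complex.I)) =
      (-(s * u) : ℝ) + -(s * u ^ α : ℝ) * Complex.exp ((π * α : ℝ) * Complex.I) by push_cast; ring,
    Complex.exp_add, ← Complex.ofReal_exp]
  push_cast; ring

lemma hasSum_im_hankelIntegrand {α s u : ℝ} (hu : 0 < u) :
    HasSum (fun k : ℕ => (-1) ^ k * sin (π * (α * (k + 1))) * hankelTerm α s k u)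
      ((hankelIntegrand α s (log u + π * Complex.I)).im / u) := by
  set e := Complex.exp ((π * α : ℝ) * Complex.I) with he
  have h := NormedSpace.expSeries_div_hasSum_exp (-(s * u ^ α : ℝ) * e)
  rw [← Complex.exp_eq_exp_ℂ] at h
  have h2 := Complex.hasSum_im (h.mul_left e)
  have h3 := h2.mul_left (exp (-(s * u)) * u ^ (α - 1))
  have hval : (hankelIntegrand α s (log u + π * Complex.I)).im / u =
      exp (-(s * u)) * u ^ (α - 1) * (e * Complex.exp (-(s * u ^ α : ℝ) * e)).im := by
    rw [hankelIntegrand_log_add_pi hu, Complex.im_ofReal_mul, rpow_sub_one hu.ne']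
    ring
  rw [hval]
  refine h3.congr_fun fun k => ?_
  have hk : e * ((-(s * u ^ α : ℝ) * e) ^ k / k.factorial) =
      ((-(s * u ^ α)) ^ k / k.factorial : ℝ) *
        Complex.exp ((π * (α * (k + 1)) : ℝ) * Complex.I) := by
    have : Complex.exp ((π * (α * (k + 1)) : ℝ) * Complex.I) = e * e ^ k := by
      rw [he, ← Complex.exp_nat_mul, ← Complex.exp_add]
      push_cast; ring_nf
    rw [this, mul_pow]
    push_cast; ring
  rw [hk, Complex.im_ofReal_mul, Complex.exp_ofReal_mul_I_im, hankelTerm, neg_pow]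
  ring

lemma tendsto_im_primitive_atTop {α s : ℝ} (hα : α ∈ Ioo (0 : ℝ) 1) (hs : 0 < s)
    {G : ℂ → ℂ} (hG : ∀ w, HasDerivAt G (hankelIntegrand α s w) w) (h0 : G 0 = 0) :
    Tendsto (fun x : ℝ => (G (x + π * Complex.I)).im) atTop
      (𝓝 (∫ u in Ioi 0, (hankelIntegrand α s (log u + π * Complex.I)).im / u)) := by
  set f' : ℝ → ℝ := fun u => (hankelIntegrand α s (log u + π * Complex.I)).im / u with hf'
  set f : ℝ → ℝ := fun u => (G (log u + π * Complex.I)).im with hf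
  have hd : ∀ u ∈ Ioi (0 : ℝ), HasDerivAt f (f' u) u := fun u hu => by
    have hu : 0 < u := hu
    have hγ : HasDerivAt (fun u : ℝ => (log u : ℂ) + π * Complex.I) ((u⁻¹ : ℝ) : ℂ) u :=
      (hasDerivAt_log hu.ne').ofReal_comp.add_const _
    refine (hasDerivAt_im ((hG _).comp u hγ)).congr_deriv ?_
    rw [mul_comm, Complex.im_ofReal_mul, hf']
    ring
  have hint : IntegrableOn f' (Ioi 0) := by
    refine (integrableOn_hankelBound hα hs).mono' ?_ ?_
    · refine ContinuousOn.aestronglyMeasurable (fun u hu => ?_) measurableSet_Ioi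
      have hu : 0 < u := hu
      have hlog : ContinuousAt (fun u : ℝ => (log u : ℂ) + π * Complex.I) u :=
        (Complex.continuous_ofReal.continuousAt.comp (continuousAt_log hu.ne')).add_const _
      have hF := ((differentiable_hankelIntegrand α s).continuous.continuousAt).comp hlog
      exact ((Complex.continuous_im.continuousAt.comp hF).div continuousAt_id
        hu.ne').continuousWithinAt
    · filter_upwards [ae_restrict_mem measurableSet_Ioi] with u hu
      have hu : 0 < u := hu
      exact (hasSum_im_hankelIntegrand hu).norm_le_of_bounded (hasSum_hankelTerm α s u)
        fun k => norm_mul_hankelTerm_le hs.le hu.le (abs_sign_mul_sin_le_one k _) k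
  have hlim0 : Tendsto f (𝓝[>] 0) (𝓝 0) :=
    (tendsto_im_primitive_atBot hα.1 hs.le hG h0).comp tendsto_log_nhdsGT_zero
  have hd' : ∀ u ∈ Ioi (0 : ℝ), HasDerivAt (Function.update f 0 0) (f' u) u := fun u hu => by
    refine (hd u hu).congr_of_eventuallyEq ?_
    filter_upwards [Ioi_mem_nhds hu] with v hv
    exact Function.update_of_ne (ne_of_gt hv) _ _
  have hcont : ContinuousWithinAt (Function.update f 0 0) (Ici 0) 0 := by
    rw [continuousWithinAt_update_same, Ici_sdiff_left]
    exact hlim0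
  have hlim := tendsto_limUnder_of_hasDerivAt_of_integrableOn_Ioi hd' hint
  have heq := integral_Ioi_of_hasDerivAt_of_tendsto hcont hd' hint hlim
  rw [Function.update_self, sub_zero] at heq
  rw [← heq] at hlim
  refine (hlim.comp tendsto_exp_atTop).congr fun x => ?_
  simp [hf]

lemma exists_primitive_hankelIntegrand (α s : ℝ) :
    ∃ G : ℂ → ℂ, (∀ w, HasDerivAt G (hankelIntegrand α s w) w) ∧ G 0 = 0 := by
  obtain ⟨G, h0, hG⟩ := (differentiable_hankelIntegrand α s).isExactOn_univ.with_val_at 0 0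
  exact ⟨G, fun w => hG w (mem_univ w), h0⟩

lemma wrightPhi_eq_integral {α s : ℝ} (hα : α ∈ Ioo (0 : ℝ) 1) (hs : 0 < s) :
    wrightPhi α (s ^ (1 - α)) = s ^ α / π *
      ∫ u in Ioi 0, (hankelIntegrand α s (log u + π * Complex.I)).im / u := by
  have h := (hasSum_integral_hankelTerm hα hs (fun k => abs_sign_mul_sin_le_one k _)
    (fun u hu => hasSum_im_hankelIntegrand hu)).mul_left (s ^ α / π)
  rw [← h.tsum_eq, wrightPhi]
  refine tsum_congr fun k => ?_
  rw [wrightPhi_term hα.1, rpow_neg hs.le]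
  have := (rpow_pos_of_pos hs α).ne'
  field_simp

lemma wrightPhi_nonneg_and_le {α s : ℝ} (hα : α ∈ Ioo (0 : ℝ) 1) (hs : 0 < s) :
    0 ≤ wrightPhi α (s ^ (1 - α)) ∧ wrightPhi α (s ^ (1 - α)) ≤ s ^ α * (2 / (s * (1 - α)) *
      exp (-(s * (exp (α * (log α / (1 - α))) * (1 - α)) / 2))) := by
  obtain ⟨G, hG, h0⟩ := exists_primitive_hankelIntegrand α s
  obtain ⟨h1, h2⟩ := limit_im_primitive_mem hα hs hG h0 (tendsto_im_primitive_atTop hα hs hG h0)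
  rw [wrightPhi_eq_integral hα hs]
  refine ⟨by positivity, (mul_le_mul_of_nonneg_left h2 (by positivity)).trans_eq ?_⟩
  field_simp

lemma exists_wrightPhi_le_of_le_one {α : ℝ} (hα : α ∈ Ioo (0 : ℝ) 1) :
    ∃ C : ℝ, 0 ≤ C ∧ ∀ z : ℝ, 0 ≤ z → z ≤ 1 → wrightPhi α z ≤ C := by
  have hsum := (hasSum_integral_hankelTerm hα one_pos (a := fun _ => 1) (by simp)
    (fun u _ => by simpa using hasSum_hankelTerm α 1 u)).summable
  simp only [one_rpow, one_pow, one_mul] at hsum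
  have hpos : ∀ k : ℕ, 0 ≤ Gamma (α * (k + 1)) / k.factorial := fun k => by
    have := Gamma_pos_of_pos (mul_pos hα.1 (Nat.cast_add_one_pos (α := ℝ) k))
    positivity
  refine ⟨∑' k : ℕ, Gamma (α * (k + 1)) / k.factorial, tsum_nonneg hpos, fun z hz0 hz1 => ?_⟩
  rw [wrightPhi]
  refine (le_norm_self _).trans (tsum_of_norm_bounded hsum.hasSum fun k => ?_)
  rw [wrightPhi_term hα.1, norm_div, norm_mul, Real.norm_of_nonneg pi_pos.le,
    Real.norm_of_nonneg (mul_nonneg (pow_nonneg hz0 k) (hpos k)), div_le_iff₀ pi_pos]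
  have h1 := abs_sign_mul_sin_le_one k (π * (α * (k + 1)))
  have h2 : z ^ k ≤ 1 := pow_le_one₀ hz0 hz1
  calc _ ≤ 1 * (1 * (Gamma (α * (k + 1)) / k.factorial)) := by
        have := hpos k
        gcongr
        exact h1
    _ ≤ _ := by nlinarith [hpos k, pi_gt_three]

/-- The Wright function is nonnegative and decays like a stretched exponential. -/
lemma exists_wrightPhi_bound {α : ℝ} (hα : α ∈ Ioo (0 : ℝ) 1) :
    ∃ C : ℝ, 0 < C ∧ ∃ c : ℝ, 0 < c ∧ ∀ s : ℝ, 0 < s →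
      0 ≤ wrightPhi α (s ^ (1 - α)) ∧ wrightPhi α (s ^ (1 - α)) ≤ C * exp (-c * s) := by
  have h3 : 0 < 1 - α := by linarith [hα.2]
  obtain ⟨C₁, hC₁, hb⟩ := exists_wrightPhi_le_of_le_one hα
  set c := exp (α * (log α / (1 - α))) * (1 - α) / 2 with hc
  have hc0 : 0 < c := by positivity
  refine ⟨2 / (1 - α) + C₁ * exp c, by positivity, c, hc0, fun s hs => ?_⟩
  obtain ⟨h1, h2⟩ := wrightPhi_nonneg_and_le hα hs
  refine ⟨h1, ?_⟩
  rw [add_mul]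
  rcases le_total s 1 with hs1 | hs1
  · have h4 := hb _ (rpow_nonneg hs.le (1 - α)) (rpow_le_one hs.le hs1 h3.le)
    have h5 : 1 ≤ exp c * exp (-c * s) := by
      rw [← exp_add]
      exact one_le_exp (by nlinarith)
    have h6 : 0 ≤ 2 / (1 - α) * exp (-c * s) := by positivity
    nlinarith
  · have h4 : s ^ α ≤ s := by simpa using rpow_le_rpow_of_exponent_le hs1 hα.2.le
    have h5 : -(s * (exp (α * (log α / (1 - α))) * (1 - α)) / 2) = -c * s := by rw [hc]; ring
    rw [h5] at h2
    calc _ ≤ s * (2 / (s * (1 - α)) * exp (-c * s)) := h2.trans (by gcongr)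
      _ = 2 / (1 - α) * exp (-c * s) := by field_simp
      _ ≤ _ := le_add_of_nonneg_right (by positivity)

end WrightFunction

/-- There exist constants `C, c > 0` depending only on `α` such that for all `s, t > 0`,
`0 ≤ φ_{t,α}(s) ≤ C t^{-α} exp(-c s^{1/(1-α)} t^{-α/(1-α)})`. -/
theorem phiSub_nonneg_and_bound
    (α : ℝ) (hα : α ∈ Set.Ioo (0 : ℝ) 1) :
    ∃ C : ℝ, 0 < C ∧ ∃ c : ℝ, 0 < c ∧ ∀ s t : ℝ, 0 < s → 0 < t →
      0 ≤ phiSub α t s ∧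
      phiSub α t s ≤
        C * t ^ (-α) * Real.exp (-c * s ^ ((1:ℝ) / (1 - α)) * t ^ (-α / (1 - α))) := by
  obtain ⟨C, hC, c, hc, h⟩ := WrightFunction.exists_wrightPhi_bound hα
  refine ⟨C, hC, c, hc, fun s t hs ht => ?_⟩
  have h3 : 1 - α ≠ 0 := by linarith [hα.2]
  obtain ⟨h1, h2⟩ := h (s ^ ((1:ℝ) / (1 - α)) * t ^ (-α / (1 - α))) (by positivity)
  have hz : (s ^ ((1:ℝ) / (1 - α)) * t ^ (-α / (1 - α))) ^ (1 - α) = s * t ^ (-α) := by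
    rw [mul_rpow (by positivity) (by positivity), ← rpow_mul hs.le, ← rpow_mul ht.le,
      div_mul_cancel₀ _ h3, div_mul_cancel₀ _ h3, rpow_one]
  rw [hz] at h1 h2
  rw [← mul_assoc] at h2
  refine ⟨by unfold phiSub; positivity, ?_⟩
  rw [phiSub, mul_comm C, mul_assoc]
  gcongr
end
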